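/- arXiv:math/0109014 — 4 statements merged into one kernel-verified Lean document; each statement's English description precedes it below -/
import Mathlib

section
/- Let d ≥ 8 be an even integer. Then every nontrivial projective representation of the alternating group A_{d+2} in characteristic zero has dimension ≠ d; that is, for every field F of characteristic 0, every group homomorphism A_{d+2} → PGL_d(F) is trivial. -/
/-- The projective general linear group `PGL_a(F)`: the quotient of `GL_a(F)` by its
center. -/
abbrev ProjGL (a : ℕ) (F : Type*) [Field F] : Type _ :=
  GL (Fin a) F ⧸ Subgroup.center (GL (Fin a) F)

section LinearAlgebra

variable {F V : Type*} [Field F] [AddCommGroup V] [Module F V]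

/-- Operators `x k` satisfying Carmichael's relations, together with a vector behaving like
`e₁ - e₂` in the standard representation, act on the vectors `x k v` like in that
representation. -/
lemma carmichael_apply [CharZero F] {ι : Type*} (x : ι → Module.End F V) (v : V)
    (hcube : ∀ k w, x k (x k (x k w)) = w)
    (hrel : ∀ k l, k ≠ l → ∀ w, x k (x l (x k (x l w))) = w)
    (hsum : ∀ k, v + x k v + x k (x k v) = 0)
    (hfix : ∀ j k l, k ≠ j → l ≠ j → x k (x k (x j v)) = x l (x l (x j v)))
    (hthree : ∀ j k : ι, ∃ l, l ≠ j ∧ l ≠ k) {i j : ι} (hij : i ≠ j) :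
    x j (x i v) = x i v - x j v := by
  have hsq : ∀ k, x k (x k v) = -v - x k v := fun k => by
    have := hsum k
    linear_combination (norm := module) this
  have hexp : ∀ i j, i ≠ j → x j (x i v) = v + x i v - x i (x i (x j v)) := by
    intro i j hij
    have h1 := congrArg (fun w => x i (x i (x j (x j w)))) (hrel j i hij.symm v)
    simp only [hcube] at h1
    rw [h1, hsq j]
    simp only [map_sub, map_neg, hsq i]
    abel
  have hD : ∀ i j, i ≠ j → x i (x i (x j v)) =
      x i v + v + x j v - x j (x j (x i v)) - x i (x j (x j (x i v))) := by
    intro i j hij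
    conv_lhs => rw [hexp j i hij.symm]
    simp only [map_sub, map_add]
    rw [hexp j i hij.symm]
    abel
  have hG : ∀ i j k l, i ≠ j → k ≠ l → x i (x i (x j v)) - x j v = x k (x k (x l v)) - x l v := by
    intro i j k l hij hkl
    by_cases hjl : j = l
    · subst hjl
      rw [hfix j i k hij hkl]
    · obtain ⟨m, hmj, hml⟩ := hthree j l
      rw [hfix j i m hij hmj, hfix l k m hkl hml, hD m j hmj, hD m l hml,
        hfix m j l hmj.symm hml.symm]
      abel
  set g := x i (x i (x j v)) - x j v - v with hg
  have h2 : x j (x j (x i v)) = g + x i v + v := by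
    have := hG i j j i hij hij.symm
    rw [hg, this]; abel
  have h3 : x i (x i (x j v)) = g + x j v + v := by rw [hg]; abel
  have h4 : x i g = -(2 : F) • g := by
    have := hD i j hij
    rw [h2, h3] at this
    simp only [map_add, hsq] at this
    rw [neg_smul, two_smul]
    linear_combination (norm := module) this
  have h5 := hcube i g
  simp only [h4, map_smul, smul_smul] at h5
  have h6 : (9 : F) • g = 0 := by
    linear_combination (norm := module) (-1 : F) • h5
  have h7 : g = 0 := by
    rcases smul_eq_zero.1 h6 with h | h
    · norm_num at h
    · exact h
  rw [hexp i j hij, h3, h7]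
  abel

/-- In the situation of `carmichael_apply`, the vectors `v` and `x k v` are linearly
independent. -/
lemma carmichael_card_lt_finrank [CharZero F] [FiniteDimensional F V] {ι : Type*} [Fintype ι]
    (x : ι → Module.End F V) (v : V) (hv : v ≠ 0)
    (hcube : ∀ k w, x k (x k (x k w)) = w)
    (hrel : ∀ k l, k ≠ l → ∀ w, x k (x l (x k (x l w))) = w)
    (hsum : ∀ k, v + x k v + x k (x k v) = 0)
    (hfix : ∀ j k l, k ≠ j → l ≠ j → x k (x k (x j v)) = x l (x l (x j v)))
    (hthree : ∀ j k : ι, ∃ l, l ≠ j ∧ l ≠ k)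
    (W : Submodule F V) (hW : v ∈ W) (hxW : ∀ k, x k v ∈ W) :
    Fintype.card ι + 1 ≤ Module.finrank F W := by
  classical
  have hact : ∀ i j, i ≠ j → x j (x i v) = x i v - x j v := fun i j hij =>
    carmichael_apply x v hcube hrel hsum hfix hthree hij
  have hsq : ∀ k, x k (x k v) = -v - x k v := fun k => by
    have := hsum k
    linear_combination (norm := module) this
  -- `x k v` is not proportional to `v`
  have hprop : ∀ k (c : F), x k v ≠ c • v := by
    intro k c hc
    have hc1 : (c * c + c + 1) • v = 0 := by
      have := hsum k
      simp only [hc, map_smul, smul_smul] at this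
      rw [← this]; module
    have hc2 : c * c + c + 1 = 0 := (smul_eq_zero.1 hc1).resolve_right hv
    obtain ⟨l, hl, -⟩ := hthree k k
    have h1 := hact k l hl.symm
    rw [hc, map_smul] at h1
    have h2 : x l v = (1 + c) • v := by
      have h3 : (1 + c) • x l v = c • v := by
        rw [add_smul, h1]; module
      have h4 : (-c) • x l v = (1 + c) • (-c) • v := by
        have h5 := congrArg (fun w => (1 + c) • w) h3
        simp only [smul_smul] at h5
        have e1 : (1 + c) * (1 + c) = c := by linear_combination hc2
        have e2 : (1 + c) * c = -1 := by linear_combination hc2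
        rw [e1, e2] at h5
        rw [neg_smul, h5, smul_smul]
        have e3 : (1 + c) * -c = 1 := by linear_combination -hc2
        rw [e3]; module
      have hc0 : -c ≠ 0 := by
        rintro h
        have : c = 0 := by simpa using h
        rw [this] at hc2; norm_num at hc2
      rw [smul_comm] at h4
      exact smul_right_injective V hc0 h4
    have h6 := hsum l
    simp only [h2, map_smul, smul_smul] at h6
    have h7 : (2 * (1 + c)) • v = 0 := by
      rw [← h6]
      have : 2 * (1 + c) = 1 + (1 + c) + (1 + c) * (1 + c) := by linear_combination -hc2
      rw [this]; module
    have h8 : 2 * (1 + c) = 0 := (smul_eq_zero.1 h7).resolve_right hv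
    have h9 : c = -1 := by linear_combination h8 / 2
    rw [h9] at hc2; norm_num at hc2
  have hind2 : ∀ k (a b : F), a • x k v = b • v → a = 0 ∧ b = 0 := by
    intro k a b hab
    by_cases ha : a = 0
    · refine ⟨ha, ?_⟩
      rw [ha, zero_smul] at hab
      exact (smul_eq_zero.1 hab.symm).resolve_right hv
    · exfalso
      apply hprop k (a⁻¹ * b)
      rw [mul_smul, ← hab, smul_smul, inv_mul_cancel₀ ha, one_smul]
  have hli : LinearIndependent F
      (fun o : Option ι => (o.elim ⟨v, hW⟩ (fun k => ⟨x k v, hxW k⟩) : W)) := by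
    apply LinearIndependent.of_comp W.subtype
    rw [Fintype.linearIndependent_iff]
    intro g hg
    rw [Fintype.sum_option] at hg
    simp only [Function.comp, Option.elim, Submodule.subtype_apply] at hg
    have hkey : ∀ j, g (some j) = - g none ∧
        -(∑ i, g (some i)) - g (some j) + g none = 0 := by
      intro j
      have h1 := congrArg (x j) hg
      simp only [map_add, map_sum, map_smul, map_zero] at h1
      have h2 : ∑ i, g (some i) • x j (x i v) =
          ∑ i, g (some i) • x i v - (∑ i, g (some i)) • x j v
            - g (some j) • (v + x j v) := by
        have : ∀ i, g (some i) • x j (x i v) = g (some i) • x i v - g (some i) • x j v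
            - if i = j then g (some j) • (v + x j v) else 0 := by
          intro i
          split_ifs with h
          · subst h; rw [hsq]; module
          · rw [hact i j h]; module
        simp only [this, Finset.sum_sub_distrib, Finset.sum_ite_eq', Finset.mem_univ, if_true,
          ← Finset.sum_smul]
      rw [h2] at h1
      have h3 : (-(∑ i, g (some i)) - g (some j) + g none) • x j v
          = (g (some j) + g none) • v := by
        linear_combination (norm := module) h1 - hg
      obtain ⟨h4, h5⟩ := hind2 j _ _ h3
      exact ⟨by linear_combination h5, h4⟩
    have hnone : g none = 0 := by
      by_cases hι : IsEmpty ι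
      · have : g none • v = 0 := by simpa using hg
        exact (smul_eq_zero.1 this).resolve_right hv
      · rw [not_isEmpty_iff] at hι
        obtain ⟨j⟩ := hι
        have h6 := (hkey j).2
        rw [Finset.sum_congr rfl (fun i _ => (hkey i).1), (hkey j).1] at h6
        simp only [Finset.sum_const, Finset.card_univ, nsmul_eq_mul] at h6
        have h7 : ((Fintype.card ι + 2 : ℕ) : F) * g none = 0 := by
          push_cast; linear_combination h6
        rcases mul_eq_zero.1 h7 with h | h
        · exact absurd (Nat.cast_eq_zero.1 h) (by omega)
        · exact h
    intro o
    cases o with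
    | none => exact hnone
    | some j => rw [(hkey j).1, hnone, neg_zero]
  have := hli.fintype_card_le_finrank
  simpa using this

end LinearAlgebra

section LinearAlgebra

variable {F V : Type*} [Field F] [AddCommGroup V] [Module F V]

lemma finrank_add_finrank_inf_eigenspace_le [FiniteDimensional F V] (W : Submodule F V)
    (K : Module.End F V) {a b : F} (hab : a ≠ b) :
    Module.finrank F (W ⊓ K.eigenspace a : Submodule F V) +
      Module.finrank F (W ⊓ K.eigenspace b : Submodule F V) ≤ Module.finrank F W := by
  have hdis : Disjoint (W ⊓ K.eigenspace a) (W ⊓ K.eigenspace b) :=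
    (K.eigenspaces_iSupIndep.pairwiseDisjoint hab).mono inf_le_right inf_le_right
  rw [← Submodule.finrank_sup_add_finrank_inf_eq, hdis.eq_bot, finrank_bot, add_zero]
  exact Submodule.finrank_mono (sup_le inf_le_left inf_le_left)

lemma finrank_add_three_inf_eigenspace_le [FiniteDimensional F V] (W : Submodule F V)
    (K : Module.End F V) {a b c : F} (hab : a ≠ b) (hac : a ≠ c) (hbc : b ≠ c) :
    Module.finrank F (W ⊓ K.eigenspace a : Submodule F V) +
      Module.finrank F (W ⊓ K.eigenspace b : Submodule F V) +
      Module.finrank F (W ⊓ K.eigenspace c : Submodule F V) ≤ Module.finrank F W := by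
  have hdis : Disjoint (W ⊓ K.eigenspace a) (W ⊓ K.eigenspace b) :=
    (K.eigenspaces_iSupIndep.pairwiseDisjoint hab).mono inf_le_right inf_le_right
  have hdis' : Disjoint ((W ⊓ K.eigenspace a) ⊔ (W ⊓ K.eigenspace b)) (W ⊓ K.eigenspace c) := by
    refine ((K.eigenspaces_iSupIndep c).mono inf_le_right ?_).symm
    refine sup_le ?_ ?_
    · exact inf_le_right.trans (le_iSup₂_of_le a hac le_rfl)
    · exact inf_le_right.trans (le_iSup₂_of_le b hbc le_rfl)
  have h1 := Submodule.finrank_sup_add_finrank_inf_eq (W ⊓ K.eigenspace a) (W ⊓ K.eigenspace b)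
  have h2 := Submodule.finrank_sup_add_finrank_inf_eq
    ((W ⊓ K.eigenspace a) ⊔ (W ⊓ K.eigenspace b)) (W ⊓ K.eigenspace c)
  rw [hdis.eq_bot, finrank_bot, add_zero] at h1
  rw [hdis'.eq_bot, finrank_bot, add_zero] at h2
  rw [← h1, ← h2]
  exact Submodule.finrank_mono (sup_le (sup_le inf_le_left inf_le_left) inf_le_left)

/-- A nonzero space carrying `2 * m` pairwise anticommuting operators with nonzero scalar
squares has dimension at least `2 ^ m`. -/
lemma two_pow_le_finrank_of_anticommute [IsAlgClosed F] [CharZero F] [FiniteDimensional F V]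
    (m : ℕ) (z : ℕ → Module.End F V) (c : ℕ → F) (W : Submodule F V) (hW : W ≠ ⊥)
    (hst : ∀ i < 2 * m, ∀ w ∈ W, z i w ∈ W)
    (hsq : ∀ i < 2 * m, ∀ w ∈ W, z i (z i w) = c i • w)
    (hc : ∀ i < 2 * m, c i ≠ 0)
    (hanti : ∀ i < 2 * m, ∀ j < 2 * m, i ≠ j → ∀ w ∈ W, z i (z j w) = - z j (z i w)) :
    2 ^ m ≤ Module.finrank F W := by
  induction m generalizing W with
  | zero =>
    rw [pow_zero]
    exact Submodule.one_le_finrank_iff.2 hW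
  | succ m ih =>
    have l0 : 2 * m < 2 * (m + 1) := by omega
    have l1 : 2 * m + 1 < 2 * (m + 1) := by omega
    have l2 : 2 * m ≠ 2 * m + 1 := by omega
    set K : Module.End F V := z (2 * m) * z (2 * m + 1) with hK
    obtain ⟨a, ha⟩ := IsAlgClosed.exists_pow_nat_eq (-(c (2 * m) * c (2 * m + 1))) (n := 2) two_pos
    have ha0 : a ≠ 0 := by
      rintro rfl
      have := mul_ne_zero (hc _ l0) (hc _ l1)
      apply this
      linear_combination ha
    have hKW : ∀ w ∈ W, K w ∈ W := fun w hw => hst _ l0 _ (hst _ l1 _ hw)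
    have hKK : ∀ w ∈ W, K (K w) = (a * a) • w := by
      intro w hw
      simp only [hK, Module.End.mul_apply]
      rw [hanti _ l1 _ l0 l2.symm _ (hst _ l1 _ hw), map_neg, hsq _ l0 _ (hst _ l1 _ (hst _ l1 _ hw)),
        hsq _ l1 _ hw, smul_smul, ← neg_smul]
      congr 1
      linear_combination -ha
    have hKz : ∀ w ∈ W, K (z (2 * m) w) = - z (2 * m) (K w) := by
      intro w hw
      simp only [hK, Module.End.mul_apply]
      rw [hanti _ l1 _ l0 l2.symm _ hw, map_neg]
    have hKc : ∀ i < 2 * m, ∀ w ∈ W, K (z i w) = z i (K w) := by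
      intro i hi w hw
      have li : i < 2 * (m + 1) := by omega
      simp only [hK, Module.End.mul_apply]
      rw [hanti _ l1 _ li (by omega) _ hw, map_neg,
        hanti _ l0 _ li (by omega) _ (hst _ l1 _ hw), neg_neg]
    have hzinj : ∀ w ∈ W, w ≠ 0 → z (2 * m) w ≠ 0 := by
      intro w hw hw0 h
      have := hsq _ l0 w hw
      rw [h, map_zero] at this
      rcases smul_eq_zero.1 this.symm with h | h
      · exact hc _ l0 h
      · exact hw0 h
    have hswap : ∀ b : F, W ⊓ K.eigenspace b ≠ ⊥ → W ⊓ K.eigenspace (-b) ≠ ⊥ := by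
      intro b hb
      obtain ⟨w, ⟨hw, hwb⟩, hw0⟩ := Submodule.exists_mem_ne_zero_of_ne_bot hb
      refine (Submodule.ne_bot_iff _).2 ⟨z (2 * m) w, ⟨hst _ l0 _ hw, ?_⟩, hzinj w hw hw0⟩
      have hwb' := Module.End.mem_eigenspace_iff.1 hwb
      refine Module.End.mem_eigenspace_iff.2 ?_
      rw [hKz w hw, hwb', map_smul, neg_smul]
    have hex : W ⊓ K.eigenspace a ≠ ⊥ ∨ W ⊓ K.eigenspace (-a) ≠ ⊥ := by
      obtain ⟨w, hw, hw0⟩ := Submodule.exists_mem_ne_zero_of_ne_bot hW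
      by_cases h : K w + a • w = 0
      · right
        refine (Submodule.ne_bot_iff _).2 ⟨w, ⟨hw, ?_⟩, hw0⟩
        refine Module.End.mem_eigenspace_iff.2 ?_
        linear_combination (norm := module) h
      · left
        refine (Submodule.ne_bot_iff _).2 ⟨K w + a • w,
          ⟨W.add_mem (hKW w hw) (W.smul_mem _ hw), ?_⟩, h⟩
        refine Module.End.mem_eigenspace_iff.2 ?_
        rw [map_add, map_smul, hKK w hw]
        module
    have hboth : W ⊓ K.eigenspace a ≠ ⊥ ∧ W ⊓ K.eigenspace (-a) ≠ ⊥ := by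
      rcases hex with h | h
      · exact ⟨h, hswap _ h⟩
      · exact ⟨by simpa using hswap _ h, h⟩
    have hhalf : ∀ b : F, W ⊓ K.eigenspace b ≠ ⊥ →
        2 ^ m ≤ Module.finrank F (W ⊓ K.eigenspace b : Submodule F V) := by
      intro b hb
      refine ih _ hb ?_ ?_ ?_ ?_
      · rintro i hi w ⟨hw, hwb⟩
        refine ⟨hst i (by omega) w hw, Module.End.mem_eigenspace_iff.2 ?_⟩
        rw [hKc i hi w hw, Module.End.mem_eigenspace_iff.1 hwb, map_smul]
      · rintro i hi w ⟨hw, -⟩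
        exact hsq i (by omega) w hw
      · exact fun i hi => hc i (by omega)
      · rintro i hi j hj hij w ⟨hw, -⟩
        exact hanti i (by omega) j (by omega) hij w hw
    have hne : a ≠ -a := by
      intro h
      apply ha0
      linear_combination h / 2
    have := finrank_add_finrank_inf_eigenspace_le W K hne
    have h1 := hhalf _ hboth.1
    have h2 := hhalf _ hboth.2
    rw [pow_succ]
    omega

lemma tetrahedral_tst (s t : Module.End F V) (hs : ∀ w, s (s (s w)) = w)
    (hst : ∀ w, s (t (s (t w))) = w) (w : V) : t (s (t w)) = s (s w) := by
  rw [← hs (t (s (t w))), hst]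

lemma tetrahedral_sts (s t : Module.End F V) (ht : ∀ w, t (t (t w)) = w)
    (hst : ∀ w, s (t (s (t w))) = w) (w : V) : s (t (s w)) = t (t w) := by
  conv_lhs => rw [← ht w]
  rw [hst]

/-- If the Klein four-group of a tetrahedral group acts nontrivially on `W`, then some vector
of `W` is fixed by `t * s` but not by `s`. -/
lemma tetrahedral_exists_fixed [CharZero F] (s t : Module.End F V) (hs : ∀ w, s (s (s w)) = w)
    (ht : ∀ w, t (t (t w)) = w) (hst : ∀ w, s (t (s (t w))) = w)
    (W : Submodule F V) (hsW : ∀ w ∈ W, s w ∈ W)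
    (htW : ∀ w ∈ W, t w ∈ W) (hne : ∃ w ∈ W, s (t w) ≠ w) :
    ∃ e ∈ W, t (s e) = e ∧ s e ≠ e := by
  by_contra! hcon
  have tst := tetrahedral_tst s t hs hst
  have sts := tetrahedral_sts s t ht hst
  have hfs : ∀ w ∈ W, s (w + t (s w)) = w + t (s w) := by
    intro w hw
    refine hcon _ (W.add_mem hw (htW _ (hsW _ hw))) ?_
    simp only [map_add, sts, ht]
    abel
  have hft : ∀ w ∈ W, t (w + t (s w)) = w + t (s w) := by
    intro w hw
    conv_lhs => rw [← hfs w hw]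
    simp only [map_add, sts, ht]
    abel
  -- an involution conjugate to `s * t` is trivial on `W`
  have hinv : ∀ w ∈ W, s (s (t (s (s w)))) = w := by
    intro w hw
    set e := w + t (s w) with he
    set e' := s (s w) + t (s (s (s w))) with he'
    have h1 : t (s w) = e - w := by rw [he]; abel
    have hse : s e = e := hfs _ hw
    have hte : t e = e := hft _ hw
    have hse' : s e' = e' := hfs _ (hsW _ (hsW _ hw))
    have hte' : t e' = e' := hft _ (hsW _ (hsW _ hw))
    have h2 : s (t w) = e' - w := by
      have h3 : t w = e' - s (s w) := by rw [he', hs]; abel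
      rw [h3, map_sub, hse', hs]
    have h4 : s (s (t (s (s w)))) = w + (e - e') := by
      rw [sts, h1, map_sub, map_sub, hte, hse, h2]
      abel
    have h5 : s (s (t (s (s (w + (e - e')))))) = w := by
      rw [← h4, hs, tst, hs, hs]
    simp only [map_add, map_sub, hse, hse', hte, hte', h4] at h5
    have h6 : (2 : F) • (e - e') = 0 := by
      linear_combination (norm := module) h5
    rw [h4, (smul_eq_zero.1 h6).resolve_left two_ne_zero, add_zero]
  obtain ⟨w, hw, hw'⟩ := hne
  apply hw'
  have h7 := congrArg (fun y => s (s y)) (hinv (s w) (hsW w hw))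
  simpa only [hs] using h7

/-- A space on which the Klein four-group of a tetrahedral group acts nontrivially has
dimension at least three. -/
lemma tetrahedral_three_le_finrank [CharZero F] [FiniteDimensional F V]
    (s t : Module.End F V) (hs : ∀ w, s (s (s w)) = w)
    (ht : ∀ w, t (t (t w)) = w) (hst : ∀ w, s (t (s (t w))) = w)
    (W : Submodule F V) (hsW : ∀ w ∈ W, s w ∈ W)
    (htW : ∀ w ∈ W, t w ∈ W) (hne : ∃ w ∈ W, s (t w) ≠ w) :
    3 ≤ Module.finrank F W := by
  have tst := tetrahedral_tst s t hs hst
  have sts := tetrahedral_sts s t ht hst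
  -- a common eigenvector of the four-group
  obtain ⟨f, hf, hf0, hu, τ, hτ, hu'⟩ : ∃ f ∈ W, f ≠ 0 ∧ s (t f) = -f ∧
      ∃ τ : F, (τ = 1 ∨ τ = -1) ∧ t (s f) = τ • f := by
    obtain ⟨w, hw, hw'⟩ := hne
    set a := w - s (t w) with ha
    have haW : a ∈ W := W.sub_mem hw (hsW _ (htW _ hw))
    have ha0 : a ≠ 0 := fun h => hw' (sub_eq_zero.1 h).symm
    have hua : s (t a) = -a := by rw [ha]; simp only [map_sub, hst]; abel
    have hcomm : ∀ y, s (t (t (s y))) = t (s (s (t y))) := by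
      intro y
      calc s (t (t (s y))) = s (s (t (s (s y)))) := by rw [sts]
        _ = t (s (t (t (t (s (t y)))))) := by rw [tst, tst]
        _ = t (s (s (t y))) := by rw [ht]
    by_cases h : a + t (s a) = 0
    · refine ⟨a, haW, ha0, hua, -1, Or.inr rfl, ?_⟩
      linear_combination (norm := module) h
    · refine ⟨a + t (s a), W.add_mem haW (htW _ (hsW _ haW)), h, ?_, 1, Or.inl rfl, ?_⟩
      · rw [map_add, map_add, hua, hcomm, hua]
        simp only [map_neg]; abel
      · simp only [map_add, sts, ht]; module
  have hu3 : s (s (t (s (s f)))) = -(τ • f) := by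
    rw [sts, hu', map_smul, map_smul, hu, smul_neg]
  have hli : LinearIndependent F ![(⟨f, hf⟩ : W), ⟨s f, hsW _ hf⟩, ⟨s (s f), hsW _ (hsW _ hf)⟩] := by
    apply LinearIndependent.of_comp W.subtype
    rw [Fintype.linearIndependent_iff]
    intro g hg
    simp only [Fin.sum_univ_three, Function.comp, Matrix.cons_val_zero, Matrix.cons_val_one,
      Matrix.cons_val, Submodule.subtype_apply] at hg
    have hsf : ∀ y, s y = 0 → y = 0 := fun y hy => by rw [← hs y, hy, map_zero, map_zero]
    have e1 : s (t (s f)) = τ • s f := by rw [hu', map_smul]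
    have e2 : t (s (s f)) = -(τ • s f) := by
      rw [← hs (t (s (s f))), hu3, map_neg, map_smul]
    have e3 : s (t (s (s f))) = -(τ • s (s f)) := by rw [e2, map_neg, map_smul]
    have e4 : t (s (s (s f))) = -s (s f) := by
      rw [hs, ← hs (t f), hu, map_neg, map_neg]
    have c1 := congrArg (fun y => s (t y)) hg
    have c3 := congrArg (fun y => t (s y)) hg
    simp only [map_add, map_smul, map_zero, hu, e1, e3] at c1
    simp only [map_add, map_smul, map_zero, hu', e2, e4] at c3
    have hsf0 : s f ≠ 0 := fun h => hf0 (hsf _ h)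
    have hssf0 : s (s f) ≠ 0 := fun h => hsf0 (hsf _ h)
    have key : ∀ (c : F) (y : V), y ≠ 0 → (2 * c) • y = 0 → c = 0 := by
      intro c y hy h
      simpa using (smul_eq_zero.1 h).resolve_right hy
    have hall : g 0 = 0 ∧ g 1 = 0 ∧ g 2 = 0 := by
      rcases hτ with rfl | rfl
      · refine ⟨key _ f hf0 ?_, key _ _ hsf0 ?_, key _ _ hssf0 ?_⟩
        · linear_combination (norm := module) hg + c3
        · linear_combination (norm := module) hg + c1
        · linear_combination (norm := module) -c1 - c3
      · refine ⟨key _ f hf0 ?_, key _ _ hsf0 ?_, key _ _ hssf0 ?_⟩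
        · linear_combination (norm := module) -c1 - c3
        · linear_combination (norm := module) hg + c3
        · linear_combination (norm := module) hg + c1
    intro i
    fin_cases i
    · exact hall.1
    · exact hall.2.1
    · exact hall.2.2
  have := hli.fintype_card_le_finrank
  simpa using this

end LinearAlgebra

section TripleRep

variable {F V α : Type*} [Field F] [AddCommGroup V] [Module F V] [DecidableEq α]

/-- The action of the 3-cycle `x ↦ y ↦ z ↦ x` on points. -/
def rotate (x y z p : α) : α := if p = x then y else if p = y then z else if p = z then x else p

/-- A family of operators indexed by 3-cycles which is equivariant under conjugation and such that
the product of two 3-cycles `(x y i)` and `(x y j)` squares to the scalar `ε`. -/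
structure IsTripleRep (T : α → α → α → Module.End F V) (ε : F) : Prop where
  cyc : ∀ {x y z}, x ≠ y → x ≠ z → y ≠ z → T y z x = T x y z
  inv : ∀ {x y z}, x ≠ y → x ≠ z → y ≠ z → ∀ w, T x z y (T x y z w) = w
  cube : ∀ {x y z}, x ≠ y → x ≠ z → y ≠ z → ∀ w, T x y z (T x y z (T x y z w)) = w
  conj : ∀ {x y z p q r}, x ≠ y → x ≠ z → y ≠ z → p ≠ q → p ≠ r → q ≠ r → ∀ w,
    T x y z (T p q r w) =
      T (rotate x y z p) (rotate x y z q) (rotate x y z r) (T x y z w)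
  rel : ∀ {x y i j}, x ≠ y → x ≠ i → x ≠ j → y ≠ i → y ≠ j → i ≠ j → ∀ w,
    T x y i (T x y j (T x y i (T x y j w))) = ε • w

/-- `W` is invariant under all operators indexed by 3-cycles on `S`. -/
def TripleStable (T : α → α → α → Module.End F V) (S : Finset α) (W : Submodule F V) : Prop :=
  ∀ x ∈ S, ∀ y ∈ S, ∀ z ∈ S, x ≠ y → x ≠ z → y ≠ z → ∀ w ∈ W, T x y z w ∈ W

/-- Some double transposition on `S` acts nontrivially on `W`. -/
def TripleNontrivial (T : α → α → α → Module.End F V) (S : Finset α) (W : Submodule F V) : Prop :=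
  ∃ x ∈ S, ∃ y ∈ S, ∃ i ∈ S, ∃ j ∈ S, [x, y, i, j].Nodup ∧ ∃ w ∈ W, T x y i (T x y j w) ≠ w

lemma Finset.exists_mem_ne_of_length_lt {S : Finset α} (l : List α) (h : l.length < S.card) :
    ∃ x ∈ S, ∀ y ∈ l, x ≠ y := by
  have h1 : l.toFinset.card < S.card := (List.toFinset_card_le l).trans_lt h
  obtain ⟨x, hx, hxl⟩ := Finset.exists_mem_notMem_of_card_lt_card h1
  exact ⟨x, hx, fun y hy hxy => hxl (by simpa [hxy] using hy)⟩

namespace IsTripleRep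

variable {T : α → α → α → Module.End F V} {ε : F}

lemma comm (hT : IsTripleRep T ε) {x y z p q r : α} (h : [x, y, z, p, q, r].Nodup) (w : V) :
    T x y z (T p q r w) = T p q r (T x y z w) := by
  simp only [List.nodup_cons, List.mem_cons, List.not_mem_nil, not_or] at h
  have := hT.conj (x := x) (y := y) (z := z) (p := p) (q := q) (r := r)
    (by grind) (by grind) (by grind) (by grind) (by grind) (by grind) w
  simpa [rotate, show p ≠ x by grind, show p ≠ y by grind, show p ≠ z by grind,
    show q ≠ x by grind, show q ≠ y by grind, show q ≠ z by grind,
    show r ≠ x by grind, show r ≠ y by grind, show r ≠ z by grind] using this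

lemma injective (hT : IsTripleRep T ε) {x y z : α} (h1 : x ≠ y) (h2 : x ≠ z) (h3 : y ≠ z) :
    Function.Injective (T x y z) :=
  Function.LeftInverse.injective (hT.inv h1 h2 h3)

/-- A product of two 3-cycles realising the double transposition `(x y)(p q)`. -/
lemma swap_conj (hT : IsTripleRep T ε) {x y z p q : α} (h : [x, y, z, p, q].Nodup) (w : V) :
    T x y z (T x p y (T x p q w)) = T x p y (T x p q (T y x z w)) := by
  simp only [List.nodup_cons, List.mem_cons, List.not_mem_nil, not_or] at h
  have h1 := hT.conj (x := x) (y := p) (z := q) (p := y) (q := x) (r := z)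
    (by grind) (by grind) (by grind) (by grind) (by grind) (by grind) w
  have h2 := hT.conj (x := x) (y := p) (z := y) (p := y) (q := p) (r := z)
    (by grind) (by grind) (by grind) (by grind) (by grind) (by grind) (T x p q w)
  have e1 : rotate x p q y = y := by grind [rotate]
  have e2 : rotate x p q x = p := by grind [rotate]
  have e3 : rotate x p q z = z := by grind [rotate]
  have e4 : rotate x p y y = x := by grind [rotate]
  have e5 : rotate x p y p = y := by grind [rotate]
  have e6 : rotate x p y z = z := by grind [rotate]
  rw [e1, e2, e3] at h1
  rw [e4, e5, e6] at h2
  rw [h1, h2]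

lemma swap_conj_disjoint (hT : IsTripleRep T ε) {x y p q i : α} (h : [x, y, p, q, i].Nodup) (w : V) :
    T x p y (T x p q (T p q i w)) = T q p i (T x p y (T x p q w)) := by
  simp only [List.nodup_cons, List.mem_cons, List.not_mem_nil, not_or] at h
  have h1 := hT.conj (x := x) (y := p) (z := q) (p := p) (q := q) (r := i)
    (by grind) (by grind) (by grind) (by grind) (by grind) (by grind) w
  have h2 := hT.conj (x := x) (y := p) (z := y) (p := q) (q := x) (r := i)
    (by grind) (by grind) (by grind) (by grind) (by grind) (by grind) (T x p q w)
  have e1 : rotate x p q p = q := by grind [rotate]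
  have e2 : rotate x p q q = x := by grind [rotate]
  have e3 : rotate x p q i = i := by grind [rotate]
  have e4 : rotate x p y q = q := by grind [rotate]
  have e5 : rotate x p y x = p := by grind [rotate]
  have e6 : rotate x p y i = i := by grind [rotate]
  rw [e1, e2, e3] at h1
  rw [e4, e5, e6] at h2
  rw [h1, h2]

lemma swap_mem_eigenspace (hT : IsTripleRep T ε) {a b : F} (hab : a * b = 1)
    {S : Finset α} {W : Submodule F V}
    (hW : TripleStable T S W) {x y z p q : α} (hx : x ∈ S) (hy : y ∈ S)
    (hp : p ∈ S) (hq : q ∈ S) (h : [x, y, z, p, q].Nodup) {w : V}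
    (hw : w ∈ W ⊓ (T x y z).eigenspace a) :
    T x p y (T x p q w) ∈ W ⊓ (T x y z).eigenspace b := by
  have h' := h
  simp only [List.nodup_cons, List.mem_cons, List.not_mem_nil, not_or] at h
  obtain ⟨hwW, hwa⟩ := hw
  have hwa' := Module.End.mem_eigenspace_iff.1 hwa
  refine ⟨hW _ hx _ hp _ hy (by grind) (by grind) (by grind) _
    (hW _ hx _ hp _ hq (by grind) (by grind) (by grind) _ hwW),
    Module.End.mem_eigenspace_iff.2 ?_⟩
  rw [hT.swap_conj h']
  have h1 := hT.inv (x := y) (y := z) (z := x) (by grind) (by grind) (by grind) w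
  rw [hT.cyc (x := x) (y := y) (z := z) (by grind) (by grind) (by grind), hwa', map_smul] at h1
  have h2 : T y x z w = b • w := by
    conv_rhs => rw [← h1, smul_smul, mul_comm, hab, one_smul]
  rw [h2, map_smul, map_smul]

lemma stable_eigenspace (hT : IsTripleRep T ε) {S : Finset α} {W : Submodule F V}
    (hW : TripleStable T S W) {x y z : α} (hxy : x ≠ y) (hxz : x ≠ z) (hyz : y ≠ z) (a : F) :
    TripleStable T (S \ {x, y, z}) (W ⊓ (T x y z).eigenspace a) := by
  intro p hp q hq r hr hpq hpr hqr w hw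
  obtain ⟨hwW, hwa⟩ := hw
  simp only [Finset.mem_sdiff, Finset.mem_insert, Finset.mem_singleton, not_or] at hp hq hr
  refine ⟨hW p hp.1 q hq.1 r hr.1 hpq hpr hqr w hwW, Module.End.mem_eigenspace_iff.2 ?_⟩
  rw [hT.comm (by simp; grind), Module.End.mem_eigenspace_iff.1 hwa, map_smul]

lemma card_sdiff_triple {S : Finset α} {x y z : α} (hx : x ∈ S) (hy : y ∈ S) (hz : z ∈ S)
    (hxy : x ≠ y) (hxz : x ≠ z) (hyz : y ≠ z) : (S \ {x, y, z}).card + 3 = S.card := by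
  have h1 : ({x, y, z} : Finset α).card = 3 := Finset.card_eq_three.2 ⟨x, y, z, hxy, hxz, hyz, rfl⟩
  have h2 : ({x, y, z} : Finset α) ⊆ S := by
    intro p hp
    simp only [Finset.mem_insert, Finset.mem_singleton] at hp
    rcases hp with rfl | rfl | rfl <;> assumption
  have := Finset.card_sdiff_add_card_eq_card h2
  omega

end IsTripleRep

end TripleRep

section TripleRep

variable {F V α : Type*} [Field F] [AddCommGroup V] [Module F V] [DecidableEq α]

lemma sub_smul_mem_eigenspace_of_cube {a b : F} (hadd : a + b = -1) (hmul : a * b = 1)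
    (s : Module.End F V) (hs : ∀ w, s (s (s w)) = w) (w : V) :
    s (s w - w) - b • (s w - w) ∈ s.eigenspace a := by
  refine Module.End.mem_eigenspace_iff.2 ?_
  obtain rfl : a = -1 - b := by linear_combination hadd
  have h : b * b = -1 - b := by linear_combination -hmul
  simp only [map_sub, map_smul, hs, smul_sub, smul_smul]
  have e : (-1 - b) * b = 1 := hmul
  rw [e]
  module

/-- Quadratic combinations of operators with scalar anticommutators. -/
lemma sum_anticommutator {ι : Type*} [Fintype ι] [DecidableEq ι] (Y : ι → Module.End F V) (w : V)
    (h : ∀ i j, Y i (Y j w) + Y j (Y i w) = (-2 - if i = j then 4 else 0 : F) • w) (p q : ι → F) :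
    (∑ i, p i • Y i) ((∑ j, q j • Y j) w) + (∑ j, q j • Y j) ((∑ i, p i • Y i) w) =
      (-2 * (∑ i, p i) * (∑ j, q j) - 4 * ∑ i, p i * q i) • w := by
  have e1 : (∑ i, p i • Y i) ((∑ j, q j • Y j) w) = ∑ i, ∑ j, (p i * q j) • Y i (Y j w) := by
    simp only [LinearMap.sum_apply, LinearMap.smul_apply, map_sum, map_smul, Finset.smul_sum,
      smul_smul]
    rw [Finset.sum_comm]
    exact Finset.sum_congr rfl fun i _ => Finset.sum_congr rfl fun j _ => by rw [mul_comm]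
  have e2 : (∑ j, q j • Y j) ((∑ i, p i • Y i) w) = ∑ i, ∑ j, (p i * q j) • Y j (Y i w) := by
    simp only [LinearMap.sum_apply, LinearMap.smul_apply, map_sum, map_smul, Finset.smul_sum,
      smul_smul]
  rw [e1, e2, ← Finset.sum_add_distrib]
  simp only [← Finset.sum_add_distrib, ← smul_add, h, smul_smul, ← Finset.sum_smul]
  congr 1
  simp only [mul_sub, Finset.sum_sub_distrib, mul_ite, mul_zero, Finset.sum_ite_eq, Finset.mem_univ,
    if_true, ← Finset.sum_mul, ← Finset.mul_sum]
  ring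

/-- The Sylvester–Hadamard matrix of order eight. -/
def hadamardEight (r i : ℕ) : ℤ :=
  (-1) ^ ((r % 2) * (i % 2) + (r / 2 % 2) * (i / 2 % 2) + (r / 4 % 2) * (i / 4 % 2))

lemma hadamardEight_orthogonal : ∀ r < 8, ∀ s < 8, r ≠ s →
    -2 * (∑ i : Fin 8, hadamardEight r i) * (∑ i : Fin 8, hadamardEight s i)
      - 4 * ∑ i : Fin 8, hadamardEight r i * hadamardEight s i = 0 := by
  decide

lemma hadamardEight_self_ne_zero : ∀ r < 8,
    -2 * (∑ i : Fin 8, hadamardEight r i) * (∑ i : Fin 8, hadamardEight r i)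
      - 4 * ∑ i : Fin 8, hadamardEight r i * hadamardEight r i ≠ 0 := by
  decide

/-- Eight operators with the anticommutators of the basic spin representation force dimension
at least sixteen. -/
lemma sixteen_le_finrank_of_anticommutator [IsAlgClosed F] [CharZero F] [FiniteDimensional F V]
    (Y : Fin 8 → Module.End F V) (W : Submodule F V) (hW : W ≠ ⊥)
    (hst : ∀ i, ∀ w ∈ W, Y i w ∈ W)
    (h : ∀ i j, ∀ w ∈ W, Y i (Y j w) + Y j (Y i w) = (-2 - if i = j then 4 else 0 : F) • w) :
    16 ≤ Module.finrank F W := by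
  set z : ℕ → Module.End F V := fun r => ∑ i : Fin 8, ((hadamardEight r i : ℤ) : F) • Y i with hz
  have hanti : ∀ r s, ∀ w ∈ W, z r (z s w) + z s (z r w) =
      ((-2 * (∑ i : Fin 8, hadamardEight r i) * (∑ i : Fin 8, hadamardEight s i)
        - 4 * ∑ i : Fin 8, hadamardEight r i * hadamardEight s i : ℤ) : F) • w := by
    intro r s w hw
    have := sum_anticommutator Y w (fun i j => h i j w hw) (fun i => ((hadamardEight r i : ℤ) : F))
      (fun i => ((hadamardEight s i : ℤ) : F))
    rw [hz, this]
    push_cast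
    rfl
  have := two_pow_le_finrank_of_anticommute 4 z
    (fun r => ((-2 * (∑ i : Fin 8, hadamardEight r i) * (∑ i : Fin 8, hadamardEight r i)
        - 4 * ∑ i : Fin 8, hadamardEight r i * hadamardEight r i : ℤ) : F) / 2) W hW
    (fun r _ w hw => ?_) (fun r hr w hw => ?_) (fun r hr => ?_) (fun r hr s hs hrs w hw => ?_)
  · simpa using this
  · simp only [hz, LinearMap.sum_apply, LinearMap.smul_apply]
    exact W.sum_mem fun i _ => W.smul_mem _ (hst i w hw)
  · have h1 := hanti r r w hw
    rw [← two_smul F] at h1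
    rw [div_eq_inv_mul, mul_smul, ← h1, smul_smul, inv_mul_cancel₀ two_ne_zero, one_smul]
  · exact div_ne_zero (Int.cast_ne_zero.2 (hadamardEight_self_ne_zero r (by omega))) two_ne_zero
  · have h1 := hanti r s w hw
    rw [hadamardEight_orthogonal r (by omega) s (by omega) hrs, Int.cast_zero, zero_smul] at h1
    exact eq_neg_of_add_eq_zero_left h1

namespace IsTripleRep

variable {T : α → α → α → Module.End F V}

lemma eigenspace_ne_bot_swap {ε : F} (hT : IsTripleRep T ε) {a b : F} (hab : a * b = 1)
    {S : Finset α} {W : Submodule F V} (hW : TripleStable T S W) {x y z p q : α} (hx : x ∈ S)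
    (hy : y ∈ S) (hp : p ∈ S) (hq : q ∈ S) (h : [x, y, z, p, q].Nodup)
    (hne : W ⊓ (T x y z).eigenspace a ≠ ⊥) : W ⊓ (T x y z).eigenspace b ≠ ⊥ := by
  have h' := h
  simp only [List.nodup_cons, List.mem_cons, List.not_mem_nil, not_or] at h
  obtain ⟨w, hw, hw0⟩ := Submodule.exists_mem_ne_zero_of_ne_bot hne
  refine (Submodule.ne_bot_iff _).2 ⟨_, hT.swap_mem_eigenspace hab hW hx hy hp hq h' hw, ?_⟩
  rw [map_ne_zero_iff _ (hT.injective (by grind) (by grind) (by grind)),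
    map_ne_zero_iff _ (hT.injective (by grind) (by grind) (by grind))]
  exact hw0

lemma spin_eigenspace_ne_bot [CharZero F] (hT : IsTripleRep T (-1)) {a b : F}
    (hadd : a + b = -1) (hmul : a * b = 1) {S : Finset α} {W : Submodule F V} (hW0 : W ≠ ⊥)
    (hW : TripleStable T S W) {x y z p q : α} (hx : x ∈ S) (hy : y ∈ S) (hz : z ∈ S)
    (hp : p ∈ S) (hq : q ∈ S) (h : [x, y, z, p, q].Nodup) :
    W ⊓ (T x y z).eigenspace a ≠ ⊥ ∧ W ⊓ (T x y z).eigenspace b ≠ ⊥ := by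
  have h' := h
  simp only [List.nodup_cons, List.mem_cons, List.not_mem_nil, not_or] at h
  obtain ⟨w, hw, hne⟩ : ∃ w ∈ W, T x y z w ≠ w := by
    by_contra! hid
    obtain ⟨w, hw, hw0⟩ := Submodule.exists_mem_ne_zero_of_ne_bot hW0
    have hpW : ∀ w ∈ W, T x y p w ∈ W :=
      hW _ hx _ hy _ hp (by grind) (by grind) (by grind)
    have h1 := hT.rel (x := x) (y := y) (i := z) (j := p)
      (by grind) (by grind) (by grind) (by grind) (by grind) (by grind) w
    rw [hid _ (hpW _ hw), hid _ (hpW _ (hpW _ hw))] at h1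
    have h2 := hT.cube (x := x) (y := y) (z := p) (by grind) (by grind) (by grind) w
    rw [h1, map_smul] at h2
    have h3 : T x y p w = -w := by linear_combination (norm := module) -h2
    rw [h3, map_neg, h3] at h1
    have h4 : (2 : F) • w = 0 := by linear_combination (norm := module) h1
    exact hw0 ((smul_eq_zero.1 h4).resolve_left two_ne_zero)
  set s := T x y z with hs
  have hsW : ∀ w ∈ W, s w ∈ W := hW _ hx _ hy _ hz (by grind) (by grind) (by grind)
  have hcube : ∀ w, s (s (s w)) = w := hT.cube (by grind) (by grind) (by grind)
  have hvW : s w - w ∈ W := W.sub_mem (hsW _ hw) hw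
  have hmem : ∀ c, s (s w - w) - c • (s w - w) ∈ W := fun c =>
    W.sub_mem (hsW _ hvW) (W.smul_mem _ hvW)
  by_cases h0 : s (s w - w) - b • (s w - w) = 0
  · have h1 : W ⊓ s.eigenspace b ≠ ⊥ :=
      (Submodule.ne_bot_iff _).2 ⟨s w - w, ⟨hvW, Module.End.mem_eigenspace_iff.2 (sub_eq_zero.1 h0)⟩,
        sub_ne_zero.2 hne⟩
    exact ⟨hT.eigenspace_ne_bot_swap (by rw [mul_comm, hmul]) hW hx hy hp hq h' h1, h1⟩
  · have h1 : W ⊓ s.eigenspace a ≠ ⊥ :=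
      (Submodule.ne_bot_iff _).2 ⟨_, ⟨hmem b, sub_smul_mem_eigenspace_of_cube hadd hmul s hcube w⟩, h0⟩
    exact ⟨h1, hT.eigenspace_ne_bot_swap hmul hW hx hy hp hq h' h1⟩

lemma exists_five {S : Finset α} (hS : 5 ≤ S.card) :
    ∃ x ∈ S, ∃ y ∈ S, ∃ z ∈ S, ∃ p ∈ S, ∃ q ∈ S, [x, y, z, p, q].Nodup := by
  obtain ⟨q, hq, h0⟩ := Finset.exists_mem_ne_of_length_lt (S := S) [] (by rw [List.length_nil]; omega)
  obtain ⟨p, hp, h1⟩ := Finset.exists_mem_ne_of_length_lt (S := S) [q] (by simp; omega)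
  obtain ⟨z, hz, h2⟩ := Finset.exists_mem_ne_of_length_lt (S := S) [p, q] (by simp; omega)
  obtain ⟨y, hy, h3⟩ := Finset.exists_mem_ne_of_length_lt (S := S) [z, p, q] (by simp; omega)
  obtain ⟨x, hx, h4⟩ := Finset.exists_mem_ne_of_length_lt (S := S) [y, z, p, q] (by simp; omega)
  exact ⟨x, hx, y, hy, z, hz, p, hp, q, hq, by simp at h1 h2 h3 h4 ⊢; grind⟩

lemma spin_two_le_finrank [CharZero F] [FiniteDimensional F V] (hT : IsTripleRep T (-1))
    {S : Finset α} {W : Submodule F V} (hW0 : W ≠ ⊥) (hW : TripleStable T S W)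
    (hS : 4 ≤ S.card) : 2 ≤ Module.finrank F W := by
  by_contra! hlt
  obtain ⟨j, hj, h0⟩ := Finset.exists_mem_ne_of_length_lt (S := S) [] (by rw [List.length_nil]; omega)
  obtain ⟨i, hi, h1⟩ := Finset.exists_mem_ne_of_length_lt (S := S) [j] (by simp; omega)
  obtain ⟨y, hy, h2⟩ := Finset.exists_mem_ne_of_length_lt (S := S) [i, j] (by simp; omega)
  obtain ⟨x, hx, h3⟩ := Finset.exists_mem_ne_of_length_lt (S := S) [y, i, j] (by simp; omega)
  simp at h1 h2 h3
  obtain ⟨v, hv⟩ := finrank_le_one_iff.1 (show Module.finrank F W ≤ 1 by omega)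
  have hv0 : (v : V) ≠ 0 := by
    intro h
    obtain ⟨w, hw, hw0⟩ := Submodule.exists_mem_ne_zero_of_ne_bot hW0
    obtain ⟨c, hc⟩ := hv ⟨w, hw⟩
    apply hw0
    have := congrArg Subtype.val hc
    simpa [h] using this.symm
  have hev : ∀ k ∈ S, k ≠ x → k ≠ y → ∃ c : F, T x y k v = c • (v : V) ∧ c ^ 3 = 1 := by
    intro k hk hkx hky
    obtain ⟨c, hc⟩ := hv ⟨_, hW x hx y hy k hk (by grind) (by grind) (by grind) v v.2⟩
    have hc' : T x y k v = c • (v : V) := (congrArg Subtype.val hc).symm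
    refine ⟨c, hc', ?_⟩
    have h := hT.cube (x := x) (y := y) (z := k) (by grind) (by grind) (by grind) v
    simp only [hc', map_smul, smul_smul] at h
    have h' : (c * c * c - 1) • (v : V) = 0 := by rw [sub_smul, h]; simp
    linear_combination (smul_eq_zero.1 h').resolve_right hv0
  obtain ⟨c, hc, hc3⟩ := hev i hi (by grind) (by grind)
  obtain ⟨e, he, he3⟩ := hev j hj (by grind) (by grind)
  have h := hT.rel (x := x) (y := y) (i := i) (j := j) (by grind) (by grind) (by grind) (by grind)
    (by grind) (by grind) v
  simp only [hc, he, map_smul, smul_smul] at h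
  have h' : (e * c * e * c + 1) • (v : V) = 0 := by rw [add_smul, h]; simp
  have h4 : (e * c) ^ 2 = -1 := by linear_combination (smul_eq_zero.1 h').resolve_right hv0
  have h5 : (2 : F) = 0 := by
    calc (2 : F) = (c ^ 3) ^ 2 * (e ^ 3) ^ 2 + 1 := by rw [hc3, he3]; norm_num
      _ = ((e * c) ^ 2) ^ 3 + 1 := by ring
      _ = 0 := by rw [h4]; norm_num
  exact two_ne_zero h5

lemma spin_split [CharZero F] [FiniteDimensional F V] (hT : IsTripleRep T (-1)) {a b : F}
    (hadd : a + b = -1) (hmul : a * b = 1) (m : ℕ) {S : Finset α} (hS : 5 ≤ S.card)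
    (hm : ∀ S' : Finset α, ∀ W' : Submodule F V, S'.card + 3 = S.card → W' ≠ ⊥ →
      TripleStable T S' W' → m ≤ Module.finrank F W')
    {W : Submodule F V} (hW0 : W ≠ ⊥) (hW : TripleStable T S W) :
    2 * m ≤ Module.finrank F W := by
  obtain ⟨x, hx, y, hy, z, hz, p, hp, q, hq, h⟩ := exists_five hS
  have h' := h
  simp only [List.nodup_cons, List.mem_cons, List.not_mem_nil, not_or] at h
  have hxy : x ≠ y := by grind
  have hxz : x ≠ z := by grind
  have hyz : y ≠ z := by grind
  obtain ⟨ha, hb⟩ := hT.spin_eigenspace_ne_bot hadd hmul hW0 hW hx hy hz hp hq h'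
  have hcard := card_sdiff_triple hx hy hz hxy hxz hyz
  have h1 := hm _ _ hcard ha (hT.stable_eigenspace hW hxy hxz hyz a)
  have h2 := hm _ _ hcard hb (hT.stable_eigenspace hW hxy hxz hyz b)
  have hab : a ≠ b := by
    rintro rfl
    have : a = -1 / 2 := by linear_combination hadd / 2
    rw [this] at hmul
    norm_num at hmul
  have := finrank_add_finrank_inf_eigenspace_le W (T x y z) hab
  omega

lemma spin_four_le_finrank [CharZero F] [FiniteDimensional F V] (hT : IsTripleRep T (-1)) {a b : F}
    (hadd : a + b = -1) (hmul : a * b = 1) {S : Finset α} (hS : 7 ≤ S.card)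
    {W : Submodule F V} (hW0 : W ≠ ⊥) (hW : TripleStable T S W) :
    4 ≤ Module.finrank F W :=
  hT.spin_split hadd hmul 2 (by omega)
    (fun _ _ hc hne hst => hT.spin_two_le_finrank hne hst (by omega)) hW0 hW

lemma spin_twelve_le_finrank [IsAlgClosed F] [CharZero F] [FiniteDimensional F V]
    (hT : IsTripleRep T (-1)) {a b : F}
    (hadd : a + b = -1) (hmul : a * b = 1) {S : Finset α} (hS : 10 ≤ S.card)
    {W : Submodule F V} (hW0 : W ≠ ⊥) (hW : TripleStable T S W) :
    12 ≤ Module.finrank F W := by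
  have hroot : ∀ c : F, c * c + c + 1 = 0 → c ≠ 1 := by
    rintro c hc rfl
    norm_num at hc
  have ha1 : a ≠ 1 := hroot a (by linear_combination a * hadd - hmul)
  have hb1 : b ≠ 1 := hroot b (by linear_combination b * hadd - hmul)
  have hab : a ≠ b := by
    rintro rfl
    have : a = -1 / 2 := by linear_combination hadd / 2
    rw [this] at hmul
    norm_num at hmul
  by_cases hex : ∃ x ∈ S, ∃ y ∈ S, ∃ z ∈ S, x ≠ y ∧ x ≠ z ∧ y ≠ z ∧
      W ⊓ (T x y z).eigenspace 1 ≠ ⊥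
  · obtain ⟨x, hx, y, hy, z, hz, hxy, hxz, hyz, h1⟩ := hex
    have hcard := card_sdiff_triple hx hy hz hxy hxz hyz
    obtain ⟨p, hp, hp'⟩ := Finset.exists_mem_ne_of_length_lt (S := S) [x, y, z] (by simp; omega)
    obtain ⟨q, hq, hq'⟩ := Finset.exists_mem_ne_of_length_lt (S := S) [x, y, z, p] (by simp; omega)
    have hnd : [x, y, z, p, q].Nodup := by simp at hp' hq' ⊢; grind
    obtain ⟨ha, hb⟩ := hT.spin_eigenspace_ne_bot hadd hmul hW0 hW hx hy hz hp hq hnd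
    have hbound : ∀ c, W ⊓ (T x y z).eigenspace c ≠ ⊥ →
        4 ≤ Module.finrank F (W ⊓ (T x y z).eigenspace c : Submodule F V) := fun c hc =>
      hT.spin_four_le_finrank hadd hmul (by omega) hc (hT.stable_eigenspace hW hxy hxz hyz c)
    have := finrank_add_three_inf_eigenspace_le W (T x y z) hab ha1 hb1
    have := hbound _ h1
    have := hbound _ ha
    have := hbound _ hb
    omega
  · push Not at hex
    have hquad : ∀ x ∈ S, ∀ y ∈ S, ∀ z ∈ S, x ≠ y → x ≠ z → y ≠ z → ∀ w ∈ W,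
        T x y z (T x y z w) = -w - T x y z w := by
      intro x hx y hy z hz hxy hxz hyz w hw
      have hst := hW x hx y hy z hz hxy hxz hyz
      have hmem : T x y z (T x y z w) + T x y z w + w ∈ W ⊓ (T x y z).eigenspace 1 := by
        refine ⟨W.add_mem (W.add_mem (hst _ (hst _ hw)) (hst _ hw)) hw,
          Module.End.mem_eigenspace_iff.2 ?_⟩
        simp only [map_add, hT.cube hxy hxz hyz]
        module
      rw [hex x hx y hy z hz hxy hxz hyz, Submodule.mem_bot] at hmem
      linear_combination (norm := module) hmem
    obtain ⟨x, hx, -⟩ := Finset.exists_mem_ne_of_length_lt (S := S) [] (by rw [List.length_nil]; omega)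
    obtain ⟨y, hy, hyx⟩ := Finset.exists_mem_ne_of_length_lt (S := S) [x] (by simp; omega)
    have hxy : x ≠ y := by simpa [eq_comm] using hyx
    have hcard : 8 ≤ (S \ {x, y}).card := by
      have h1 := Finset.le_card_sdiff {x, y} S
      have h2 : ({x, y} : Finset α).card ≤ 2 := Finset.card_le_two
      omega
    set k : Fin 8 → α := fun i => ((S \ {x, y}).equivFin.symm (Fin.castLE hcard i) : α) with hk
    have hkinj : ∀ i j, i ≠ j → k i ≠ k j := by
      intro i j hij h
      apply hij
      simpa [hk, Subtype.val_inj] using h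
    have hkmem : ∀ i, k i ∈ S ∧ x ≠ k i ∧ y ≠ k i := by
      intro i
      have := ((S \ {x, y}).equivFin.symm (Fin.castLE hcard i)).2
      simp only [Finset.mem_sdiff, Finset.mem_insert, Finset.mem_singleton, not_or] at this
      exact ⟨this.1, fun h => this.2.1 h.symm, fun h => this.2.2 h.symm⟩
    have hX : ∀ i, ∀ w ∈ W, T x y (k i) w ∈ W := fun i =>
      hW x hx y hy _ (hkmem i).1 hxy (hkmem i).2.1 (hkmem i).2.2
    have hXX : ∀ i, ∀ w ∈ W, T x y (k i) (T x y (k i) w) = -w - T x y (k i) w := fun i =>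
      hquad x hx y hy _ (hkmem i).1 hxy (hkmem i).2.1 (hkmem i).2.2
    have hX3 : ∀ i w, T x y (k i) (T x y (k i) (T x y (k i) w)) = w := fun i =>
      hT.cube hxy (hkmem i).2.1 (hkmem i).2.2
    have hXY : ∀ i j, i ≠ j → ∀ w ∈ W, T x y (k i) (T x y (k j) w) =
        - T x y (k j) (T x y (k i) w) - T x y (k j) w - T x y (k i) w - w := by
      intro i j hij w hw
      have h1 := hT.rel hxy (hkmem i).2.1 (hkmem j).2.1 (hkmem i).2.2 (hkmem j).2.2
        (hkinj i j hij) w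
      have h2 : T x y (k j) (T x y (k i) (T x y (k j) w)) = T x y (k i) w + w := by
        rw [← hX3 i (T x y (k j) (T x y (k i) (T x y (k j) w))), h1, map_smul, map_smul, hXX i w hw]
        module
      rw [← hX3 j (T x y (k i) (T x y (k j) w)), h2, hXX j _ (W.add_mem (hX i w hw) hw)]
      simp only [map_add]
      abel
    refine le_trans (by norm_num) (sixteen_le_finrank_of_anticommutator
      (fun i => (2 : F) • T x y (k i) + 1) W hW0 (fun i w hw => ?_) (fun i j w hw => ?_))
    · exact W.add_mem (W.smul_mem _ (hX i w hw)) hw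
    · simp only [LinearMap.add_apply, LinearMap.smul_apply, Module.End.one_apply, map_add, map_smul]
      split_ifs with hij
      · subst hij
        rw [hXX i w hw]
        module
      · rw [hXY i j hij w hw]
        module

lemma spin_card_le [IsAlgClosed F] [CharZero F] [FiniteDimensional F V]
    (hT : IsTripleRep T (-1)) {a b : F} (hadd : a + b = -1) (hmul : a * b = 1) (S : Finset α)
    (hS : 10 ≤ S.card) (W : Submodule F V) (hW0 : W ≠ ⊥) (hW : TripleStable T S W) :
    S.card ≤ Module.finrank F W + 1 := by
  induction hn : S.card using Nat.strong_induction_on generalizing S W with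
  | _ n ih =>
    by_cases h13 : n < 13
    · have := hT.spin_twelve_le_finrank hadd hmul hS hW0 hW
      omega
    · have := hT.spin_split hadd hmul (n - 4) (by omega) (fun S' W' hc hne hst => by
        have := ih S'.card (by omega) S' (by omega) W' hne hst rfl
        omega) hW0 hW
      omega

end IsTripleRep

end TripleRep

section TripleRep

variable {F V α : Type*} [Field F] [AddCommGroup V] [Module F V] [DecidableEq α]

namespace IsTripleRep

variable {T : α → α → α → Module.End F V}

lemma quotient_apply (hT : IsTripleRep T 1) {x y i j : α} (h : [x, y, i, j].Nodup) (w : V) :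
    T x j i (T x y j w) = T x y i w := by
  simp only [List.nodup_cons, List.mem_cons, List.not_mem_nil, not_or] at h
  apply hT.injective (x := x) (y := y) (z := i) (by grind) (by grind) (by grind)
  have h1 := hT.conj (x := x) (y := y) (z := i) (p := x) (q := j) (r := i)
    (by grind) (by grind) (by grind) (by grind) (by grind) (by grind) (T x y j w)
  have e1 : rotate x y i x = y := by grind [rotate]
  have e2 : rotate x y i j = j := by grind [rotate]
  have e3 : rotate x y i i = x := by grind [rotate]
  rw [e1, e2, e3, hT.cyc (x := x) (y := y) (z := j) (by grind) (by grind) (by grind)] at h1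
  rw [h1]
  refine tetrahedral_tst _ _ (hT.cube (by grind) (by grind) (by grind)) (fun w => ?_) w
  rw [hT.rel (by grind) (by grind) (by grind) (by grind) (by grind) (by grind), one_smul]

lemma nontrivial_eigenspaces {ε : F} (hT : IsTripleRep T ε) {a b : F} (hab : a * b = 1)
    {S : Finset α} {W : Submodule F V} (hW : TripleStable T S W) {x y z p q i j : α}
    (hx : x ∈ S) (hy : y ∈ S) (hp : p ∈ S) (hq : q ∈ S) (hi : i ∈ S) (hj : j ∈ S)
    (h : [x, y, z, p, q, i, j].Nodup) {u : V} (hu : u ∈ W ⊓ (T x y z).eigenspace a)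
    (hne : T p q i (T p q j u) ≠ u) :
    TripleNontrivial T (S \ {x, y, z}) (W ⊓ (T x y z).eigenspace a) ∧
      TripleNontrivial T (S \ {x, y, z}) (W ⊓ (T x y z).eigenspace b) := by
  simp only [List.nodup_cons, List.mem_cons, List.not_mem_nil, not_or] at h
  have hp' : p ∈ S \ {x, y, z} := by simp; grind
  have hq' : q ∈ S \ {x, y, z} := by simp; grind
  have hi' : i ∈ S \ {x, y, z} := by simp; grind
  have hj' : j ∈ S \ {x, y, z} := by simp; grind
  refine ⟨⟨p, hp', q, hq', i, hi', j, hj', by simp; grind, u, hu, hne⟩,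
    ⟨q, hq', p, hp', i, hi', j, hj', by simp; grind, _,
      hT.swap_mem_eigenspace hab hW hx hy hp hq (by simp; grind) hu, ?_⟩⟩
  rw [← hT.swap_conj_disjoint (by simp; grind), ← hT.swap_conj_disjoint (by simp; grind)]
  intro h1
  exact hne (hT.injective (by grind) (by grind) (by grind)
    (hT.injective (by grind) (by grind) (by grind) h1))

lemma linear_split [CharZero F] [FiniteDimensional F V] {ε : F} (hT : IsTripleRep T ε) {a b : F}
    (hadd : a + b = -1) (hmul : a * b = 1) (m : ℕ) {S : Finset α}
    (hm : ∀ S' : Finset α, ∀ W' : Submodule F V, S'.card + 3 = S.card → TripleNontrivial T S' W' →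
      TripleStable T S' W' → m ≤ Module.finrank F W')
    {W : Submodule F V} (hW : TripleStable T S W) {x y z p q i j : α}
    (hx : x ∈ S) (hy : y ∈ S) (hz : z ∈ S) (hp : p ∈ S) (hq : q ∈ S) (hi : i ∈ S) (hj : j ∈ S)
    (h : [x, y, z, p, q, i, j].Nodup) {w : V} (hw : w ∈ W)
    (hne : T p q i (T p q j (T x y z w - w)) ≠ T x y z w - w) :
    2 * m ≤ Module.finrank F W := by
  have h' := h
  simp only [List.nodup_cons, List.mem_cons, List.not_mem_nil, not_or] at h
  have hxy : x ≠ y := by grind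
  have hxz : x ≠ z := by grind
  have hyz : y ≠ z := by grind
  have hab : a ≠ b := by
    rintro rfl
    have : a = -1 / 2 := by linear_combination hadd / 2
    rw [this] at hmul
    norm_num at hmul
  have hmul' : b * a = 1 := by rw [mul_comm, hmul]
  have hadd' : b + a = -1 := by rw [add_comm, hadd]
  have hnt : TripleNontrivial T (S \ {x, y, z}) (W ⊓ (T x y z).eigenspace a) ∧
      TripleNontrivial T (S \ {x, y, z}) (W ⊓ (T x y z).eigenspace b) := by
    have hsW := hW x hx y hy z hz hxy hxz hyz
    have hcube := hT.cube hxy hxz hyz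
    have hmem : ∀ c, T x y z (T x y z w - w) - c • (T x y z w - w) ∈ W := fun c =>
      have := W.sub_mem (hsW _ hw) hw
      W.sub_mem (hsW _ this) (W.smul_mem _ this)
    have hua := sub_smul_mem_eigenspace_of_cube hadd hmul (T x y z) hcube w
    have hub := sub_smul_mem_eigenspace_of_cube hadd' hmul' (T x y z) hcube w
    by_contra hcon
    have hfa : ∀ u ∈ W ⊓ (T x y z).eigenspace a, T p q i (T p q j u) = u := by
      intro u hu
      by_contra hne'
      exact hcon (hT.nontrivial_eigenspaces hmul hW hx hy hp hq hi hj h' hu hne')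
    have hfb : ∀ u ∈ W ⊓ (T x y z).eigenspace b, T p q i (T p q j u) = u := by
      intro u hu
      by_contra hne'
      exact hcon (hT.nontrivial_eigenspaces hmul' hW hx hy hp hq hi hj h' hu hne').symm
    have h1 := hfa _ ⟨hmem b, hua⟩
    have h2 := hfb _ ⟨hmem a, hub⟩
    set v := T x y z w - w with hv
    clear_value v
    apply hne
    have h3 : (a - b) • T p q i (T p q j v) = (a - b) • v := by
      simp only [map_sub, map_smul] at h1 h2
      linear_combination (norm := module) h1 - h2
    exact smul_right_injective V (sub_ne_zero.2 hab) h3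
  have hcard := card_sdiff_triple hx hy hz hxy hxz hyz
  have h1 := hm _ _ hcard hnt.1 (hT.stable_eigenspace hW hxy hxz hyz a)
  have h2 := hm _ _ hcard hnt.2 (hT.stable_eigenspace hW hxy hxz hyz b)
  have := finrank_add_finrank_inf_eigenspace_le W (T x y z) hab
  omega

set_option maxHeartbeats 800000 in
/-- If a vector of `W` behaves like `e_x - e_y` with respect to two 3-cycles, then `W` contains
the standard representation. -/
lemma standard_card_le_finrank [CharZero F] [FiniteDimensional F V] (hT : IsTripleRep T 1)
    {S : Finset α} (hS : 7 ≤ S.card) {W : Submodule F V} (hW : TripleStable T S W) {x y i j : α}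
    (hx : x ∈ S) (hy : y ∈ S) (hi : i ∈ S) (hj : j ∈ S) (h : [x, y, i, j].Nodup) {v : V}
    (hv : v ∈ W) (hv0 : v ≠ 0) (hsum : v + T x y i v + T x y i (T x y i v) = 0)
    (hsum' : v + T x y j v + T x y j (T x y j v) = 0)
    (hfix : ∀ a ∈ S, a ≠ x → a ≠ y → a ≠ i → a ≠ j → T a j i v = v) :
    S.card ≤ Module.finrank F W + 1 := by
  simp only [List.nodup_cons, List.mem_cons, List.not_mem_nil, not_or] at h
  have hxy : x ≠ y := by grind
  have hxi : x ≠ i := by grind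
  have hxj : x ≠ j := by grind
  have hyi : y ≠ i := by grind
  have hyj : y ≠ j := by grind
  have hij : i ≠ j := by grind
  have hrot : ∀ {a b c : α}, a ≠ b → a ≠ c → b ≠ c → T a b c v = v → T b c a v = v :=
    fun h1 h2 h3 h4 => by rw [hT.cyc h1 h2 h3, h4]
  have hfix' : ∀ a ∈ S, a ≠ x → a ≠ y → a ≠ i → a ≠ j → T a i j v = v := by
    intro a ha h1 h2 h3 h4
    have := hT.inv (x := a) (y := j) (z := i) h4 h3 hij.symm v
    rwa [hfix a ha h1 h2 h3 h4] at this
  have hji : ∀ a ∈ S, a ≠ x → a ≠ y → a ≠ i → a ≠ j → T j i a v = v := fun a ha h1 h2 h3 h4 =>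
    hrot h4 h3 hij.symm (hfix a ha h1 h2 h3 h4)
  have hij' : ∀ a ∈ S, a ≠ x → a ≠ y → a ≠ i → a ≠ j → T i j a v = v := fun a ha h1 h2 h3 h4 =>
    hrot h3 h4 hij (hfix' a ha h1 h2 h3 h4)
  have hiab : ∀ a ∈ S, a ≠ x → a ≠ y → a ≠ i → a ≠ j → ∀ b ∈ S, b ≠ x → b ≠ y → b ≠ i → b ≠ j →
      a ≠ b → T i a b v = v := by
    intro a ha h1 h2 h3 h4 b hb g1 g2 g3 g4 hab
    have := hT.quotient_apply (x := i) (y := j) (i := b) (j := a) (by simp; grind) v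
    rwa [hij' a ha h1 h2 h3 h4, hij' b hb g1 g2 g3 g4] at this
  have hjab : ∀ a ∈ S, a ≠ x → a ≠ y → a ≠ i → a ≠ j → ∀ b ∈ S, b ≠ x → b ≠ y → b ≠ i → b ≠ j →
      a ≠ b → T j a b v = v := by
    intro a ha h1 h2 h3 h4 b hb g1 g2 g3 g4 hab
    have := hT.quotient_apply (x := j) (y := i) (i := b) (j := a) (by simp; grind) v
    rwa [hji a ha h1 h2 h3 h4, hji b hb g1 g2 g3 g4] at this
  have habc : ∀ a ∈ S, a ≠ x → a ≠ y → a ≠ i → a ≠ j → ∀ b ∈ S, b ≠ x → b ≠ y → b ≠ i → b ≠ j →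
      ∀ c ∈ S, c ≠ x → c ≠ y → c ≠ i → c ≠ j → a ≠ b → a ≠ c → b ≠ c → T a b c v = v := by
    intro a ha h1 h2 h3 h4 b hb g1 g2 g3 g4 c hc k1 k2 k3 k4 hab hac hbc
    have := hT.quotient_apply (x := a) (y := i) (i := c) (j := b) (by simp; grind) v
    rwa [← hT.cyc (x := a) (y := i) (z := b) (by grind) (by grind) (by grind),
      ← hT.cyc (x := a) (y := i) (z := c) (by grind) (by grind) (by grind),
      hiab b hb g1 g2 g3 g4 a ha h1 h2 h3 h4 hab.symm,
      hiab c hc k1 k2 k3 k4 a ha h1 h2 h3 h4 hac.symm] at this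
  have hall : ∀ a ∈ S, a ≠ x → a ≠ y → ∀ b ∈ S, b ≠ x → b ≠ y → ∀ c ∈ S, c ≠ x → c ≠ y →
      a ≠ b → a ≠ c → b ≠ c → T a b c v = v := by
    have hi1 : ∀ b ∈ S, b ≠ x → b ≠ y → ∀ c ∈ S, c ≠ x → c ≠ y → i ≠ b → i ≠ c → b ≠ c →
        T i b c v = v := by
      intro b hb h1 h2 c hc g1 g2 k1 k2 k3
      by_cases hbj : b = j
      · subst hbj
        exact hij' c hc g1 g2 k2.symm k3.symm
      by_cases hcj : c = j
      · subst hcj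
        exact hrot (Ne.symm hij) k3.symm k1 (hji b hb h1 h2 k1.symm hbj)
      exact hiab b hb h1 h2 k1.symm hbj c hc g1 g2 k2.symm hcj k3
    have hj1 : ∀ b ∈ S, b ≠ x → b ≠ y → ∀ c ∈ S, c ≠ x → c ≠ y → j ≠ b → j ≠ c → b ≠ c →
        T j b c v = v := by
      intro b hb h1 h2 c hc g1 g2 k1 k2 k3
      by_cases hbj : b = i
      · subst hbj
        exact hji c hc g1 g2 k3.symm k2.symm
      by_cases hcj : c = i
      · subst hcj
        exact hrot hij k3.symm k1 (hij' b hb h1 h2 hbj k1.symm)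
      exact hjab b hb h1 h2 hbj k1.symm c hc g1 g2 hcj k2.symm k3
    intro a ha a1 a2 b hb b1 b2 c hc c1 c2 hab hac hbc
    by_cases hai : a = i
    · subst hai
      exact hi1 b hb b1 b2 c hc c1 c2 hab hac hbc
    by_cases haj : a = j
    · subst haj
      exact hj1 b hb b1 b2 c hc c1 c2 hab hac hbc
    by_cases hbi : b = i
    · subst hbi
      exact hrot hac.symm hbc.symm hab
        (hrot hbc hab.symm hac.symm (hi1 c hc c1 c2 a ha a1 a2 hbc hab.symm hac.symm))
    by_cases hbj : b = j
    · subst hbj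
      exact hrot hac.symm hbc.symm hab
        (hrot hbc hab.symm hac.symm (hj1 c hc c1 c2 a ha a1 a2 hbc hab.symm hac.symm))
    by_cases hci : c = i
    · subst hci
      exact hrot hac.symm hbc.symm hab (hi1 a ha a1 a2 b hb b1 b2 hac.symm hbc.symm hab)
    by_cases hcj : c = j
    · subst hcj
      exact hrot hac.symm hbc.symm hab (hj1 a ha a1 a2 b hb b1 b2 hac.symm hbc.symm hab)
    exact habc a ha a1 a2 hai haj b hb b1 b2 hbi hbj c hc c1 c2 hci hcj hab hac hbc
  have hmem : ∀ k : ↥(S \ {x, y}), (k : α) ∈ S ∧ x ≠ k ∧ y ≠ k := by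
    intro k
    have := k.2
    simp only [Finset.mem_sdiff, Finset.mem_insert, Finset.mem_singleton, not_or] at this
    exact ⟨this.1, fun h => this.2.1 h.symm, fun h => this.2.2 h.symm⟩
  have hcard : (S \ {x, y}).card + 2 = S.card := by
    have h1 : ({x, y} : Finset α).card = 2 := Finset.card_pair hxy
    have h2 : ({x, y} : Finset α) ⊆ S := by
      intro p hp
      simp only [Finset.mem_insert, Finset.mem_singleton] at hp
      rcases hp with rfl | rfl <;> assumption
    have := Finset.card_sdiff_add_card_eq_card h2
    omega
  have hcube : ∀ (k : ↥(S \ {x, y})) w, T x y k (T x y k (T x y k w)) = w := fun k =>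
    hT.cube hxy (hmem k).2.1 (hmem k).2.2
  have hcar := carmichael_card_lt_finrank (fun k : ↥(S \ {x, y}) => T x y k) v hv0 hcube
    (fun k l hkl w => ?_) (fun k => ?_) (fun m k l hkm hlm => ?_) (fun k l => ?_) W hv
    (fun k => hW x hx y hy k (hmem k).1 hxy (hmem k).2.1 (hmem k).2.2 v hv)
  · rw [Fintype.card_coe] at hcar
    omega
  · rw [hT.rel hxy (hmem k).2.1 (hmem l).2.1 (hmem k).2.2 (hmem l).2.2
      (Subtype.coe_injective.ne hkl), one_smul]
  · obtain ⟨k1, k2, k3⟩ := hmem k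
    generalize (k : α) = k at k1 k2 k3 ⊢
    by_cases hki : k = i
    · rw [hki, hsum]
    by_cases hkj : k = j
    · rw [hkj, hsum']
    have h1 : ∀ w, T k j i (T x y i w) = T x y k (T k j i w) := by
      intro w
      have h1 := hT.conj (x := k) (y := j) (z := i) (p := x) (q := y) (r := i)
        (by grind) (by grind) (by grind) (by grind) (by grind) (by grind) w
      rwa [show rotate k j i x = x by grind [rotate], show rotate k j i y = y by grind [rotate],
        show rotate k j i i = k by grind [rotate]] at h1
    have h2 := congrArg (T k j i) hsum
    simpa only [map_add, map_zero, h1, hfix k k1 k2.symm k3.symm hki hkj] using h2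
  · by_cases hkl : k = l
    · rw [hkl]
    obtain ⟨k1, k2, k3⟩ := hmem k
    obtain ⟨l1, l2, l3⟩ := hmem l
    obtain ⟨m1, m2, m3⟩ := hmem m
    have hkl' : (k : α) ≠ l := Subtype.coe_injective.ne hkl
    have hkm' : (k : α) ≠ m := Subtype.coe_injective.ne hkm
    have hlm' : (l : α) ≠ m := Subtype.coe_injective.ne hlm
    have h1 := hT.conj (x := x) (y := y) (z := m) (p := m) (q := l) (r := k)
      hxy m2 m3 hlm'.symm hkm'.symm hkl'.symm v
    rw [show rotate x y m m = x by grind [rotate],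
      show rotate x y (m : α) (l : α) = l by grind [rotate],
      show rotate x y (m : α) (k : α) = k by grind [rotate],
      hall m m1 m2.symm m3.symm l l1 l2.symm l3.symm k k1 k2.symm k3.symm hlm'.symm hkm'.symm
        hkl'.symm] at h1
    have h2 := hT.quotient_apply (x := x) (y := y) (i := k) (j := l) (by simp; grind)
      (T x y l (T x y l (T x y m v)))
    rw [hcube, ← h1] at h2
    change T x y k (T x y k (T x y m v)) = T x y l (T x y l (T x y m v))
    conv_lhs => rw [h2]
    exact hcube k _
  · obtain ⟨m, hm, hm'⟩ := Finset.exists_mem_ne_of_length_lt (S := S \ {x, y}) [(k : α), (l : α)]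
      (by simp only [List.length_cons, List.length_nil]; omega)
    simp only [List.mem_cons, List.not_mem_nil, or_false, forall_eq_or_imp, forall_eq] at hm'
    exact ⟨⟨m, hm⟩, fun h => hm'.1 (congrArg Subtype.val h), fun h => hm'.2 (congrArg Subtype.val h)⟩

/-- If double transpositions act trivially on the vectors moved by a disjoint 3-cycle, then `W`
contains the standard representation. -/
lemma card_le_finrank_of_trivial [CharZero F] [FiniteDimensional F V] (hT : IsTripleRep T 1)
    {S : Finset α} (hS : 7 ≤ S.card) {W : Submodule F V} (hW : TripleStable T S W)
    (hNT : TripleNontrivial T S W)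
    (htriv : ∀ x ∈ S, ∀ y ∈ S, ∀ z ∈ S, ∀ p ∈ S, ∀ q ∈ S, ∀ i ∈ S, ∀ j ∈ S,
      [x, y, z, p, q, i, j].Nodup → ∀ w ∈ W,
        T p q i (T p q j (T x y z w - w)) = T x y z w - w) :
    S.card ≤ Module.finrank F W + 1 := by
  obtain ⟨x, hx, y, hy, i, hi, j, hj, h, hne⟩ := hNT
  have h' := h
  simp only [List.nodup_cons, List.mem_cons, List.not_mem_nil, not_or] at h
  have hxy : x ≠ y := by grind
  have hxi : x ≠ i := by grind
  have hxj : x ≠ j := by grind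
  have hyi : y ≠ i := by grind
  have hyj : y ≠ j := by grind
  have hij : i ≠ j := by grind
  have hs := hT.cube hxy hxi hyi
  have ht := hT.cube hxy hxj hyj
  have hsW := hW x hx y hy i hi hxy hxi hyi
  obtain ⟨e, he, hte, hse⟩ := tetrahedral_exists_fixed (T x y i) (T x y j) hs ht
    (fun w => by rw [hT.rel hxy hxi hxj hyi hyj hij, one_smul]) W hsW
    (hW x hx y hy j hj hxy hxj hyj) hne
  have hse' : T x y i e = T x j y e := by
    have := hT.inv hxy hxj hyj (T x y i e)
    rw [hte] at this
    exact this.symm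
  have htt : T x y i e = T x y j (T x y j e) := by
    rw [← ht (T x y i e), hte]
  refine hT.standard_card_le_finrank hS hW hx hy hi hj h' (v := T x y i e - e)
    (W.sub_mem (hsW _ he) he) (sub_ne_zero.2 hse) ?_ ?_ ?_
  · simp only [map_sub, hs]
    abel
  · rw [htt]
    simp only [map_sub, ht]
    abel
  · intro a ha hax hay hai haj
    obtain ⟨b, hb, hb'⟩ := Finset.exists_mem_ne_of_length_lt (S := S) [x, y, i, j, a]
      (by simp only [List.length_cons, List.length_nil]; omega)
    obtain ⟨c, hc, hc'⟩ := Finset.exists_mem_ne_of_length_lt (S := S) [x, y, i, j, a, b]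
      (by simp only [List.length_cons, List.length_nil]; omega)
    simp only [List.mem_cons, List.not_mem_nil, or_false, forall_eq_or_imp, forall_eq] at hb' hc'
    have h1 := htriv x hx y hy i hi a ha b hb j hj c hc (by simp; grind) e he
    have h2 := htriv x hx j hj y hy a ha b hb i hi c hc (by simp; grind) e he
    rw [← hse'] at h2
    have h3 := hT.quotient_apply (x := a) (y := b) (i := i) (j := j) (by simp; grind)
      (T a b c (T x y i e - e))
    rwa [h1, h2] at h3

lemma linear_three_le_finrank [CharZero F] [FiniteDimensional F V] (hT : IsTripleRep T 1)
    {S : Finset α} {W : Submodule F V} (hW : TripleStable T S W) (hNT : TripleNontrivial T S W) :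
    3 ≤ Module.finrank F W := by
  obtain ⟨x, hx, y, hy, i, hi, j, hj, h, hne⟩ := hNT
  simp only [List.nodup_cons, List.mem_cons, List.not_mem_nil, not_or] at h
  exact tetrahedral_three_le_finrank (T x y i) (T x y j) (hT.cube (by grind) (by grind) (by grind))
    (hT.cube (by grind) (by grind) (by grind))
    (fun w => by rw [hT.rel (by grind) (by grind) (by grind) (by grind) (by grind) (by grind),
      one_smul]) W (hW x hx y hy i hi (by grind) (by grind) (by grind))
    (hW x hx y hy j hj (by grind) (by grind) (by grind)) hne

lemma linear_split_or [CharZero F] [FiniteDimensional F V] (hT : IsTripleRep T 1) {a b : F}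
    (hadd : a + b = -1) (hmul : a * b = 1) (m : ℕ) {S : Finset α} (hS : 7 ≤ S.card)
    (hm : ∀ S' : Finset α, ∀ W' : Submodule F V, S'.card + 3 = S.card → TripleNontrivial T S' W' →
      TripleStable T S' W' → m ≤ Module.finrank F W')
    {W : Submodule F V} (hW : TripleStable T S W) (hNT : TripleNontrivial T S W) :
    S.card ≤ Module.finrank F W + 1 ∨ 2 * m ≤ Module.finrank F W := by
  by_cases htriv : ∀ x ∈ S, ∀ y ∈ S, ∀ z ∈ S, ∀ p ∈ S, ∀ q ∈ S, ∀ i ∈ S, ∀ j ∈ S,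
      [x, y, z, p, q, i, j].Nodup → ∀ w ∈ W,
        T p q i (T p q j (T x y z w - w)) = T x y z w - w
  · exact Or.inl (hT.card_le_finrank_of_trivial hS hW hNT htriv)
  · push Not at htriv
    obtain ⟨x, hx, y, hy, z, hz, p, hp, q, hq, i, hi, j, hj, h, w, hw, hne⟩ := htriv
    exact Or.inr (hT.linear_split hadd hmul m hm hW hx hy hz hp hq hi hj h hw hne)

lemma linear_card_le [CharZero F] [FiniteDimensional F V]
    (hT : IsTripleRep T 1) {a b : F} (hadd : a + b = -1) (hmul : a * b = 1) (S : Finset α)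
    (hS : 10 ≤ S.card) (W : Submodule F V) (hW : TripleStable T S W)
    (hNT : TripleNontrivial T S W) : S.card ≤ Module.finrank F W + 1 := by
  have hsix : ∀ S' : Finset α, ∀ W' : Submodule F V, 7 ≤ S'.card → TripleNontrivial T S' W' →
      TripleStable T S' W' → 6 ≤ Module.finrank F W' := by
    intro S' W' hS' hNT' hW'
    rcases hT.linear_split_or hadd hmul 3 hS'
      (fun _ _ _ hn hst => hT.linear_three_le_finrank hst hn) hW' hNT' with h | h <;> omega
  induction hn : S.card using Nat.strong_induction_on generalizing S W with
  | _ n ih =>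
    by_cases h13 : n < 13
    · rcases hT.linear_split_or hadd hmul 6 (by omega)
        (fun S' W' hc hn hst => hsix S' W' (by omega) hn hst) hW hNT with h | h <;> omega
    · rcases hT.linear_split_or hadd hmul (n - 4) (by omega) (fun S' W' hc hnt hst => by
        have := ih S'.card (by omega) S' (by omega) W' hst hnt rfl
        omega) hW hNT with h | h <;> omega

/-- Families of operators indexed by 3-cycles in small dimension are trivial. -/
theorem eq_one_of_finrank_lt [Fintype α] [IsAlgClosed F] [CharZero F] [FiniteDimensional F V]
    {ε : F} (hT : IsTripleRep T ε) (hε : ε * ε = 1) (hα : 10 ≤ Fintype.card α)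
    (hpos : 0 < Module.finrank F V) (hlt : Module.finrank F V + 1 < Fintype.card α)
    {x y z : α} (hxy : x ≠ y) (hxz : x ≠ z) (hyz : y ≠ z) : T x y z = 1 := by
  obtain ⟨a, ha⟩ := IsAlgClosed.exists_pow_nat_eq (-3 : F) (n := 2) two_pos
  have hadd : (-1 + a) / 2 + (-1 - a) / 2 = -1 := by ring
  have hmul : (-1 + a) / 2 * ((-1 - a) / 2) = 1 := by linear_combination -ha / 4
  have hst : TripleStable T Finset.univ ⊤ := fun _ _ _ _ _ _ _ _ _ _ _ => Submodule.mem_top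
  rcases mul_self_eq_one_iff.1 hε with rfl | rfl
  · have hnt : ¬ TripleNontrivial T Finset.univ ⊤ := by
      intro hnt
      have := hT.linear_card_le hadd hmul Finset.univ (by simpa using hα) ⊤ hst hnt
      rw [finrank_top, Finset.card_univ] at this
      omega
    have htriv : ∀ i j, [x, y, i, j].Nodup → ∀ w, T x y i (T x y j w) = w := by
      intro i j h w
      by_contra hne
      exact hnt ⟨x, Finset.mem_univ _, y, Finset.mem_univ _, i, Finset.mem_univ _, j,
        Finset.mem_univ _, h, w, Submodule.mem_top, hne⟩
    obtain ⟨p, -, hp⟩ := Finset.exists_mem_ne_of_length_lt (S := Finset.univ) [x, y, z]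
      (by simp only [List.length_cons, List.length_nil, Finset.card_univ]; omega)
    obtain ⟨q, -, hq⟩ := Finset.exists_mem_ne_of_length_lt (S := Finset.univ) [x, y, z, p]
      (by simp only [List.length_cons, List.length_nil, Finset.card_univ]; omega)
    simp only [List.mem_cons, List.not_mem_nil, or_false, forall_eq_or_imp, forall_eq] at hp hq
    ext w
    have h1 : T x y z w = T x y q w := by
      conv_lhs => rw [← htriv p q (by simp; grind) w]
      exact htriv z p (by simp; grind) _
    have h2 : T x y z (T x y z w) = w := by
      conv_lhs => rw [h1]
      exact htriv z q (by simp; grind) w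
    have h3 := hT.cube hxy hxz hyz w
    rw [h2] at h3
    rw [h3, Module.End.one_apply]
  · have hbot : (⊤ : Submodule F V) ≠ ⊥ := by
      have := Module.finrank_pos_iff.1 hpos
      exact top_ne_bot
    have := hT.spin_card_le hadd hmul Finset.univ (by simpa using hα) ⊤ hbot hst
    rw [finrank_top, Finset.card_univ] at this
    omega

end IsTripleRep

end TripleRep

section Lifting

open Equiv Equiv.Perm

variable {α : Type*} [Fintype α] [DecidableEq α]

/-- The 3-cycle `x ↦ y ↦ z ↦ x` as an element of the alternating group. -/
def threeCycle (x y z : α) : alternatingGroup α :=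
  if h : x ≠ y ∧ y ≠ z then
    ⟨swap x y * swap y z, by rw [mem_alternatingGroup, Perm.sign_mul, sign_swap h.1, sign_swap h.2]; rfl⟩
  else 1

lemma coe_threeCycle {x y z : α} (hxy : x ≠ y) (hyz : y ≠ z) :
    (threeCycle x y z : Perm α) = swap x y * swap y z := by
  rw [threeCycle, dif_pos ⟨hxy, hyz⟩]

lemma threeCycle_apply {x y z : α} (hxy : x ≠ y) (hxz : x ≠ z) (hyz : y ≠ z) (p : α) :
    (threeCycle x y z : Perm α) p = rotate x y z p := by
  rw [coe_threeCycle hxy hyz, Perm.mul_apply, swap_apply_def y z, swap_apply_def]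
  grind [rotate]

lemma conj_threeCycle (g : alternatingGroup α) (x y z : α) :
    g * threeCycle x y z * g⁻¹ =
      threeCycle ((g : Perm α) x) ((g : Perm α) y) ((g : Perm α) z) := by
  by_cases h : x ≠ y ∧ y ≠ z
  · ext1
    rw [coe_threeCycle ((g : Perm α).injective.ne h.1) ((g : Perm α).injective.ne h.2),
      swap_apply_apply, swap_apply_apply]
    push_cast
    rw [coe_threeCycle h.1 h.2]
    group
  · have h' : ¬ ((g : Perm α) x ≠ (g : Perm α) y ∧ (g : Perm α) y ≠ (g : Perm α) z) := by
      simpa using h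
    rw [threeCycle, threeCycle, dif_neg h, dif_neg h']
    group

lemma alternatingGroup_ext {a b : alternatingGroup α}
    (h : ∀ p, (a : Perm α) p = (b : Perm α) p) : a = b :=
  Subtype.ext (Equiv.ext h)

lemma threeCycle_rotate {x y z : α} (hxy : x ≠ y) (hxz : x ≠ z) (hyz : y ≠ z) :
    threeCycle y z x = threeCycle x y z := by
  refine alternatingGroup_ext fun p => ?_
  rw [threeCycle_apply hyz hxy.symm hxz.symm, threeCycle_apply hxy hxz hyz]
  grind [rotate]

lemma threeCycle_inv {x y z : α} (hxy : x ≠ y) (hxz : x ≠ z) (hyz : y ≠ z) :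
    threeCycle x z y = (threeCycle x y z)⁻¹ := by
  rw [eq_inv_iff_mul_eq_one]
  refine alternatingGroup_ext fun p => ?_
  simp only [Subgroup.coe_mul, Subgroup.coe_one, Perm.mul_apply, Perm.one_apply]
  rw [threeCycle_apply hxz hxy hyz.symm, threeCycle_apply hxy hxz hyz]
  grind [rotate]

lemma threeCycle_cube {x y z : α} (hxy : x ≠ y) (hxz : x ≠ z) (hyz : y ≠ z) :
    threeCycle x y z ^ 3 = 1 := by
  refine alternatingGroup_ext fun p => ?_
  simp only [pow_succ, pow_zero, one_mul, Subgroup.coe_mul, Subgroup.coe_one, Perm.mul_apply,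
    Perm.one_apply, threeCycle_apply hxy hxz hyz]
  grind [rotate]

lemma threeCycle_mul_sq {x y i j : α} (h : [x, y, i, j].Nodup) :
    (threeCycle x y i * threeCycle x y j) ^ 2 = 1 := by
  simp only [List.nodup_cons, List.mem_cons, List.not_mem_nil, not_or] at h
  refine alternatingGroup_ext fun p => ?_
  simp only [pow_succ, pow_zero, one_mul, Subgroup.coe_mul, Subgroup.coe_one, Perm.mul_apply,
    Perm.one_apply, threeCycle_apply (show x ≠ y by grind) (show x ≠ i by grind)
    (show y ≠ i by grind), threeCycle_apply (show x ≠ y by grind) (show x ≠ j by grind)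
    (show y ≠ j by grind)]
  have hp : ∀ k, p ≠ x → p ≠ y → p ≠ k → rotate x y k p = p := by grind [rotate]
  have hx : ∀ k, rotate x y k x = y := by grind [rotate]
  have hy : ∀ k, rotate x y k y = k := by grind [rotate]
  have hk : rotate x y i i = x ∧ rotate x y j j = x ∧ rotate x y i j = j ∧ rotate x y j i = i := by
    grind [rotate]
  by_cases h1 : p = x
  · simp only [h1, hx, hy, hk]
  by_cases h2 : p = y
  · simp only [h2, hx, hy, hk]
  by_cases h3 : p = i
  · simp only [h3, hx, hy, hk]
  by_cases h4 : p = j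
  · simp only [h4, hx, hy, hk]
  rw [hp j h1 h2 h4, hp i h1 h2 h3, hp j h1 h2 h4, hp i h1 h2 h3]

lemma exists_swap_mul_swap {x y p q : α} (hxy : x ≠ y) (hpq : p ≠ q) :
    ∃ h : alternatingGroup α, (h : Perm α) = swap x y * swap p q :=
  ⟨⟨_, by rw [mem_alternatingGroup, Perm.sign_mul, sign_swap hxy, sign_swap hpq]; rfl⟩, rfl⟩

/-- A double transposition inverting a given 3-cycle. -/
lemma exists_conj_threeCycle_eq_inv {x y z p q : α} (h : [x, y, z, p, q].Nodup) :
    ∃ g : alternatingGroup α, g * threeCycle x y z * g⁻¹ = (threeCycle x y z)⁻¹ ∧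
      ∀ t, t ≠ x → t ≠ y → t ≠ p → t ≠ q → (g : Perm α) t = t := by
  simp only [List.nodup_cons, List.mem_cons, List.not_mem_nil, not_or] at h
  obtain ⟨g, hg⟩ := exists_swap_mul_swap (show x ≠ y by grind) (show p ≠ q by grind)
  refine ⟨g, ?_, fun t h1 h2 h3 h4 => ?_⟩
  · have hx : (g : Perm α) x = y := by
      rw [hg, Perm.mul_apply, swap_apply_of_ne_of_ne (show x ≠ p by grind) (show x ≠ q by grind),
        swap_apply_left]
    have hy : (g : Perm α) y = x := by
      rw [hg, Perm.mul_apply, swap_apply_of_ne_of_ne (show y ≠ p by grind) (show y ≠ q by grind),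
        swap_apply_right]
    have hz : (g : Perm α) z = z := by
      rw [hg, Perm.mul_apply, swap_apply_of_ne_of_ne (show z ≠ p by grind) (show z ≠ q by grind),
        swap_apply_of_ne_of_ne (by grind) (by grind)]
    rw [conj_threeCycle, ← threeCycle_inv (by grind) (by grind) (by grind), hx, hy, hz,
      threeCycle_rotate (x := y) (y := x) (z := z) (by grind) (by grind) (by grind)]
  · rw [hg, Perm.mul_apply, swap_apply_of_ne_of_ne h3 h4, swap_apply_of_ne_of_ne h1 h2]

lemma exists_eq_threeCycle {σ : alternatingGroup α} (hσ : IsThreeCycle (σ : Perm α)) :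
    ∃ x y z, x ≠ y ∧ x ≠ z ∧ y ≠ z ∧ σ = threeCycle x y z := by
  obtain ⟨a, ha⟩ := hσ.isCycle.nonempty_support
  have hn := hσ.nodup_iff_mem_support.2 ha
  have he := hσ.eq_swap_mul_swap_iff_mem_support.2 ha
  simp only [List.nodup_cons, List.mem_cons, List.not_mem_nil, not_or] at hn
  have hyz : (σ : Perm α) a ≠ (σ : Perm α) ((σ : Perm α) a) := by grind
  exact ⟨a, (σ : Perm α) a, (σ : Perm α) ((σ : Perm α) a), by grind, by grind, hyz,
    Subtype.ext (he.trans (coe_threeCycle (by grind) hyz).symm)⟩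

end Lifting

section CommutingLifts

open Equiv Equiv.Perm

variable {α : Type*} [Fintype α] [DecidableEq α] {G : Type*} [Group G]

lemma exists_eq_mul_center_of_mk_eq {a b : G} (h : (a : G ⧸ Subgroup.center G) = b) :
    ∃ c ∈ Subgroup.center G, b = a * c :=
  ⟨a⁻¹ * b, QuotientGroup.eq.1 h, by group⟩

lemma mk_mul_center {a c : G} (hc : c ∈ Subgroup.center G) :
    ((a * c : G) : G ⧸ Subgroup.center G) = a := by
  rw [QuotientGroup.mk_mul_of_mem a hc]

lemma eq_one_of_sq_of_cube {M : Type*} [Monoid M] {c : M} (h2 : c ^ 2 = 1) (h3 : c ^ 3 = 1) :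
    c = 1 := by
  rwa [pow_succ, h2, one_mul] at h3

/-- If `B` and `X` commute up to a central factor, `B ^ 3` is central, and some element fixes `X`
and inverts `B` up to central factors, then `B` and `X` commute. -/
lemma mul_comm_of_inverts {X B H c s t : G} (hc : c ∈ Subgroup.center G)
    (hs : s ∈ Subgroup.center G) (ht : t ∈ Subgroup.center G) (hB : B ^ 3 ∈ Subgroup.center G)
    (hBX : B * X = X * B * c) (hX : H * X * H⁻¹ = X * s) (hHB : H * B * H⁻¹ = B⁻¹ * t) :
    B * X = X * B := by
  rw [Subgroup.mem_center_iff] at hc hs ht hB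
  have hconj : (B⁻¹ * t) * (X * s) = (X * s) * (B⁻¹ * t) * c := by
    rw [← hX, ← hHB]
    calc H * B * H⁻¹ * (H * X * H⁻¹) = H * (B * X) * H⁻¹ := by group
      _ = H * X * B * (c * H⁻¹) := by rw [hBX]; group
      _ = H * X * B * (H⁻¹ * c) := by rw [hc]
      _ = _ := by group
  have hinv : B⁻¹ * X = X * B⁻¹ * c := by
    have e1 : (B⁻¹ * t) * (X * s) = B⁻¹ * X * (s * t) := by
      rw [mul_assoc, ← ht (X * s)]; group
    have e2 : (X * s) * (B⁻¹ * t) * c = X * B⁻¹ * c * (s * t) := by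
      calc (X * s) * (B⁻¹ * t) * c = X * (s * (B⁻¹ * t * c)) := by group
        _ = X * (B⁻¹ * (t * (c * s))) := by rw [← hs]; group
        _ = _ := by rw [← ht]; group
    exact mul_right_cancel (e1.symm.trans (hconj.trans e2))
  have hcc : c ^ 2 = 1 := by
    have : X * B = X * B * (c * c) := by
      calc X * B = B * (B⁻¹ * X) * B := by group
        _ = B * X * (B⁻¹ * (c * B)) := by rw [hinv]; group
        _ = B * X * c := by rw [← hc]; group
        _ = _ := by rw [hBX]; group
    rw [pow_two]
    exact (mul_eq_left.1 this.symm)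
  have hccc : c ^ 3 = 1 := by
    have : X * B ^ 3 = X * B ^ 3 * c ^ 3 := by
      calc X * B ^ 3 = B * (B * (B * X)) := by
            rw [hB]; simp only [pow_succ, pow_zero, one_mul, mul_assoc]
        _ = B * (B * (X * B * c)) := by rw [hBX]
        _ = B * (B * X) * (B * c) := by simp only [mul_assoc]
        _ = B * (X * B * c) * (B * c) := by rw [hBX]
        _ = B * X * (B * (c * B)) * c := by simp only [mul_assoc]
        _ = B * X * (B * B * (c * c)) := by rw [← hc B]; simp only [mul_assoc]
        _ = X * B * (c * (B * B)) * (c * c) := by rw [hBX]; simp only [mul_assoc]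
        _ = _ := by rw [← hc]; simp only [pow_succ, pow_zero, one_mul, mul_assoc]
    exact (mul_eq_left.1 this.symm)
  rw [hBX, eq_one_of_sq_of_cube hcc hccc, mul_one]

variable (φ : alternatingGroup α →* G ⧸ Subgroup.center G)

/-- The elements all of whose lifts along `φ` commute with `X`. -/
def liftCentralizer (X : G) : Subgroup (alternatingGroup α) :=
  ((Subgroup.centralizer {X}).map (QuotientGroup.mk' (Subgroup.center G))).comap φ

variable {φ}

lemma mem_liftCentralizer {X K : G} {k : alternatingGroup α}
    (hK : (K : G ⧸ Subgroup.center G) = φ k) :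
    k ∈ liftCentralizer φ X ↔ K * X = X * K := by
  rw [liftCentralizer, Subgroup.mem_comap, Subgroup.mem_map]
  constructor
  · rintro ⟨L, hL, hLk⟩
    obtain ⟨c, hc, rfl⟩ := exists_eq_mul_center_of_mk_eq (a := L) (b := K)
      (hLk.trans hK.symm)
    rw [Subgroup.mem_centralizer_singleton_iff] at hL
    rw [Subgroup.mem_center_iff] at hc
    rw [mul_assoc, ← hc X, ← mul_assoc, hL, mul_assoc]
  · intro h
    exact ⟨K, Subgroup.mem_centralizer_singleton_iff.2 h, hK⟩

lemma threeCycle_mem_liftCentralizer (hα : 8 ≤ Fintype.card α) {x y z p q r : α}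
    (h : [x, y, z, p, q, r].Nodup) {X : G}
    (hX : (X : G ⧸ Subgroup.center G) = φ (threeCycle x y z)) :
    threeCycle p q r ∈ liftCentralizer φ X := by
  obtain ⟨u, -, hu⟩ := (Finset.univ : Finset α).exists_mem_ne_of_length_lt [x, y, z, p, q, r]
    (by simp only [List.length_cons, List.length_nil, Finset.card_univ]; omega)
  obtain ⟨v, -, hv⟩ := (Finset.univ : Finset α).exists_mem_ne_of_length_lt [x, y, z, p, q, r, u]
    (by simp only [List.length_cons, List.length_nil, Finset.card_univ]; omega)
  have hn : [p, q, r, u, v].Nodup := by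
    simp only [List.nodup_cons, List.mem_cons, List.not_mem_nil, not_or] at h ⊢
    grind
  simp only [List.nodup_cons, List.mem_cons, List.not_mem_nil, not_or] at h
  obtain ⟨g, hg, hfix⟩ := exists_conj_threeCycle_eq_inv hn
  have hgx : g * threeCycle x y z * g⁻¹ = threeCycle x y z := by
    rw [conj_threeCycle, hfix x, hfix y, hfix z] <;> grind
  have hcomm : threeCycle p q r * threeCycle x y z = threeCycle x y z * threeCycle p q r := by
    rw [← mul_inv_eq_iff_eq_mul, conj_threeCycle,
      threeCycle_apply (by grind) (by grind) (by grind),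
      threeCycle_apply (by grind) (by grind) (by grind),
      threeCycle_apply (by grind) (by grind) (by grind)]
    congr 1 <;> grind [rotate]
  obtain ⟨B, hB⟩ := QuotientGroup.mk_surjective (φ (threeCycle p q r))
  obtain ⟨H, hH⟩ := QuotientGroup.mk_surjective (φ g)
  obtain ⟨c, hc, hBX⟩ := exists_eq_mul_center_of_mk_eq (a := X * B) (b := B * X) (by
    rw [QuotientGroup.mk_mul, QuotientGroup.mk_mul, hX, hB, ← map_mul, ← map_mul, hcomm])
  obtain ⟨s, hs, hHX⟩ := exists_eq_mul_center_of_mk_eq (a := X) (b := H * X * H⁻¹) (by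
    rw [QuotientGroup.mk_mul, QuotientGroup.mk_mul, QuotientGroup.mk_inv, hX, hH, ← map_inv,
      ← map_mul, ← map_mul, hgx])
  obtain ⟨t, ht, hHB⟩ := exists_eq_mul_center_of_mk_eq (a := B⁻¹) (b := H * B * H⁻¹) (by
    rw [QuotientGroup.mk_mul, QuotientGroup.mk_mul, QuotientGroup.mk_inv, QuotientGroup.mk_inv, hB,
      hH, ← map_inv, ← map_inv, ← map_mul, ← map_mul, hg])
  have hB3 : B ^ 3 ∈ Subgroup.center G := by
    rw [← QuotientGroup.eq_one_iff, QuotientGroup.mk_pow, hB, ← map_pow,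
      threeCycle_cube (by grind) (by grind) (by grind), map_one]
  exact (mem_liftCentralizer hB).2 (mul_comm_of_inverts hc hs ht hB3 hBX hHX hHB)

lemma mem_liftCentralizer_of_fixed (hα : 8 ≤ Fintype.card α) {x y z : α} (hxy : x ≠ y)
    (hxz : x ≠ z) (hyz : y ≠ z) {X : G} (hX : (X : G ⧸ Subgroup.center G) = φ (threeCycle x y z))
    {k : alternatingGroup α} (hx : (k : Perm α) x = x) (hy : (k : Perm α) y = y)
    (hz : (k : Perm α) z = z) : k ∈ liftCentralizer φ X := by
  have hle : alternatingGroup {t // t ≠ x ∧ t ≠ y ∧ t ≠ z} ≤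
      ((liftCentralizer φ X).map (alternatingGroup α).subtype).comap ofSubtype := by
    rw [← closure_three_cycles_eq_alternating, Subgroup.closure_le]
    intro σ hσ
    obtain ⟨p, q, r, hpq, hpr, hqr, he⟩ :=
      exists_eq_threeCycle (σ := ⟨σ, mem_alternatingGroup.2 hσ.sign⟩) hσ
    refine ⟨threeCycle p.1 q.1 r.1, threeCycle_mem_liftCentralizer hα ?_ hX, ?_⟩
    · simp only [List.nodup_cons, List.mem_cons, List.not_mem_nil, not_or]
      grind
    · rw [Subtype.ext_iff, coe_threeCycle hpq hqr] at he
      rw [show σ = _ from he, map_mul, ofSubtype_swap_eq, ofSubtype_swap_eq,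
        Subgroup.coe_subtype, coe_threeCycle (by grind) (by grind)]
  have hinj := (k : Perm α).injective
  have h1 : ∀ t, ((k : Perm α) t ≠ x ∧ (k : Perm α) t ≠ y ∧ (k : Perm α) t ≠ z) ↔
      (t ≠ x ∧ t ≠ y ∧ t ≠ z) := by
    intro t
    rw [← hinj.ne_iff (x := t) (y := x), ← hinj.ne_iff (x := t) (y := y),
      ← hinj.ne_iff (x := t) (y := z), hx, hy, hz]
  have h2 : ∀ t, (k : Perm α) t ≠ t → (t ≠ x ∧ t ≠ y ∧ t ≠ z) := by
    intro t ht
    refine ⟨?_, ?_, ?_⟩ <;> rintro rfl <;> contradiction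
  have hmem : subtypePerm (k : Perm α) h1 ∈ alternatingGroup {t // t ≠ x ∧ t ≠ y ∧ t ≠ z} := by
    rw [mem_alternatingGroup, sign_subtypePerm _ h1 h2]
    exact mem_alternatingGroup.1 k.2
  obtain ⟨k', hk', he⟩ := hle hmem
  rw [ofSubtype_subtypePerm h1 h2] at he
  rwa [← Subtype.ext he]

lemma mem_liftCentralizer_of_commute (hα : 8 ≤ Fintype.card α) {x y z : α} (hxy : x ≠ y)
    (hxz : x ≠ z) (hyz : y ≠ z) {X : G} (hX : (X : G ⧸ Subgroup.center G) = φ (threeCycle x y z))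
    {k : alternatingGroup α} (hk : k * threeCycle x y z = threeCycle x y z * k) :
    k ∈ liftCentralizer φ X := by
  set a := threeCycle x y z with ha
  have hap : ∀ t, (a : Perm α) t = rotate x y z t := threeCycle_apply hxy hxz hyz
  have hax : (a : Perm α) x = y := by rw [hap]; grind [rotate]
  have hay : (a : Perm α) y = z := by rw [hap]; grind [rotate]
  have haz : (a : Perm α) z = x := by rw [hap]; grind [rotate]
  have hfix : ∀ m : alternatingGroup α, m * a = a * m → (m : Perm α) x = x →
      m ∈ liftCentralizer φ X := by
    intro m hm hx
    have hp : ∀ t, (m : Perm α) ((a : Perm α) t) = (a : Perm α) ((m : Perm α) t) := fun t =>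
      congrArg (fun g : alternatingGroup α => (g : Perm α) t) hm
    have hy : (m : Perm α) y = y := by rw [← hax, hp, hx]
    have hz : (m : Perm α) z = z := by rw [← hay, hp, hy]
    exact mem_liftCentralizer_of_fixed hα hxy hxz hyz hX hx hy hz
  have haX : a ∈ liftCentralizer φ X := (mem_liftCentralizer hX).2 rfl
  have hkx : (k : Perm α) x = x ∨ (k : Perm α) x = y ∨ (k : Perm α) x = z := by
    by_contra hne
    have h1 : (k : Perm α) ((a : Perm α) x) = (a : Perm α) ((k : Perm α) x) :=
      congrArg (fun g : alternatingGroup α => (g : Perm α) x) hk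
    have h2 : (a : Perm α) ((k : Perm α) x) = (k : Perm α) x := by rw [hap]; grind [rotate]
    rw [h2, hax] at h1
    exact hxy ((k : Perm α).injective h1).symm
  rcases hkx with h | h | h
  · exact hfix k hk h
  · refine (Subgroup.mul_mem_cancel_left _ (inv_mem haX)).1 (hfix (a⁻¹ * k) ?_ ?_)
    · rw [mul_assoc, hk]; group
    · rw [Subgroup.coe_mul, Perm.mul_apply, h, Subgroup.coe_inv, Perm.inv_eq_iff_eq, hax]
  · refine (Subgroup.mul_mem_cancel_left _ haX).1 (hfix (a * k) ?_ ?_)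
    · rw [mul_assoc, hk]
    · rw [Subgroup.coe_mul, Perm.mul_apply, h, haz]

end CommutingLifts

section InvertingLift

open Equiv Equiv.Perm

variable {α : Type*} [Fintype α] [DecidableEq α] {G : Type*} [Group G]
  (φ : alternatingGroup α →* G ⧸ Subgroup.center G)

/-- `X` is a lift of `φ a` of order dividing `3` that is inverted by every lift of every element
inverting `a`. -/
structure IsInvertingLift (a : alternatingGroup α) (X : G) : Prop where
  mk_eq : (X : G ⧸ Subgroup.center G) = φ a
  cube : X ^ 3 = 1
  conj_eq_inv : ∀ h : alternatingGroup α, h * a * h⁻¹ = a⁻¹ →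
    ∀ H : G, (H : G ⧸ Subgroup.center G) = φ h → H * X * H⁻¹ = X⁻¹

variable {φ}

lemma commute_of_mem_center {c : G} (hc : c ∈ Subgroup.center G) (X : G) : Commute X c :=
  Subgroup.mem_center_iff.1 hc X

namespace IsInvertingLift

variable {a : alternatingGroup α} {X : G}

lemma inv (h : IsInvertingLift φ a X) : IsInvertingLift φ a⁻¹ X⁻¹ where
  mk_eq := by rw [QuotientGroup.mk_inv, h.mk_eq, map_inv]
  cube := by rw [inv_pow, h.cube, inv_one]
  conj_eq_inv g hg H hH := by
    have hg' : g * a * g⁻¹ = a⁻¹ := by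
      rw [inv_inv] at hg
      rw [← conj_inv, inv_eq_iff_eq_inv] at hg
      exact hg
    rw [← h.conj_eq_inv g hg' H hH, conj_inv, h.conj_eq_inv g hg' H hH]

lemma conj (h : IsInvertingLift φ a X) {k : alternatingGroup α} {K : G}
    (hK : (K : G ⧸ Subgroup.center G) = φ k) :
    IsInvertingLift φ (k * a * k⁻¹) (K * X * K⁻¹) where
  mk_eq := by
    rw [QuotientGroup.mk_mul, QuotientGroup.mk_mul, QuotientGroup.mk_inv, h.mk_eq, hK, map_mul,
      map_mul, map_inv]
  cube := by rw [conj_pow, h.cube]; group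
  conj_eq_inv g hg H hH := by
    have hg' : (k⁻¹ * g * k) * a * (k⁻¹ * g * k)⁻¹ = a⁻¹ := by
      calc _ = k⁻¹ * (g * (k * a * k⁻¹) * g⁻¹) * k := by group
        _ = a⁻¹ := by rw [hg]; group
    have := h.conj_eq_inv _ hg' (K⁻¹ * H * K) (by
      rw [QuotientGroup.mk_mul, QuotientGroup.mk_mul, QuotientGroup.mk_inv, hH, hK, map_mul,
        map_mul, map_inv])
    calc H * (K * X * K⁻¹) * H⁻¹ = K * (K⁻¹ * H * K * X * (K⁻¹ * H * K)⁻¹) * K⁻¹ := by group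
      _ = (K * X * K⁻¹)⁻¹ := by rw [this]; group

lemma unique {X' : G} (h : IsInvertingLift φ a X) (h' : IsInvertingLift φ a X')
    (ha : ∃ g : alternatingGroup α, g * a * g⁻¹ = a⁻¹) : X = X' := by
  obtain ⟨g, hg⟩ := ha
  obtain ⟨H, hH⟩ := QuotientGroup.mk_surjective (φ g)
  obtain ⟨c, hc, rfl⟩ := exists_eq_mul_center_of_mk_eq (h.mk_eq.trans h'.mk_eq.symm)
  have hcube : c ^ 3 = 1 := by
    have := h'.cube
    rwa [(commute_of_mem_center hc X).mul_pow, h.cube, one_mul] at this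
  have hsq : c ^ 2 = 1 := by
    have h1 := h'.conj_eq_inv g hg H hH
    have h2 : H * (X * c) * H⁻¹ = X⁻¹ * c := by
      rw [← h.conj_eq_inv g hg H hH, mul_assoc _ H⁻¹, (commute_of_mem_center hc H⁻¹).eq]
      simp only [mul_assoc]
    rw [h2, (commute_of_mem_center hc X).eq, mul_inv_rev, mul_right_inj] at h1
    rw [pow_two]
    nth_rewrite 1 [h1]
    exact inv_mul_cancel c
  rw [eq_one_of_sq_of_cube hsq hcube, mul_one]

end IsInvertingLift

lemma exists_inverting (hα : 8 ≤ Fintype.card α) {x y z : α} (hxy : x ≠ y) (hxz : x ≠ z)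
    (hyz : y ≠ z) :
    ∃ g : alternatingGroup α, g * threeCycle x y z * g⁻¹ = (threeCycle x y z)⁻¹ := by
  obtain ⟨u, -, hu⟩ := (Finset.univ : Finset α).exists_mem_ne_of_length_lt [x, y, z]
    (by simp only [List.length_cons, List.length_nil, Finset.card_univ]; omega)
  obtain ⟨v, -, hv⟩ := (Finset.univ : Finset α).exists_mem_ne_of_length_lt [x, y, z, u]
    (by simp only [List.length_cons, List.length_nil, Finset.card_univ]; omega)
  obtain ⟨g, hg, -⟩ := exists_conj_threeCycle_eq_inv (x := x) (y := y) (z := z) (p := u) (q := v)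
    (by
      simp only [List.nodup_cons, List.mem_cons, List.not_mem_nil, not_or]
      grind)
  exact ⟨g, hg⟩

lemma exists_isInvertingLift (hα : 8 ≤ Fintype.card α)
    (hdiv : ∀ z ∈ Subgroup.center G, ∃ y ∈ Subgroup.center G, y ^ 3 = z) {x y z : α} (hxy : x ≠ y)
    (hxz : x ≠ z) (hyz : y ≠ z) : ∃ X : G, IsInvertingLift φ (threeCycle x y z) X := by
  obtain ⟨g, hg⟩ := exists_inverting hα hxy hxz hyz
  obtain ⟨H, hH⟩ := QuotientGroup.mk_surjective (φ g)
  obtain ⟨A, hA⟩ := QuotientGroup.mk_surjective (φ (threeCycle x y z))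
  obtain ⟨w, hw, hwA⟩ := hdiv (A ^ 3) (by
    rw [← QuotientGroup.eq_one_iff, QuotientGroup.mk_pow, hA, ← map_pow,
      threeCycle_cube hxy hxz hyz, map_one])
  obtain ⟨B, hB, hB3⟩ : ∃ B : G, (B : G ⧸ Subgroup.center G) = φ (threeCycle x y z) ∧ B ^ 3 = 1 :=
    ⟨A * w⁻¹, by rw [mk_mul_center (inv_mem hw), hA], by
      rw [(commute_of_mem_center (inv_mem hw) A).mul_pow, inv_pow, hwA, mul_inv_cancel]⟩
  obtain ⟨l, hl, hHB⟩ := exists_eq_mul_center_of_mk_eq (a := B⁻¹) (b := H * B * H⁻¹) (by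
    rw [QuotientGroup.mk_mul, QuotientGroup.mk_mul, QuotientGroup.mk_inv, QuotientGroup.mk_inv, hB,
      hH, ← map_inv, ← map_inv, ← map_mul, ← map_mul, hg])
  have hl3 : l ^ 3 = 1 := by
    have h1 : (H * B * H⁻¹) ^ 3 = 1 := by rw [conj_pow, hB3]; group
    rwa [hHB, (commute_of_mem_center hl _).mul_pow, inv_pow, hB3, inv_one, one_mul] at h1
  have hX : ((B * l : G) : G ⧸ Subgroup.center G) = φ (threeCycle x y z) := by
    rw [mk_mul_center hl, hB]
  have hHX : H * (B * l) * H⁻¹ = (B * l)⁻¹ := by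
    have h1 : H * (B * l) * H⁻¹ = B⁻¹ * l * l := by
      rw [← hHB, mul_assoc _ H⁻¹, (commute_of_mem_center hl H⁻¹).eq]
      simp only [mul_assoc]
    rw [h1, (commute_of_mem_center hl B).eq, mul_inv_rev, mul_assoc, mul_right_inj,
      eq_inv_iff_mul_eq_one, ← hl3]
    simp only [pow_succ, pow_zero, one_mul]
  refine ⟨B * l, hX, ?_, fun h hh L hL => ?_⟩
  · rw [(commute_of_mem_center hl B).mul_pow, hB3, hl3, one_mul]
  · have hk : (g⁻¹ * h) * threeCycle x y z = threeCycle x y z * (g⁻¹ * h) := by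
      rw [← mul_inv_eq_iff_eq_mul]
      calc _ = g⁻¹ * (h * threeCycle x y z * h⁻¹) * g := by group
        _ = threeCycle x y z := by rw [hh, ← hg]; group
    have hcomm := (mem_liftCentralizer (K := H⁻¹ * L) (by
      rw [QuotientGroup.mk_mul, QuotientGroup.mk_inv, hL, hH, map_mul, map_inv])).1
      (mem_liftCentralizer_of_commute hα hxy hxz hyz hX hk)
    rw [← mul_inv_eq_iff_eq_mul] at hcomm
    calc L * (B * l) * L⁻¹ = H * (H⁻¹ * L * (B * l) * (H⁻¹ * L)⁻¹) * H⁻¹ := by group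
      _ = (B * l)⁻¹ := by rw [hcomm, hHX]

variable (φ) in
/-- The properties of a coherent choice of lifts of the 3-cycles. -/
structure IsCoherentLift (T : α → α → α → G) : Prop where
  mk_eq : ∀ {x y z : α}, x ≠ y → x ≠ z → y ≠ z →
    (T x y z : G ⧸ Subgroup.center G) = φ (threeCycle x y z)
  cube : ∀ {x y z : α}, x ≠ y → x ≠ z → y ≠ z → T x y z ^ 3 = 1
  cyc : ∀ {x y z : α}, x ≠ y → x ≠ z → y ≠ z → T y z x = T x y z
  inv : ∀ {x y z : α}, x ≠ y → x ≠ z → y ≠ z → T x z y = (T x y z)⁻¹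
  conj : ∀ {x y z : α}, x ≠ y → x ≠ z → y ≠ z → ∀ {g : alternatingGroup α} {K : G},
    (K : G ⧸ Subgroup.center G) = φ g →
    K * T x y z * K⁻¹ = T ((g : Perm α) x) ((g : Perm α) y) ((g : Perm α) z)

theorem exists_isCoherentLift (hα : 8 ≤ Fintype.card α)
    (hdiv : ∀ z ∈ Subgroup.center G, ∃ y ∈ Subgroup.center G, y ^ 3 = z) :
    ∃ T : α → α → α → G, IsCoherentLift φ T := by
  have hex : ∀ x y z : α, ∃ X : G, x ≠ y → x ≠ z → y ≠ z →
      IsInvertingLift φ (threeCycle x y z) X := by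
    intro x y z
    by_cases h : x ≠ y ∧ x ≠ z ∧ y ≠ z
    · obtain ⟨X, hX⟩ := exists_isInvertingLift (φ := φ) hα hdiv h.1 h.2.1 h.2.2
      exact ⟨X, fun _ _ _ => hX⟩
    · exact ⟨1, fun h1 h2 h3 => absurd ⟨h1, h2, h3⟩ h⟩
  choose T hT using hex
  refine ⟨T, ⟨fun h1 h2 h3 => (hT _ _ _ h1 h2 h3).mk_eq, fun h1 h2 h3 => (hT _ _ _ h1 h2 h3).cube,
    fun h1 h2 h3 => ?_, fun h1 h2 h3 => ?_, fun {x y z} h1 h2 h3 g K hK => ?_⟩⟩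
  · have := hT _ _ _ h3 h1.symm h2.symm
    rw [threeCycle_rotate h1 h2 h3] at this
    exact this.unique (hT _ _ _ h1 h2 h3) (exists_inverting hα h1 h2 h3)
  · refine (hT _ _ _ h2 h1 h3.symm).unique ?_ (exists_inverting hα h2 h1 h3.symm)
    rw [threeCycle_inv h1 h2 h3]
    exact (hT _ _ _ h1 h2 h3).inv
  · have hinj := (g : Perm α).injective
    refine IsInvertingLift.unique (φ := φ) ?_
      (hT _ _ _ (hinj.ne h1) (hinj.ne h2) (hinj.ne h3))
      (exists_inverting hα (hinj.ne h1) (hinj.ne h2) (hinj.ne h3))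
    rw [← conj_threeCycle]
    exact (hT _ _ _ h1 h2 h3).conj hK

lemma exists_alternatingGroup_map_eq (hα : 6 ≤ Fintype.card α) {x y i j x' y' i' j' : α}
    (h : [x, y, i, j].Nodup) (h' : [x', y', i', j'].Nodup) :
    ∃ g : alternatingGroup α, (g : Perm α) x = x' ∧ (g : Perm α) y = y' ∧ (g : Perm α) i = i' ∧
      (g : Perm α) j = j' := by
  have hcard : 6 ≤ Nat.card α := by rwa [Nat.card_eq_fintype_card]
  have := alternatingGroup.isMultiplyPretransitive α
  have h4 : MulAction.IsMultiplyPretransitive (alternatingGroup α) α 4 :=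
    MulAction.isMultiplyPretransitive_of_le (n := Nat.card α - 2) (by omega) (by omega)
  rw [MulAction.isMultiplyPretransitive_iff] at h4
  have hinj : ∀ {a b c d : α}, [a, b, c, d].Nodup → Function.Injective ![a, b, c, d] := by
    intro a b c d hn
    exact List.nodup_ofFn.1 (show (List.ofFn ![a, b, c, d]).Nodup by simpa using hn)
  obtain ⟨g, hg⟩ := h4 ⟨_, hinj h⟩ ⟨_, hinj h'⟩
  exact ⟨g, DFunLike.congr_fun hg 0, DFunLike.congr_fun hg 1, DFunLike.congr_fun hg 2,
    DFunLike.congr_fun hg 3⟩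

namespace IsCoherentLift

variable {T : α → α → α → G}

lemma mul_sq_mem_center (hT : IsCoherentLift φ T) {x y i j : α} (h : [x, y, i, j].Nodup) :
    (T x y i * T x y j) ^ 2 ∈ Subgroup.center G := by
  have h' := h
  simp only [List.nodup_cons, List.mem_cons, List.not_mem_nil, not_or] at h
  rw [← QuotientGroup.eq_one_iff, QuotientGroup.mk_pow, QuotientGroup.mk_mul,
    hT.mk_eq (by grind) (by grind) (by grind), hT.mk_eq (by grind) (by grind) (by grind),
    ← map_mul, ← map_pow, threeCycle_mul_sq h', map_one]

lemma conj_mul_sq (hT : IsCoherentLift φ T) {x y i j : α} (h : [x, y, i, j].Nodup)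
    (g : alternatingGroup α) :
    (T x y i * T x y j) ^ 2 = (T ((g : Perm α) x) ((g : Perm α) y) ((g : Perm α) i) *
      T ((g : Perm α) x) ((g : Perm α) y) ((g : Perm α) j)) ^ 2 := by
  obtain ⟨K, hK⟩ := QuotientGroup.mk_surjective (φ g)
  have hc := (commute_of_mem_center (hT.mul_sq_mem_center h) K).eq
  simp only [List.nodup_cons, List.mem_cons, List.not_mem_nil, not_or] at h
  rw [← hT.conj (by grind) (by grind) (by grind) hK, ← hT.conj (by grind) (by grind) (by grind) hK,
    
    eq_mul_inv_of_mul_eq hc.symm, ← conj_pow]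
  congr 1
  group

lemma mul_sq_mul_self (hT : IsCoherentLift φ T) {x y i j p q : α}
    (h : [x, y, i, j, p, q].Nodup) :
    (T x y i * T x y j) ^ 2 * (T x y i * T x y j) ^ 2 = 1 := by
  have h4 : [x, y, i, j].Nodup := by
    simp only [List.nodup_cons, List.mem_cons, List.not_mem_nil, not_or] at h ⊢
    grind
  simp only [List.nodup_cons, List.mem_cons, List.not_mem_nil, not_or] at h
  obtain ⟨g, hg⟩ := exists_swap_mul_swap (show x ≠ y by grind) (show p ≠ q by grind)
  have hx : (g : Perm α) x = y := by
    rw [hg, Perm.mul_apply, swap_apply_of_ne_of_ne (show x ≠ p by grind) (show x ≠ q by grind),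
      swap_apply_left]
  have hy : (g : Perm α) y = x := by
    rw [hg, Perm.mul_apply, swap_apply_of_ne_of_ne (show y ≠ p by grind) (show y ≠ q by grind),
      swap_apply_right]
  have hfix : ∀ t, t ≠ x → t ≠ y → t ≠ p → t ≠ q → (g : Perm α) t = t := by
    intro t h1 h2 h3 h4
    rw [hg, Perm.mul_apply, swap_apply_of_ne_of_ne h3 h4, swap_apply_of_ne_of_ne h1 h2]
  have hinv : ∀ t, x ≠ t → y ≠ t → T y x t = (T x y t)⁻¹ := by
    intro t h1 h2
    rw [← hT.cyc (by grind) h2 h1, hT.inv (by grind) h1 h2]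
  have hconj := hT.conj_mul_sq h4 g
  rw [hx, hy, hfix i (by grind) (by grind) (by grind) (by grind),
    hfix j (by grind) (by grind) (by grind) (by grind), hinv i (by grind) (by grind),
    hinv j (by grind) (by grind)] at hconj
  have hc := (commute_of_mem_center (hT.mul_sq_mem_center h4) (T x y j)).eq
  nth_rewrite 2 [hconj]
  rw [← mul_inv_rev, inv_pow, mul_inv_eq_one]
  refine mul_right_cancel (b := T x y j) (hc.symm.trans ?_)
  simp only [pow_two, mul_assoc]

lemma exists_mul_sq_eq (hT : IsCoherentLift φ T) (hα : 6 ≤ Fintype.card α) :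
    ∃ ε ∈ Subgroup.center G, ε * ε = 1 ∧
      ∀ {x y i j : α}, [x, y, i, j].Nodup → (T x y i * T x y j) ^ 2 = ε := by
  obtain ⟨f⟩ := Function.Embedding.nonempty_of_card_le (α := Fin 6) (β := α) (by simpa using hα)
  have h6 : [f 0, f 1, f 2, f 3, f 4, f 5].Nodup := by simp
  have h4 : [f 0, f 1, f 2, f 3].Nodup := by
    simp only [List.nodup_cons, List.mem_cons, List.not_mem_nil, not_or] at h6 ⊢
    grind
  refine ⟨_, hT.mul_sq_mem_center h4, hT.mul_sq_mul_self h6, fun {x y i j} h => ?_⟩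
  obtain ⟨g, hx, hy, hi, hj⟩ := exists_alternatingGroup_map_eq hα h h4
  rw [hT.conj_mul_sq h g, hx, hy, hi, hj]

end IsCoherentLift

end InvertingLift

section ProjectiveLinear

open Equiv Equiv.Perm

lemma exists_pow_three_eq_of_mem_center {n K : Type*} [Fintype n] [DecidableEq n] [Field K]
    [IsAlgClosed K] {z : GL n K} (hz : z ∈ Subgroup.center (GL n K)) :
    ∃ y ∈ Subgroup.center (GL n K), y ^ 3 = z := by
  rw [Matrix.GeneralLinearGroup.center_eq_range_scalar] at hz ⊢
  obtain ⟨u, rfl⟩ := hz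
  obtain ⟨w, hw⟩ := IsAlgClosed.exists_pow_nat_eq (u : K) (n := 3) three_pos
  have hw0 : w ≠ 0 := by
    rintro rfl
    exact u.ne_zero (by rw [← hw, zero_pow three_ne_zero])
  refine ⟨_, ⟨Units.mk0 w hw0, rfl⟩, ?_⟩
  rw [← map_pow]
  congr 1
  exact Units.ext hw

variable {α n K : Type*} [Fintype α] [DecidableEq α] [Fintype n] [DecidableEq n] [Field K]

lemma IsCoherentLift.isTripleRep {φ : alternatingGroup α →* GL n K ⧸ Subgroup.center (GL n K)}
    {T : α → α → α → GL n K} (hT : IsCoherentLift φ T) {e : Kˣ}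
    (he : ∀ {x y i j : α}, [x, y, i, j].Nodup →
      (T x y i * T x y j) ^ 2 = Matrix.GeneralLinearGroup.scalar n e) :
    IsTripleRep (fun x y z => Matrix.toLin' (T x y z).val) (e : K) where
  cyc hxy hxz hyz := by rw [hT.cyc hxy hxz hyz]
  inv hxy hxz hyz w := by
    rw [← Matrix.toLin'_mul_apply, ← Units.val_mul, hT.inv hxy hxz hyz, inv_mul_cancel,
      Units.val_one, Matrix.toLin'_one, LinearMap.id_apply]
  cube hxy hxz hyz w := by
    rw [← Matrix.toLin'_mul_apply, ← Matrix.toLin'_mul_apply, ← Units.val_mul, ← Units.val_mul,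
      ← pow_two, ← pow_succ, hT.cube hxy hxz hyz, Units.val_one, Matrix.toLin'_one,
      LinearMap.id_apply]
  conj hxy hxz hyz hpq hpr hqr w := by
    have h := hT.conj hpq hpr hqr (hT.mk_eq hxy hxz hyz)
    rw [mul_inv_eq_iff_eq_mul, threeCycle_apply hxy hxz hyz, threeCycle_apply hxy hxz hyz,
      threeCycle_apply hxy hxz hyz] at h
    rw [← Matrix.toLin'_mul_apply, ← Matrix.toLin'_mul_apply, ← Units.val_mul, ← Units.val_mul, h]
  rel {x y i j} hxy hxi hxj hyi hyj hij w := by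
    have h := he (x := x) (y := y) (i := i) (j := j) (by simp; grind)
    rw [← Matrix.toLin'_mul_apply, ← Matrix.toLin'_mul_apply, ← Matrix.toLin'_mul_apply,
      ← Units.val_mul, ← Units.val_mul, ← Units.val_mul,
      show T x y i * T x y j * T x y i * T x y j = (T x y i * T x y j) ^ 2 by
        rw [pow_two, ← mul_assoc], h]
    ext k
    simp [Matrix.toLin'_apply, Matrix.mulVec_diagonal]

theorem threeCycle_map_eq_one [IsAlgClosed K] [CharZero K] (hα : 10 ≤ Fintype.card α)
    (hn : 0 < Fintype.card n) (hlt : Fintype.card n + 1 < Fintype.card α)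
    (φ : alternatingGroup α →* GL n K ⧸ Subgroup.center (GL n K)) {x y z : α} (hxy : x ≠ y)
    (hxz : x ≠ z) (hyz : y ≠ z) : φ (threeCycle x y z) = 1 := by
  obtain ⟨T, hT⟩ := exists_isCoherentLift (φ := φ) (by omega)
    fun _ => exists_pow_three_eq_of_mem_center
  obtain ⟨ε, hε, hεε, hrel⟩ := hT.exists_mul_sq_eq (by omega)
  rw [Matrix.GeneralLinearGroup.center_eq_range_scalar] at hε
  obtain ⟨e, rfl⟩ := hε
  have : Nonempty n := Fintype.card_pos_iff.1 hn
  have hee : (e : K) * e = 1 := by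
    have h := congrArg (fun g : GL n K => g.val (Classical.arbitrary n) (Classical.arbitrary n)) hεε
    simpa using h
  have h := (hT.isTripleRep hrel).eq_one_of_finrank_lt hee hα
    (by rwa [Module.finrank_fintype_fun_eq_card]) (by rwa [Module.finrank_fintype_fun_eq_card])
    hxy hxz hyz
  have h1 : T x y z = 1 :=
    Units.ext (Matrix.toLin'.injective (h.trans Matrix.toLin'_one.symm))
  rw [← hT.mk_eq hxy hxz hyz, h1, QuotientGroup.mk_one]

end ProjectiveLinear

lemma mem_center_of_map_mem_center {n F K : Type*} [Fintype n] [DecidableEq n] [Field F] [Field K]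
    (f : F →+* K) {g : GL n F}
    (hg : Matrix.GeneralLinearGroup.map f g ∈ Subgroup.center (GL n K)) :
    g ∈ Subgroup.center (GL n F) := by
  rw [Subgroup.mem_center_iff] at hg ⊢
  intro h
  have := hg (Matrix.GeneralLinearGroup.map f h)
  rw [← map_mul, ← map_mul] at this
  exact Units.ext (Matrix.map_injective f.injective (congrArg Units.val this))

/-- Let `d ≥ 8` be an even integer.  Then every nontrivial projective
representation of the alternating group `A_{d+2}` in characteristic zero has dimension
`≠ d`: for every field `F` of characteristic `0`, every group homomorphism
`A_{d+2} → PGL_d(F)` is trivial. -/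
theorem alternating_hom_to_pgl_char_zero_trivial
    (d : ℕ) (hd : 8 ≤ d) (hde : Even d)
    (F : Type*) [Field F] [CharZero F]
    (φ : alternatingGroup (Fin (d + 2)) →* ProjGL d F) : φ = 1 := by
  have : CharZero (AlgebraicClosure F) := charZero_of_injective_algebraMap
    (algebraMap F (AlgebraicClosure F)).injective
  let f := algebraMap F (AlgebraicClosure F)
  let ψ : ProjGL d F →* GL (Fin d) (AlgebraicClosure F) ⧸ Subgroup.center _ :=
    QuotientGroup.map _ _ (Matrix.GeneralLinearGroup.map f)
      (Matrix.GeneralLinearGroup.map_center_le f)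
  have hker : ⊤ ≤ φ.ker := by
    rw [← alternatingGroup.closure_isThreeCycles_eq_top, Subgroup.closure_le]
    intro σ hσ
    obtain ⟨x, y, z, hxy, hxz, hyz, rfl⟩ := exists_eq_threeCycle hσ
    have h := threeCycle_map_eq_one (by simpa using hd) (by simpa using (by omega : 0 < d))
      (by simp) (ψ.comp φ) hxy hxz hyz
    obtain ⟨g, hg⟩ := QuotientGroup.mk_surjective (φ (threeCycle x y z))
    rw [MonoidHom.comp_apply, ← hg, QuotientGroup.map_mk, QuotientGroup.eq_one_iff] at h
    rw [SetLike.mem_coe, MonoidHom.mem_ker, ← hg, QuotientGroup.eq_one_iff]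
    exact mem_center_of_map_mem_center f h
  ext1 σ
  exact hker (Subgroup.mem_top σ)
end

section
/- Let d = 2m ≥ 8 be an even integer. Then there does not exist a faithful symplectic d-dimensional representation of the alternating group A_{d+1} in characteristic 0; that is, for every field F of characteristic 0, there is no injective group homomorphism from A_{d+1} into the symplectic group Sp_{2m}(F) (the group of 2m × 2m matrices over F preserving the standard nondegenerate alternating bilinear form). -/
open Equiv Finset

namespace AlternatingSymplectic

theorem add_two_le_choose {n r : ℕ} (hr : 2 ≤ r) (hrn : r + 2 ≤ n) : n + 2 ≤ n.choose r := by
  induction n generalizing r with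
  | zero => omega
  | succ n ih =>
    obtain ⟨r, rfl⟩ : ∃ s, r = s + 1 := ⟨r - 1, by omega⟩
    rw [Nat.choose_succ_succ']
    rcases Nat.lt_or_ge r 2 with h | h
    · obtain rfl : r = 1 := by omega
      rcases Nat.lt_or_ge n 4 with h4 | h4
      · obtain rfl : n = 3 := by omega
        decide
      · have := ih le_rfl h4
        rw [Nat.choose_one_right, one_add_one_eq_two]
        omega
    · have h₁ := ih h (by omega)
      have h₂ : 0 < n.choose (r + 1) := Nat.choose_pos (by omega)
      omega

variable {ι : Type*} [DecidableEq ι]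

/-- The transposition of the two points lying over `i`. -/
def pairSwap (i : ι) : Perm (ι × Bool) := swap (i, false) (i, true)

theorem pairSwap_mul_self (i : ι) : pairSwap i * pairSwap i = 1 := swap_mul_self _ _

theorem pairSwap_comm (i j : ι) : pairSwap i * pairSwap j = pairSwap j * pairSwap i := by
  by_cases h : i = j
  · rw [h]
  · refine (Perm.Disjoint.commute ?_).eq
    intro x
    by_cases hx : x.1 = i
    · right
      exact swap_apply_of_ne_of_ne (by grind) (by grind)
    · left
      exact swap_apply_of_ne_of_ne (by grind) (by grind)

variable {F : Type*} [Field F]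

/-- The value at `i` of the sign function attached to the finite set `S`. -/
def sgn (F : Type*) [Field F] (S : Finset ι) (i : ι) : F := if i ∈ S then -1 else 1

theorem sgn_mul_self (S : Finset ι) (i : ι) : sgn F S i * sgn F S i = 1 := by
  unfold sgn; split_ifs <;> simp

theorem sgn_eq_sgn_iff [CharZero F] {S T : Finset ι} {i : ι} :
    sgn F S i = sgn F T i ↔ (i ∈ S ↔ i ∈ T) := by
  have h : (-1 : F) ≠ 1 := by norm_num
  unfold sgn
  by_cases hS : i ∈ S <;> by_cases hT : i ∈ T <;> simp [hS, hT, h, h.symm]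

variable [Fintype ι]

/-- The product of the transpositions of the pairs over `i` and over `j`. -/
def dbl (i j : ι) : alternatingGroup (ι × Bool) :=
  ⟨pairSwap i * pairSwap j, by
    rw [Perm.mem_alternatingGroup, map_mul, pairSwap, pairSwap, Perm.sign_swap (by simp),
      Perm.sign_swap (by simp)]
    rfl⟩

theorem dbl_self (i : ι) : dbl i i = 1 := Subtype.ext (pairSwap_mul_self i)

theorem dbl_comm (i j : ι) : dbl i j = dbl j i := Subtype.ext (pairSwap_comm i j)

theorem dbl_mul_dbl (i j k : ι) : dbl i j * dbl j k = dbl i k := by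
  apply Subtype.ext
  change pairSwap i * pairSwap j * (pairSwap j * pairSwap k) = pairSwap i * pairSwap k
  rw [mul_assoc, ← mul_assoc (pairSwap j), pairSwap_mul_self, one_mul]

theorem dbl_mul_self (i j : ι) : dbl i j * dbl i j = 1 := by
  nth_rw 2 [dbl_comm]
  rw [dbl_mul_dbl, dbl_self]

theorem dbl_mul_comm (i j k l : ι) : dbl i j * dbl k l = dbl k l * dbl i j := by
  apply Subtype.ext
  have h : ∀ i j : ι, Commute (pairSwap i) (pairSwap j) := pairSwap_comm
  exact (((h i k).mul_right (h i l)).mul_left ((h j k).mul_right (h j l))).eq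

/-- The even permutation permuting the pairs as `σ` does. -/
def blockPerm (σ : Perm ι) : alternatingGroup (ι × Bool) :=
  ⟨prodCongrLeft fun _ => σ, by
    rw [Perm.mem_alternatingGroup, Perm.sign_prodCongrLeft]
    simp⟩

theorem conj_swap {α : Type*} [DecidableEq α] (g : Perm α) (x y : α) :
    g * swap x y = swap (g x) (g y) * g := by
  rw [swap_apply_apply, inv_mul_cancel_right]

theorem blockPerm_mul_dbl (σ : Perm ι) (i j : ι) :
    blockPerm σ * dbl i j = dbl (σ i) (σ j) * blockPerm σ := by
  apply Subtype.ext
  change (prodCongrLeft fun _ => σ) * (pairSwap i * pairSwap j) =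
    pairSwap (σ i) * pairSwap (σ j) * (prodCongrLeft fun _ => σ)
  have h : ∀ i, (prodCongrLeft fun _ => σ) * pairSwap i =
      pairSwap (σ i) * (prodCongrLeft fun _ : Bool => σ) := fun i => conj_swap _ _ _
  rw [← mul_assoc, h, mul_assoc, h, mul_assoc]

/-- The 3-cycle fixing `(a, false)` and rotating the other three points over `a` and `b`. -/
def rot (a b : ι) : alternatingGroup (ι × Bool) :=
  ⟨swap (a, true) (b, false) * swap (b, false) (b, true), by
    rw [Perm.mem_alternatingGroup, map_mul, Perm.sign_swap (by simp),
      Perm.sign_swap (by simp)]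
    rfl⟩

theorem rot_mul_dbl {a b i j : ι} (hia : i ≠ a) (hib : i ≠ b)
    (hja : j ≠ a) (hjb : j ≠ b) : rot a b * dbl i j = dbl i j * rot a b := by
  apply Subtype.ext
  change (rot a b).1 * (pairSwap i * pairSwap j) = pairSwap i * pairSwap j * (rot a b).1
  have h : ∀ i, i ≠ a → i ≠ b → (rot a b).1 * pairSwap i = pairSwap i * (rot a b).1 := by
    intro i hia hib
    have h : ∀ x, (rot a b).1 (i, x) = (i, x) := fun x => by
      simp only [rot, Perm.mul_apply]
      rw [swap_apply_of_ne_of_ne (x := (i, x)) (by grind) (by grind),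
        swap_apply_of_ne_of_ne (by grind) (by grind)]
    rw [pairSwap, conj_swap, h, h]
  rw [← mul_assoc, h i hia hib, mul_assoc, h j hja hjb, mul_assoc]

/-- The three conjugates of `dbl a b` under `rot a b` are the involutions of a Klein four-group. -/
theorem rot_conj_prod {a b : ι} (hab : a ≠ b) :
    rot a b * rot a b * dbl a b =
      dbl a b * rot a b * dbl a b * rot a b := by
  apply Subtype.ext
  ext1 ⟨i, x⟩
  change (rot a b).1 ((rot a b).1 ((dbl a b).1 (i, x))) =
    (dbl a b).1 ((rot a b).1 ((dbl a b).1 ((rot a b).1 (i, x))))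
  simp only [rot, dbl, pairSwap, Perm.mul_apply, swap_apply_def]
  grind

variable {V : Type*} [AddCommGroup V] [Module F V]

theorem sgn_compl (S : Finset ι) (i : ι) : sgn F Sᶜ i = -sgn F S i := by
  unfold sgn; by_cases h : i ∈ S <;> simp [h]

theorem eq_or_eq_compl_of_sgn [CharZero F] {S T : Finset ι}
    (h : ∀ i j, sgn F S i * sgn F S j = sgn F T i * sgn F T j) : S = T ∨ S = Tᶜ := by
  by_cases hex : ∃ i, sgn F S i = sgn F T i
  · obtain ⟨i, hi⟩ := hex
    left
    ext j
    have hij := h i j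
    rw [hi] at hij
    have h0 : sgn F T i ≠ 0 := fun h0 => by simpa [h0] using sgn_mul_self (F := F) T i
    exact sgn_eq_sgn_iff.1 (mul_left_cancel₀ h0 hij)
  · push Not at hex
    right
    ext j
    have := mt sgn_eq_sgn_iff.2 (hex j)
    rw [mem_compl]
    tauto

/-- The vector `v` spans, if nonzero, a line on which each `dbl i j` acts through the
character attached to `S`. -/
def IsWeight (ρ : alternatingGroup (ι × Bool) →* Module.End F V) (S : Finset ι) (v : V) : Prop :=
  ∀ i j, ρ (dbl i j) v = (sgn F S i * sgn F S j) • v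

variable {ρ : alternatingGroup (ι × Bool) →* Module.End F V}

theorem IsWeight.compl {S : Finset ι} {v : V} (h : IsWeight ρ S v) : IsWeight ρ Sᶜ v := by
  intro i j
  rw [h, sgn_compl, sgn_compl, neg_mul_neg]

theorem isWeight_of_base {S : Finset ι} {v : V} (c : ι)
    (h : ∀ i, ρ (dbl i c) v = (sgn F S i * sgn F S c) • v) : IsWeight ρ S v := by
  intro i j
  rw [← dbl_mul_dbl i c j, dbl_comm c j, map_mul, Module.End.mul_apply, h j, map_smul, h i,
    smul_smul]
  congr 1
  linear_combination sgn F S i * sgn F S j * sgn_mul_self (F := F) S c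

theorem apply_apply_of_mul_eq {g h k : alternatingGroup (ι × Bool)} (hk : g * h = k) (v : V) :
    ρ g (ρ h v) = ρ k v := by
  rw [← hk, map_mul, Module.End.mul_apply]

theorem apply_ne_zero (g : alternatingGroup (ι × Bool)) {v : V} (hv : v ≠ 0) : ρ g v ≠ 0 := by
  intro h
  apply hv
  have := apply_apply_of_mul_eq (ρ := ρ) (inv_mul_cancel g) v
  rw [h, map_zero, map_one] at this
  exact this.symm

theorem IsWeight.blockPerm {S T : Finset ι} {v : V} (h : IsWeight ρ S v) {σ : Perm ι}
    (hσ : ∀ i, i ∈ S ↔ σ i ∈ T) : IsWeight ρ T (ρ (blockPerm σ) v) := by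
  have hs : ∀ i, sgn F T i = sgn F S (σ.symm i) := fun i => by
    simp only [sgn, hσ, apply_symm_apply]
  intro i j
  have := blockPerm_mul_dbl σ (σ.symm i) (σ.symm j)
  rw [apply_symm_apply, apply_symm_apply] at this
  rw [apply_apply_of_mul_eq this.symm, map_mul, Module.End.mul_apply, h, map_smul, hs, hs]

theorem exists_perm_of_card_eq {S T : Finset ι} (h : S.card = T.card) :
    ∃ σ : Perm ι, ∀ i, i ∈ S ↔ σ i ∈ T := by
  let e : {x // x ∈ S} ≃ {x // x ∈ T} := Finset.equivOfCardEq h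
  refine ⟨e.extendSubtype, fun i => ?_⟩
  by_cases hi : i ∈ S
  · simp only [hi, true_iff]
    exact e.extendSubtype_mem i hi
  · simp only [hi, false_iff]
    exact e.extendSubtype_not_mem i hi

theorem exists_isWeight_of_card_eq {S T : Finset ι} (h : S.card = T.card)
    (hS : ∃ v ≠ 0, IsWeight ρ S v) : ∃ v ≠ 0, IsWeight ρ T v := by
  obtain ⟨v, hv, hw⟩ := hS
  obtain ⟨σ, hσ⟩ := exists_perm_of_card_eq h
  exact ⟨_, apply_ne_zero _ hv, hw.blockPerm hσ⟩

/-- Commuting involutions preserving a nonzero subspace have a common eigenvector there. -/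
theorem exists_common_eigenvector {κ : Type*} (f : κ → Module.End F V)
    (hcomm : ∀ i j v, f i (f j v) = f j (f i v)) (hinv : ∀ i v, f i (f i v) = v)
    (P : Submodule F V) (hP : ∀ i, ∀ v ∈ P, f i v ∈ P) {v₀ : V} (hv₀ : v₀ ∈ P) (h₀ : v₀ ≠ 0)
    (s : Finset κ) :
    ∃ v ∈ P, v ≠ 0 ∧ ∀ i ∈ s, f i v = v ∨ f i v = -v := by
  classical
  induction s using Finset.induction_on with
  | empty => exact ⟨v₀, hv₀, h₀, by simp⟩
  | insert a s _ ih =>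
    obtain ⟨v, hvP, hv, hs⟩ := ih
    by_cases h : f a v = -v
    · exact ⟨v, hvP, hv, by simpa [h] using hs⟩
    · refine ⟨v + f a v, P.add_mem hvP (hP a v hvP), fun h' => h ?_, ?_⟩
      · exact (neg_eq_of_add_eq_zero_right h').symm
      · intro i hi
        rw [mem_insert] at hi
        rw [map_add, hcomm i a]
        rcases hi with rfl | hi
        · left
          rw [hinv, add_comm]
        · rcases hs i hi with h | h <;> rw [h]
          · exact Or.inl rfl
          · right
            rw [map_neg, neg_add]

theorem dbl_apply_comm (i j k l : ι) (v : V) :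
    ρ (dbl i j) (ρ (dbl k l) v) = ρ (dbl k l) (ρ (dbl i j) v) := by
  rw [apply_apply_of_mul_eq (dbl_mul_comm i j k l), map_mul, Module.End.mul_apply]

theorem dbl_apply_apply_self (i j : ι) (v : V) : ρ (dbl i j) (ρ (dbl i j) v) = v := by
  rw [apply_apply_of_mul_eq (dbl_mul_self i j), map_one, Module.End.one_apply]

/-- A nontrivial action of `dbl a b * dbl c d` is detected by some weight. -/
theorem exists_isWeight_of_ne_one [CharZero F] {a b c d : ι} (h : ρ (dbl a b * dbl c d) ≠ 1) :
    ∃ S : Finset ι, sgn F S a * sgn F S b * (sgn F S c * sgn F S d) = -1 ∧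
      ∃ v ≠ 0, IsWeight ρ S v := by
  classical
  set g := ρ (dbl a b * dbl c d) with hg
  have hgv : ∀ v, g v = ρ (dbl a b) (ρ (dbl c d) v) := fun v => by
    rw [hg, map_mul, Module.End.mul_apply]
  obtain ⟨u, hu⟩ : ∃ u, g u ≠ u := by
    by_contra! h'
    exact h (LinearMap.ext h')
  have hgg : g (g u) = u := by
    rw [hgv, hgv, dbl_apply_comm c d, dbl_apply_apply_self, dbl_apply_apply_self]
  obtain ⟨v, hvP, hv, hs⟩ := exists_common_eigenvector (fun i => ρ (dbl i a))
    (fun i j v => dbl_apply_comm i a j a v) (fun i v => dbl_apply_apply_self i a v)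
    (Module.End.eigenspace g (-1))
    (fun i v hv => by
      rw [Module.End.mem_eigenspace_iff] at hv ⊢
      rw [hgv, dbl_apply_comm c d, dbl_apply_comm a b, ← hgv, hv, map_smul])
    (v₀ := g u - u) (by rw [Module.End.mem_eigenspace_iff, map_sub, hgg]; module)
    (sub_ne_zero.2 hu) univ
  have hneg : v ≠ -v := fun h => by
    have h2 : (2 : F) • v = 0 := by rw [two_smul, eq_neg_iff_add_eq_zero.1 h]
    exact hv ((smul_eq_zero.1 h2).resolve_left two_ne_zero)
  let S : Finset ι := univ.filter fun i => ρ (dbl i a) v = -v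
  have ha : sgn F S a = 1 := by
    simp [sgn, S, dbl_self, hneg]
  have hw : IsWeight ρ S v := isWeight_of_base a fun i => by
    rw [ha, mul_one]
    by_cases hi : ρ (dbl i a) v = -v
    · simp [sgn, S, hi]
    · simp [sgn, S, (hs i (mem_univ i)).resolve_right hi]
  refine ⟨S, ?_, v, hv, hw⟩
  rw [Module.End.mem_eigenspace_iff, hgv, hw, map_smul, hw, smul_smul] at hvP
  rw [mul_comm]
  exact smul_left_injective F hv hvP

section Form

variable [CharZero F] {B : V →ₗ[F] V →ₗ[F] F}

theorem eq_or_eq_compl_of_form_ne_zero (hB : ∀ g v w, B (ρ g v) (ρ g w) = B v w)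
    {S T : Finset ι} {v w : V} (hv : IsWeight ρ S v)
    (hw : IsWeight ρ T w) (h : B v w ≠ 0) : S = T ∨ S = Tᶜ := by
  apply eq_or_eq_compl_of_sgn (F := F)
  intro i j
  have h' := hB (dbl i j) v w
  rw [hv, hw] at h'
  simp only [map_smul, LinearMap.smul_apply, smul_eq_mul] at h'
  have h1 : sgn F S i * sgn F S j * (sgn F T i * sgn F T j) = 1 :=
    mul_right_cancel₀ h (by linear_combination h')
  linear_combination (sgn F T i * sgn F T j) * h1 -
    sgn F S i * sgn F S j * (sgn F T j * sgn F T j * sgn_mul_self (F := F) T i +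
      sgn_mul_self (F := F) T j)

/-- The form is nondegenerate on each weight space. -/
theorem IsWeight.exists_partner (hB : ∀ g v w, B (ρ g v) (ρ g w) = B v w)
    {S : Finset ι} {v : V} (hv : IsWeight ρ S v)
    (hnd : ∃ w, B v w ≠ 0) : ∃ w, IsWeight ρ S w ∧ B v w ≠ 0 := by
  by_cases hne : Nonempty ι
  swap
  · obtain ⟨w, hw⟩ := hnd
    exact ⟨w, fun i => (hne ⟨i⟩).elim, hw⟩
  obtain ⟨c⟩ := hne
  suffices h : ∀ s : Finset ι, ∃ w, (∀ i ∈ s, ρ (dbl i c) w = (sgn F S i * sgn F S c) • w) ∧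
      B v w ≠ 0 by
    obtain ⟨w, hw, hvw⟩ := h univ
    exact ⟨w, isWeight_of_base c fun i => hw i (mem_univ i), hvw⟩
  intro s
  induction s using Finset.induction_on with
  | empty => simpa using hnd
  | insert a s _ ih =>
    obtain ⟨w, hw, hvw⟩ := ih
    have hsq : sgn F S a * sgn F S c * (sgn F S a * sgn F S c) = 1 := by
      linear_combination sgn F S c * sgn F S c * sgn_mul_self (F := F) S a +
        sgn_mul_self (F := F) S c
    refine ⟨w + (sgn F S a * sgn F S c) • ρ (dbl a c) w, fun i hi => ?_, ?_⟩
    · rw [mem_insert] at hi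
      rcases hi with rfl | hi
      · rw [map_add, map_smul, dbl_apply_apply_self, smul_add, smul_smul, hsq, one_smul, add_comm]
      · rw [map_add, map_smul, dbl_apply_comm, hw i hi, map_smul, smul_add, smul_comm]
    · have h : B v (ρ (dbl a c) w) = sgn F S a * sgn F S c * B v w := by
        have h' := hB (dbl a c) v (ρ (dbl a c) w)
        rw [dbl_apply_apply_self, hv, map_smul, LinearMap.smul_apply, smul_eq_mul] at h'
        exact h'.symm
      rw [map_add, map_smul, smul_eq_mul, h, ← mul_assoc, hsq, one_mul, ← two_mul]
      exact mul_ne_zero two_ne_zero hvw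

/-- Each weight contributes at least two dimensions. -/
theorem two_mul_card_le_finrank [FiniteDimensional F V]
    (hB : ∀ g v w, B (ρ g v) (ρ g w) = B v w)
    (halt : ∀ v, B v v = 0) (hnd : ∀ v, v ≠ 0 → ∃ w, B v w ≠ 0)
    (C : Finset (Finset ι))
    (hC : ∀ S ∈ C, ∃ v ≠ 0, IsWeight ρ S v)
    (hcompl : ∀ S ∈ C, ∀ T ∈ C, S ≠ Tᶜ) : 2 * C.card ≤ Module.finrank F V := by
  have hex : ∀ S : C, ∃ v w, IsWeight ρ S.1 v ∧ IsWeight ρ S.1 w ∧ B v w ≠ 0 := fun S => by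
    obtain ⟨v, hv, hvw⟩ := hC S.1 S.2
    obtain ⟨w, hw, h⟩ := hvw.exists_partner hB (hnd v hv)
    exact ⟨v, w, hvw, hw, h⟩
  choose v w hv hw hvw using hex
  have hskew : ∀ x y, B x y = -B y x := fun x y => by
    have h := halt (x + y)
    simp only [map_add, LinearMap.add_apply, halt] at h
    linear_combination h
  have horth : ∀ {S T : C} {x y : V}, IsWeight ρ S.1 x → IsWeight ρ T.1 y → S ≠ T →
      B x y = 0 := fun {S T x y} hx hy hST => by
    by_contra h
    rcases eq_or_eq_compl_of_form_ne_zero hB hx hy h with h | h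
    · exact hST (Subtype.ext h)
    · exact hcompl _ S.2 _ T.2 h
  have hli : LinearIndependent F (Sum.elim v w) := by
    rw [Fintype.linearIndependent_iff]
    intro g hg
    rw [Fintype.sum_sum_type] at hg
    simp only [Sum.elim_inl, Sum.elim_inr] at hg
    rintro (T | T)
    · have h := congrArg (fun x => B x (w T)) hg
      simp only [map_add, map_sum, map_smul, LinearMap.add_apply, LinearMap.sum_apply,
        LinearMap.smul_apply, smul_eq_mul, map_zero, LinearMap.zero_apply] at h
      rw [Finset.sum_eq_single T (fun S _ hST => by rw [horth (hv S) (hw T) hST, mul_zero])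
        (by simp), Finset.sum_eq_zero, add_zero] at h
      · exact (mul_eq_zero.1 h).resolve_right (hvw T)
      · intro S _
        by_cases hST : S = T
        · rw [hST, halt, mul_zero]
        · rw [horth (hw S) (hw T) hST, mul_zero]
    · have h := congrArg (fun x => B (v T) x) hg
      simp only [map_add, map_sum, map_smul, smul_eq_mul, map_zero] at h
      rw [Finset.sum_eq_zero, zero_add, Finset.sum_eq_single T
        (fun S _ hST => by rw [horth (hv T) (hw S) hST.symm, mul_zero]) (by simp)] at h
      · exact (mul_eq_zero.1 h).resolve_right (hvw T)
      · intro S _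
        by_cases hST : S = T
        · rw [hST, halt, mul_zero]
        · rw [horth (hv T) (hv S) (Ne.symm hST), mul_zero]
  have := hli.fintype_card_le_finrank
  simp only [Fintype.card_sum, Fintype.card_coe] at this
  omega

theorem card_le_of_weights [FiniteDimensional F V]
    (hB : ∀ g v w, B (ρ g v) (ρ g w) = B v w)
    (halt : ∀ v, B v v = 0) (hnd : ∀ v, v ≠ 0 → ∃ w, B v w ≠ 0)
    (hdim : Module.finrank F V = 2 * Fintype.card ι)
    (C : Finset (Finset ι))
    (hC : ∀ S ∈ C, ∃ v ≠ 0, IsWeight ρ S v)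
    (hcompl : ∀ S ∈ C, ∀ T ∈ C, S ≠ Tᶜ) : C.card ≤ Fintype.card ι := by
  have := two_mul_card_le_finrank hB halt hnd C hC hcompl
  omega

/-- A weight which takes both values at least twice has too large an orbit. -/
theorem not_isWeight_of_three_le_card [FiniteDimensional F V]
    (hB : ∀ g v w, B (ρ g v) (ρ g w) = B v w)
    (halt : ∀ v, B v v = 0) (hnd : ∀ v, v ≠ 0 → ∃ w, B v w ≠ 0)
    (hdim : Module.finrank F V = 2 * Fintype.card ι)
    {S : Finset ι} (h3 : 3 ≤ S.card)
    (hS : S.card + 2 ≤ Fintype.card ι) : ¬ ∃ v ≠ 0, IsWeight ρ S v := by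
  intro hw
  obtain ⟨a, ha⟩ := Finset.card_pos.1 (by omega : 0 < S.card)
  have hinj : Set.InjOn (insert a) (SetLike.coe (powersetCard (S.card - 1) (univ.erase a))) := by
    intro T hT U hU h
    rw [mem_coe, mem_powersetCard] at hT hU
    have hT' : a ∉ T := fun h => by simpa using hT.1 h
    have hU' : a ∉ U := fun h => by simpa using hU.1 h
    rw [← erase_insert hT', ← erase_insert hU', h]
  have hle := card_le_of_weights hB halt hnd hdim
    ((powersetCard (S.card - 1) (univ.erase a)).image (insert a)) ?_ ?_
  · rw [card_image_of_injOn hinj, card_powersetCard, card_erase_of_mem (mem_univ a),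
      card_univ] at hle
    have := add_two_le_choose (n := Fintype.card ι - 1) (r := S.card - 1) (by omega) (by omega)
    omega
  · intro T hT
    obtain ⟨U, hU, rfl⟩ := mem_image.1 hT
    rw [mem_powersetCard] at hU
    refine exists_isWeight_of_card_eq ?_ hw
    rw [card_insert_of_notMem fun h => by simpa using hU.1 h]
    omega
  · intro T hT U hU h
    obtain ⟨T, -, rfl⟩ := mem_image.1 hT
    obtain ⟨U, -, rfl⟩ := mem_image.1 hU
    have : a ∈ (insert a U)ᶜ := h ▸ mem_insert_self a T
    simp at this

/-- A weight on which `dbl a b * dbl c d` acts as `-1` takes one of its values exactly once. -/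
theorem card_eq_one_or_of_sgn_mul [FiniteDimensional F V]
    (hB : ∀ g v w, B (ρ g v) (ρ g w) = B v w)
    (halt : ∀ v, B v v = 0) (hnd : ∀ v, v ≠ 0 → ∃ w, B v w ≠ 0)
    (hdim : Module.finrank F V = 2 * Fintype.card ι)
    {S : Finset ι} {a b c d : ι}
    (hnodup : [a, b, c, d].Nodup)
    (hsgn : sgn F S a * sgn F S b * (sgn F S c * sgn F S d) = -1)
    (hw : ∃ v ≠ 0, IsWeight ρ S v) : S.card = 1 ∨ S.card + 1 = Fintype.card ι := by
  have hle : ({a, b, c, d} : Finset ι).card = 4 := by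
    simpa using List.toFinset_card_of_nodup hnodup
  set Q : Finset ι := {a, b, c, d} with hQ
  have hprod : ∏ i ∈ Q, sgn F S i = -1 := by
    simp only [List.nodup_cons, List.mem_cons, List.not_mem_nil, or_false, not_or] at hnodup
    rw [hQ, prod_insert (by simpa using hnodup.1), prod_insert (by simpa using hnodup.2.1),
      prod_pair hnodup.2.2.1, ← mul_assoc, hsgn]
  have hodd : Odd (Q ∩ S).card := by
    simp only [sgn, prod_ite, prod_const, one_pow, mul_one, filter_mem_eq_inter] at hprod
    by_contra h
    rw [(Nat.not_odd_iff_even.1 h).neg_one_pow] at hprod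
    norm_num at hprod
  have hsplit : (Q ∩ S).card + (Q \ S).card = 4 := by rw [card_inter_add_card_sdiff, hle]
  have hinter : (Q ∩ S).card ≤ S.card := card_le_card inter_subset_right
  have hsdiff : (Q \ S).card ≤ Sᶜ.card := card_le_card fun i hi => by
    simpa using (mem_sdiff.1 hi).2
  have hadd : S.card + Sᶜ.card = Fintype.card ι := card_add_card_compl S
  by_contra! hcard
  have h4 : Fintype.card ι ≠ 4 := fun h4 => by
    have huniv : Q = univ := (card_eq_iff_eq_univ Q).1 (by rw [hle, h4])
    rw [huniv, univ_inter] at hodd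
    obtain ⟨r, hr⟩ := hodd
    omega
  obtain ⟨r, hr⟩ := hodd
  rcases Nat.lt_or_ge S.card 3 with h3 | h3
  · obtain ⟨v, hv, hvw⟩ := hw
    exact not_isWeight_of_three_le_card hB halt hnd hdim (S := Sᶜ) (by omega) (by omega)
      ⟨v, hv, hvw.compl⟩
  · exact not_isWeight_of_three_le_card hB halt hnd hdim h3 (by omega) hw

/-- If a weight takes one of its values exactly once, all weights do. -/
theorem card_eq_one_or_of_isWeight [FiniteDimensional F V]
    (hB : ∀ g v w, B (ρ g v) (ρ g w) = B v w)
    (halt : ∀ v, B v v = 0) (hnd : ∀ v, v ≠ 0 → ∃ w, B v w ≠ 0)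
    (hdim : Module.finrank F V = 2 * Fintype.card ι)
    (h3 : 3 ≤ Fintype.card ι)
    {S T : Finset ι} (hS : S.card = 1) (hw : ∃ v ≠ 0, IsWeight ρ S v)
    (hT : ∃ v ≠ 0, IsWeight ρ T v) : T.card = 1 ∨ T.card + 1 = Fintype.card ι := by
  by_contra! hcard
  have hne : ∀ i, T ≠ {i} := fun i h => hcard.1 (by rw [h, card_singleton])
  have hadd : ∀ U : Finset ι, U.card + Uᶜ.card = Fintype.card ι := fun U => card_add_card_compl U
  have hle := card_le_of_weights hB halt hnd hdim (insert T (univ.image singleton)) ?_ ?_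
  · rw [card_insert_of_notMem (by simpa using fun i => (hne i).symm),
      card_image_of_injective _ singleton_injective, card_univ] at hle
    omega
  · intro U hU
    rcases mem_insert.1 hU with rfl | hU
    · exact hT
    · obtain ⟨i, -, rfl⟩ := mem_image.1 hU
      exact exists_isWeight_of_card_eq (by rw [hS, card_singleton]) hw
  · have hcompl : ∀ i, T ≠ {i}ᶜ := fun i h => hcard.2 (by
      have := hadd {i}
      rw [← h, card_singleton] at this
      omega)
    intro U hU W hW h
    rcases mem_insert.1 hU with rfl | hU
    · rcases mem_insert.1 hW with rfl | hW
      · obtain ⟨i⟩ : Nonempty ι := Fintype.card_pos_iff.1 (by omega)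
        have := Finset.ext_iff.1 h i
        simp at this
      · obtain ⟨i, -, rfl⟩ := mem_image.1 hW
        exact hcompl i h
    · obtain ⟨i, -, rfl⟩ := mem_image.1 hU
      rcases mem_insert.1 hW with rfl | hW
      · exact hcompl i (by rw [h, compl_compl])
      · obtain ⟨j, -, rfl⟩ := mem_image.1 hW
        have := hadd {j}
        rw [← h, card_singleton, card_singleton] at this
        omega

end Form

/-- If every weight takes one of its values exactly once, `dbl a b` acts as `-1` on the vectors
fixed by all `dbl i j` with `i` and `j` different from `a` and `b`. -/
theorem dbl_apply_eq_neg [CharZero F] {a b c : ι} (hab : a ≠ b) (hca : c ≠ a) (hcb : c ≠ b)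
    (h4 : 4 ≤ Fintype.card ι)
    (hwt : ∀ T : Finset ι, (∃ v ≠ 0, IsWeight ρ T v) → T.card = 1 ∨ T.card + 1 = Fintype.card ι)
    {v : V} (hv : ∀ i, i ≠ a → i ≠ b → ρ (dbl i c) v = v) : ρ (dbl a b) v = -v := by
  set w := v + ρ (dbl a b) v with hw
  have hfix : ∀ i, i ≠ a → i ≠ b → ρ (dbl i c) w = w := fun i hia hib => by
    rw [hw, map_add, dbl_apply_comm, hv i hia hib]
  have hwab : ρ (dbl a b) w = w := by
    rw [hw, map_add, dbl_apply_apply_self, add_comm]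
  have hac : ∀ u, ρ (dbl a c) u = ρ (dbl b c) (ρ (dbl a b) u) := fun u => by
    rw [dbl_apply_comm, apply_apply_of_mul_eq (dbl_mul_dbl a b c)]
  have hplus : w + ρ (dbl b c) w = 0 := by
    by_contra hne
    have := hwt ∅ ⟨_, hne, isWeight_of_base c fun i => ?_⟩
    · rw [card_empty] at this
      omega
    · simp only [sgn, notMem_empty, if_false, mul_one, one_smul]
      by_cases hia : i = a
      · rw [hia, hac, map_add, dbl_apply_comm a b, hwab, map_add, dbl_apply_apply_self, add_comm]
      by_cases hib : i = b
      · rw [hib, map_add, dbl_apply_apply_self, add_comm]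
      · rw [map_add, dbl_apply_comm, hfix i hia hib]
  have hminus : w - ρ (dbl b c) w = 0 := by
    by_contra hne
    have := hwt {a, b} ⟨_, hne, isWeight_of_base c fun i => ?_⟩
    · rw [card_pair hab] at this
      omega
    · have hc : sgn F {a, b} c = 1 := by simp [sgn, hca, hcb]
      rw [hc, mul_one]
      by_cases hia : i = a
      · rw [hia, hac, map_sub, dbl_apply_comm a b, hwab, map_sub, dbl_apply_apply_self]
        simp [sgn]
      by_cases hib : i = b
      · rw [hib, map_sub, dbl_apply_apply_self]
        simp [sgn]
      · rw [map_sub, dbl_apply_comm, hfix i hia hib]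
        simp [sgn, hia, hib]
  have h2 : (2 : F) • w = 0 := by
    rw [two_smul]
    nth_rw 2 [sub_eq_zero.1 hminus]
    exact hplus
  have h0 := (smul_eq_zero.1 h2).resolve_left two_ne_zero
  exact (neg_eq_of_add_eq_zero_right h0).symm

/-- A representation of the even permutations of `ι × Bool` of dimension `2 * card ι` which
preserves a nondegenerate alternating form is not faithful. -/
theorem not_injective_of_form [CharZero F] [FiniteDimensional F V] (h4 : 4 ≤ Fintype.card ι)
    (B : V →ₗ[F] V →ₗ[F] F) (hB : ∀ g v w, B (ρ g v) (ρ g w) = B v w)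
    (halt : ∀ v, B v v = 0) (hnd : ∀ v, v ≠ 0 → ∃ w, B v w ≠ 0)
    (hdim : Module.finrank F V = 2 * Fintype.card ι) : ¬ Function.Injective ρ := by
  intro hinj
  obtain ⟨e⟩ : Nonempty (Fin 4 ↪ ι) := by
    rw [Function.Embedding.nonempty_iff_card_le, Fintype.card_fin]
    exact h4
  obtain ⟨a, b, c, d, hnodup⟩ : ∃ a b c d : ι, [a, b, c, d].Nodup :=
    ⟨e 0, e 1, e 2, e 3, by simp [e.injective.eq_iff]⟩
  have hne := hnodup
  simp only [List.nodup_cons, List.mem_cons, List.not_mem_nil, or_false, not_or] at hne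
  obtain ⟨⟨hab, hac, had⟩, ⟨hbc, hbd⟩, hcd, -⟩ := hne
  have hone : ρ (dbl a b * dbl c d) ≠ 1 := by
    intro h
    have h' := hinj (h.trans (map_one ρ).symm)
    have := congrArg (fun g : alternatingGroup (ι × Bool) => g.1 (a, false)) h'
    change (pairSwap a * pairSwap b * (pairSwap c * pairSwap d)) (a, false) = (a, false) at this
    simp [pairSwap, Perm.mul_apply, swap_apply_def, hab, hac, had] at this
  obtain ⟨S, hsgn, hS⟩ := exists_isWeight_of_ne_one hone
  obtain ⟨U, hU, hUw⟩ : ∃ U : Finset ι, U.card = 1 ∧ ∃ v ≠ 0, IsWeight ρ U v := by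
    rcases card_eq_one_or_of_sgn_mul hB halt hnd hdim hnodup hsgn hS with h | h
    · exact ⟨S, h, hS⟩
    · obtain ⟨v, hv, hw⟩ := hS
      refine ⟨Sᶜ, ?_, v, hv, hw.compl⟩
      rw [card_compl]
      omega
  have hneg : ∀ v, (∀ i, i ≠ a → i ≠ b → ρ (dbl i c) v = v) → ρ (dbl a b) v = -v :=
    fun v => dbl_apply_eq_neg hab (Ne.symm hac) (Ne.symm hbc) h4 fun T hT =>
      card_eq_one_or_of_isWeight hB halt hnd hdim (by omega) hU hUw hT
  obtain ⟨v, hv, hw⟩ := exists_isWeight_of_card_eq (T := {a}) (by rw [hU, card_singleton]) hUw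
  have hrot : ∀ v, (∀ i, i ≠ a → i ≠ b → ρ (dbl i c) v = v) →
      ∀ i, i ≠ a → i ≠ b → ρ (dbl i c) (ρ (rot a b) v) = ρ (rot a b) v := by
    intro v hv i hia hib
    rw [apply_apply_of_mul_eq (rot_mul_dbl hia hib (Ne.symm hac) (Ne.symm hbc)).symm, map_mul,
      Module.End.mul_apply, hv i hia hib]
  have h0 : ∀ i, i ≠ a → i ≠ b → ρ (dbl i c) v = v := fun i hia _ => by
    rw [hw]
    simp [sgn, hia, Ne.symm hac]
  have h1 := hrot v h0
  have h2 := hrot _ h1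
  have key := congrArg (fun g => ρ g v) (rot_conj_prod hab)
  simp only [map_mul, Module.End.mul_apply] at key
  rw [hneg v h0, hneg _ h1, map_neg, map_neg, map_neg, hneg _ h2, neg_neg] at key
  have hz : (2 : F) • ρ (rot a b) (ρ (rot a b) v) = 0 := by
    rw [two_smul]
    nth_rw 1 [← key]
    exact neg_add_cancel _
  exact apply_ne_zero _ (apply_ne_zero _ hv) ((smul_eq_zero.1 hz).resolve_left two_ne_zero)

end AlternatingSymplectic

open AlternatingSymplectic Matrix in
/-- Let `d = 2m ≥ 8` be an even integer.  Then there is no faithful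
symplectic `d`-dimensional representation of the alternating group `A_{d+1}` in
characteristic `0`: for every field `F` of characteristic `0`, there is no injective group
homomorphism from `A_{d+1}` into the symplectic group `Sp_{2m}(F)` of the standard
nondegenerate alternating bilinear form on `F^{2m}`. -/
theorem no_faithful_symplectic_rep_of_alternating
    (m : ℕ) (hm : 4 ≤ m) (F : Type*) [Field F] [CharZero F] :
    ¬ ∃ φ : alternatingGroup (Fin (2 * m + 1)) →* Matrix.symplecticGroup (Fin m) F,
        Function.Injective φ := by
  rintro ⟨φ, hφ⟩
  obtain ⟨e⟩ : Nonempty (Fin m × Bool ↪ Fin (2 * m + 1)) := by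
    rw [Function.Embedding.nonempty_iff_card_le]
    simp only [Fintype.card_prod, Fintype.card_fin, Fintype.card_bool]
    omega
  let f := Equiv.ofInjective e e.injective
  let η : alternatingGroup (Fin m × Bool) →* alternatingGroup (Fin (2 * m + 1)) :=
    ((Perm.extendDomainHom f).comp (alternatingGroup _).subtype).codRestrict _ fun g => by
      have := g.2
      rw [Perm.mem_alternatingGroup] at this ⊢
      simpa [Perm.extendDomainHom] using this
  have hη : Function.Injective η := fun g h hgh => Subtype.ext <|
    Perm.extendDomainHom_injective f (congrArg Subtype.val hgh)
  let M : alternatingGroup (Fin m × Bool) →* Matrix (Fin m ⊕ Fin m) (Fin m ⊕ Fin m) F :=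
    ((symplecticGroup (Fin m) F).subtype.comp φ).comp η
  have hM : Function.Injective M := Subtype.val_injective.comp (hφ.comp hη)
  let ρ : alternatingGroup (Fin m × Bool) →* Module.End F (Fin m ⊕ Fin m → F) :=
    (toLinAlgEquiv' : Matrix (Fin m ⊕ Fin m) (Fin m ⊕ Fin m) F ≃ₐ[F] _).toMonoidHom.comp M
  have hρ : ∀ g v, ρ g v = M g *ᵥ v := fun g v => rfl
  refine not_injective_of_form (ρ := ρ) (by simpa using hm)
    (Matrix.toLinearMap₂' F (J (Fin m) F)) ?_ ?_ ?_ ?_ (toLinAlgEquiv'.injective.comp hM)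
  · intro g v w
    have h := SymplecticGroup.mem_iff'.1 (φ (η g)).2
    change (M g)ᵀ * J (Fin m) F * M g = J (Fin m) F at h
    rw [toLinearMap₂'_apply', toLinearMap₂'_apply', hρ, hρ]
    conv_rhs => rw [← h]
    rw [← vecMul_transpose, ← dotProduct_mulVec]
    simp only [mulVec_mulVec, Matrix.mul_assoc]
  · intro v
    have h : v ⬝ᵥ J (Fin m) F *ᵥ v = -(v ⬝ᵥ J (Fin m) F *ᵥ v) := by
      conv_lhs => rw [dotProduct_mulVec, ← mulVec_transpose, J_transpose, neg_mulVec,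
        neg_dotProduct, dotProduct_comm]
    rw [toLinearMap₂'_apply']
    exact self_eq_neg.1 h
  · intro v hv
    by_contra! h
    apply hv
    refine dotProduct_eq_zero v fun w => ?_
    have := h (-(J (Fin m) F *ᵥ w))
    rwa [toLinearMap₂'_apply', mulVec_neg, mulVec_mulVec, J_squared, neg_mulVec, one_mulVec,
      neg_neg] at this
  · simp
    omega
end

section
/- Let ℓ be a prime, k a finite field of characteristic ℓ, V a finite-dimensional k-vector space, and G a subgroup of Aut_k(V). Assume: (i) G is perfect; (ii) G contains a normal abelian subgroup Z such that Γ := G/Z is a simple non-abelian group; (iii) there exists a positive integer d ≥ dim_k(V) such that for every field F of characteristic ℓ and every positive integer a < d, every group homomorphism Γ → PGL_a(F) is trivial. Then Z is a cyclic central subgroup of G and the G-module V is very simple. -/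
/-- A `G`-module `V` over a field `k`, given by `ρ : G → Aut_k(V)`, is *very simple* if
every `k`-subalgebra `R ⊆ End_k(V)` (containing the identity operator) which is stable
under conjugation by all `ρ(σ)`, `σ ∈ G`, is either `k·Id` or all of `End_k(V)`. -/
def IsVerySimple (k : Type*) (V : Type*) [Field k] [AddCommGroup V] [Module k V]
    {G : Type*} [Group G] (ρ : G →* (Module.End k V)ˣ) : Prop :=
  ∀ R : Subalgebra k (Module.End k V),
    (∀ g : G, ∀ r ∈ R,
      ((ρ g : (Module.End k V)ˣ) : Module.End k V) * r *
        (((ρ g)⁻¹ : (Module.End k V)ˣ) : Module.End k V) ∈ R) →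
    R = ⊥ ∨ R = ⊤

open Module

section ProjectiveBound

variable {G : Type*} [Group G]

/-- A homomorphism out of a perfect group whose values commute is trivial. -/
theorem MonoidHom.eq_one_of_commute_of_perfect {M : Type*} [Monoid M]
    (hperf : commutator G = ⊤) (φ : G →* M) (hφ : ∀ g h, φ g * φ h = φ h * φ g) : φ = 1 := by
  have hker : commutator G ≤ φ.toHomUnits.ker := by
    refine Subgroup.commutator_le.2 fun g _ h _ => ?_
    rw [MonoidHom.mem_ker, map_commutatorElement, commutatorElement_eq_one_iff_mul_comm]
    exact Units.ext (hφ g h)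
  ext g
  have hg : g ∈ φ.toHomUnits.ker := hker (hperf ▸ Subgroup.mem_top g)
  simpa using congrArg Units.val (MonoidHom.mem_ker.1 hg)

/-- Conjugation by units, as a homomorphism to the algebra automorphisms. -/
def unitConj (K A : Type*) [CommSemiring K] [Semiring A] [Algebra K A] : Aˣ →* (A ≃ₐ[K] A) :=
  (MulSemiringAction.toAlgAut (ConjAct Aˣ) K A).comp ConjAct.toConjAct.toMonoidHom

theorem unitConj_apply {K A : Type*} [CommSemiring K] [Semiring A] [Algebra K A] (u : Aˣ) (a : A) :
    unitConj K A u a = u * a * (u⁻¹ : Aˣ) := rfl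

theorem unitConj_eq_one_iff {K A : Type*} [CommSemiring K] [Semiring A] [Algebra K A] (u : Aˣ) :
    unitConj K A u = 1 ↔ ∀ a : A, u * a = a * u := by
  simp only [AlgEquiv.ext_iff, unitConj_apply, AlgEquiv.one_apply, Units.mul_inv_eq_iff_eq_mul]

theorem Matrix.unitConj_surjective (K : Type*) [Field K] (n : ℕ) :
    Function.Surjective (unitConj K (Matrix (Fin n) (Fin n) K)) := by
  intro f
  let e : Matrix (Fin n) (Fin n) K ≃ₐ[K] End K (Fin n → K) := Matrix.toLinAlgEquiv'
  obtain ⟨T, hT⟩ := ((e.symm.trans f).trans e).eq_linearEquivConjAlgEquiv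
  let t : (End K (Fin n → K))ˣ := LinearMap.GeneralLinearGroup.ofLinearEquiv T
  refine ⟨Units.map (e.symm : End K (Fin n → K) →* Matrix (Fin n) (Fin n) K) t, ?_⟩
  ext1 a
  apply e.injective
  have h1 : e (f a) = T.conjAlgEquiv K (e a) := by
    rw [← hT]; simp
  rw [unitConj_apply, h1, map_mul, map_mul]
  simp only [Units.coe_map, ← map_inv]
  have h2 : ∀ x, e ((e.symm : End K (Fin n → K) →* Matrix (Fin n) (Fin n) K) x) = x :=
    fun x => e.apply_symm_apply x
  rw [h2, h2]
  rfl

theorem Matrix.unitConj_ker (K : Type*) [Field K] (n : ℕ) :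
    (unitConj K (Matrix (Fin n) (Fin n) K)).ker = Subgroup.center (GL (Fin n) K) := by
  ext u
  rw [MonoidHom.mem_ker, unitConj_eq_one_iff]
  constructor
  · exact fun h => Subgroup.mem_center_iff.2 fun g => Units.ext (h g).symm
  · intro h a
    obtain ⟨c, hc⟩ := Matrix.GeneralLinearGroup.mem_center_iff_val_mem_range_scalar.1 h
    rw [← hc]
    exact Matrix.scalar_commute c (Commute.all c) a

/-- Every homomorphism from `G` to a projective general linear group of degree `< d` over `K`
which kills `Z` is trivial. -/
def ProjectiveBound (Z : Subgroup G) (K : Type*) [Field K] (d : ℕ) : Prop :=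
  ∀ a : ℕ, 0 < a → a < d → ∀ φ : G →* ProjGL a K, Z ≤ φ.ker → φ = 1

variable {K : Type*} [Field K] {Z : Subgroup G} {d : ℕ}

theorem ProjectiveBound.matrixAut_eq_one (hG : ProjectiveBound Z K d) {n : ℕ} (hn : n < d)
    (α : G →* (Matrix (Fin n) (Fin n) K ≃ₐ[K] Matrix (Fin n) (Fin n) K)) (hα : Z ≤ α.ker) :
    α = 1 := by
  rcases Nat.eq_zero_or_pos n with rfl | hpos
  · ext g a i
    exact i.elim0
  let e : (Matrix (Fin n) (Fin n) K ≃ₐ[K] Matrix (Fin n) (Fin n) K) ≃* ProjGL n K :=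
    (QuotientGroup.quotientKerEquivOfSurjective _ (Matrix.unitConj_surjective K n)).symm.trans
      (QuotientGroup.quotientMulEquivOfEq (Matrix.unitConj_ker K n))
  have h := hG n hpos hn (e.toMonoidHom.comp α) fun z hz => by
    have : α z = 1 := hα hz
    simp [MonoidHom.mem_ker, this]
  ext1 g
  apply e.injective
  simpa using DFunLike.congr_fun h g

theorem ProjectiveBound.algAut_eq_one (hG : ProjectiveBound Z K d) {A : Type*} [Semiring A]
    [Algebra K A] {n : ℕ} (hn : n < d) (e : A ≃ₐ[K] Matrix (Fin n) (Fin n) K)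
    (α : G →* (A ≃ₐ[K] A)) (hα : Z ≤ α.ker) : α = 1 := by
  have h := hG.matrixAut_eq_one hn ((AlgEquiv.autCongr e).toMonoidHom.comp α) fun z hz => by
    have : α z = 1 := hα hz
    simp [MonoidHom.mem_ker, this]
  ext1 g
  apply (AlgEquiv.autCongr e).injective
  rw [MonoidHom.one_apply, map_one]
  exact DFunLike.congr_fun h g

variable {W : Type*} [AddCommGroup W] [Module K W]

theorem ProjectiveBound.rep_eq_one_of_scalar [FiniteDimensional K W] (hG : ProjectiveBound Z K d)
    (hperf : commutator G = ⊤) (ρ : G →* End K W) (hW : finrank K W < d)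
    (hZ : ∀ z ∈ Z, ∀ f : End K W, ρ z * f = f * ρ z) : ρ = 1 := by
  have h := hG.algAut_eq_one hW (algEquivMatrix (finBasis K W))
    ((unitConj K (End K W)).comp ρ.toHomUnits) fun z hz => by
      rw [MonoidHom.mem_ker, MonoidHom.comp_apply, unitConj_eq_one_iff]
      exact hZ z hz
  refine ρ.eq_one_of_commute_of_perfect hperf fun g g' => ?_
  exact (unitConj_eq_one_iff (ρ.toHomUnits g)).1 (DFunLike.congr_fun h g) _

/-- A perfect group acting trivially on a subspace and on the quotient acts trivially. -/
theorem MonoidHom.eq_one_of_unipotent_of_perfect (hperf : commutator G = ⊤) (ρ : G →* End K W)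
    (U : Submodule K W) (hU : ∀ g, ∀ u ∈ U, ρ g u = u) (hQ : ∀ g w, ρ g w - w ∈ U) : ρ = 1 := by
  refine ρ.eq_one_of_commute_of_perfect hperf fun g h => ?_
  ext w
  have h1 := hU g _ (hQ h w)
  have h2 := hU h _ (hQ g w)
  rw [map_sub] at h1 h2
  simp only [Module.End.mul_apply]
  rw [sub_eq_iff_eq_add.1 h1, sub_eq_iff_eq_add.1 h2]
  abel

theorem ProjectiveBound.perm_eq_one (hG : ProjectiveBound Z K d) (hperf : commutator G = ⊤)
    {X : Type*} [Fintype X] (hX : Fintype.card X ≤ d) (σ : G →* Equiv.Perm X)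
    (hσ : Z ≤ σ.ker) : σ = 1 := by
  classical
  rcases isEmpty_or_nonempty X with hX0 | ⟨⟨x₀⟩⟩
  · ext g x
    exact hX0.elim x
  let ρ : G →* End K (X → K) :=
    { toFun := fun g => LinearMap.funLeft K K (σ g⁻¹)
      map_one' := by ext; simp [LinearMap.funLeft_apply]
      map_mul' := fun g h => by ext; simp [LinearMap.funLeft_apply] }
  have hρ : ∀ g f x, ρ g f x = f (σ g⁻¹ x) := fun _ _ _ => rfl
  let U : Submodule K (X → K) := Submodule.span K {1}
  have hU : ∀ g, ∀ u ∈ U, ρ g u = u := by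
    intro g u hu
    obtain ⟨c, rfl⟩ := Submodule.mem_span_singleton.1 hu
    ext x
    simp [hρ]
  have hUdim : finrank K U = 1 :=
    finrank_span_singleton fun h => one_ne_zero (congrFun h x₀)
  have hUle : ∀ g, U ≤ U.comap (ρ g) := fun g u hu => by
    rw [Submodule.mem_comap, hU g u hu]; exact hu
  have hQdim : finrank K ((X → K) ⧸ U) < d := by
    have := U.finrank_quotient_add_finrank
    rw [hUdim, finrank_fintype_fun_eq_card] at this
    lia
  have hquot := hG.rep_eq_one_of_scalar hperf (Representation.quotient ρ U hUle) hQdim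
    fun z hz f => by
      have hz1 : ρ z = 1 := by
        have : σ z⁻¹ = 1 := hσ (Z.inv_mem hz)
        refine LinearMap.ext fun f => funext fun x => ?_
        rw [hρ, this]
        rfl
      have : (Representation.quotient ρ U hUle) z = 1 := by
        ext w
        simp [Representation.quotient, hz1]
      rw [this, one_mul, mul_one]
  have hρ1 : ρ = 1 := by
    refine ρ.eq_one_of_unipotent_of_perfect hperf U hU fun g w => ?_
    have := LinearMap.congr_fun (DFunLike.congr_fun hquot g) (U.mkQ w)
    rw [← Submodule.Quotient.eq]
    exact this
  ext g x
  have := congrFun (LinearMap.congr_fun (DFunLike.congr_fun hρ1 g) (Pi.single x 1)) (σ g x)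
  simp only [hρ, map_inv, Equiv.Perm.inv_def, Equiv.symm_apply_apply, Pi.single_eq_same,
    MonoidHom.one_apply, Module.End.one_apply] at this
  by_contra hne
  rw [Pi.single_eq_of_ne (by simpa using hne)] at this
  exact one_ne_zero this

theorem ProjectiveBound.map_eq_of_sSupIndep [FiniteDimensional K W] (hG : ProjectiveBound Z K d)
    (hperf : commutator G = ⊤) (ρ : G →* End K W) (hW : finrank K W ≤ d)
    {X : Set (Submodule K W)} (hX : sSupIndep X) (hbot : ⊥ ∉ X)
    (hmap : ∀ g, ∀ U ∈ X, U.map (ρ g) ∈ X) (hZ : ∀ z ∈ Z, ∀ U ∈ X, U.map (ρ z) = U)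
    (g : G) {U : Submodule K W} (hU : U ∈ X) : U.map (ρ g) = U := by
  classical
  have : Fintype X := (WellFoundedGT.finite_of_sSupIndep hX).fintype
  have hcard : Fintype.card X ≤ d := by
    refine le_trans ?_ (((sSupIndep_iff X).1 hX).subtype_ne_bot_le_finrank.trans hW)
    exact Fintype.card_le_of_injective (fun U => ⟨U, fun h => hbot (h ▸ U.2)⟩)
      fun U U' h => congrArg Subtype.val h
  let act : G →* Function.End X :=
    { toFun := fun g U => ⟨(U : Submodule K W).map (ρ g), hmap g U U.2⟩
      map_one' := by
        funext U
        exact Subtype.ext ((congrArg (Submodule.map · U.1) (map_one ρ)).trans (Submodule.map_id _))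
      map_mul' := fun g h => by
        funext U
        exact Subtype.ext ((congrArg (Submodule.map · U.1) (map_mul ρ g h)).trans
          (Submodule.map_comp _ _ _)) }
  have h := hG.perm_eq_one hperf hcard act.toHomPerm fun z hz => by
    rw [MonoidHom.mem_ker]
    ext1 U
    exact Subtype.ext (hZ z hz U U.2)
  exact congrArg Subtype.val (Equiv.congr_fun (DFunLike.congr_fun h g) ⟨U, hU⟩)

/-- Commuting operators on a nonzero space over an algebraically closed field have a common
eigenvector. -/
theorem Module.End.exists_common_eigenvector [IsAlgClosed K] [FiniteDimensional K W]
    [Nontrivial W] (S : Set (End K W)) (hS : ∀ s ∈ S, ∀ t ∈ S, s * t = t * s) :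
    ∃ v : W, v ≠ 0 ∧ ∀ s ∈ S, ∃ c : K, s v = c • v := by
  let P : Set (Submodule K W) := {U | U ≠ ⊥ ∧ ∀ s ∈ S, ∀ u ∈ U, s u ∈ U}
  obtain ⟨M, ⟨hM0, hMS⟩, hmin⟩ :=
    (wellFounded_lt (α := Submodule K W)).has_min P ⟨⊤, top_ne_bot, fun _ _ _ _ => trivial⟩
  obtain ⟨v, hv, hv0⟩ := M.ne_bot_iff.1 hM0
  refine ⟨v, hv0, fun s hs => ?_⟩
  have : Nontrivial M := Submodule.nontrivial_iff_ne_bot.2 hM0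
  obtain ⟨c, hc⟩ := Module.End.exists_eigenvalue (s.restrict (hMS s hs))
  obtain ⟨w, hw⟩ := hc.exists_hasEigenvector
  have hsw : s w = c • (w : W) := congrArg Subtype.val hw.apply_eq_smul
  have hmem : M ⊓ s.eigenspace c ∈ P := by
    refine ⟨(Submodule.ne_bot_iff _).2 ⟨w, ⟨w.2, Module.End.mem_eigenspace_iff.2 hsw⟩,
      fun h => hw.2 (Subtype.ext h)⟩, fun t ht u hu => ⟨hMS t ht u hu.1, ?_⟩⟩
    have hu2 := Module.End.mem_eigenspace_iff.1 hu.2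
    rw [SetLike.mem_coe, Module.End.mem_eigenspace_iff, ← Module.End.mul_apply, hS s hs t ht,
      Module.End.mul_apply, hu2, map_smul]
  have heq : M ⊓ s.eigenspace c = M := by
    by_contra hne
    exact hmin _ hmem (lt_of_le_of_ne inf_le_left hne)
  rw [← heq] at hv
  exact ⟨c, Module.End.mem_eigenspace_iff.1 hv.2⟩

/-- The representation `ρ` has no invariant subspaces other than `0` and the whole space. -/
def NoProperInvariant (ρ : G →* End K W) : Prop :=
  ∀ U : Submodule K W, (∀ g, U ≤ U.comap (ρ g)) → U = ⊥ ∨ U = ⊤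

theorem MonoidHom.apply_inv_mul_cancel (ρ : G →* End K W) (g : G) : ρ g⁻¹ * ρ g = 1 := by
  rw [← map_mul, inv_mul_cancel, map_one]

theorem MonoidHom.apply_mul_inv_cancel (ρ : G →* End K W) (g : G) : ρ g * ρ g⁻¹ = 1 := by
  rw [← map_mul, mul_inv_cancel, map_one]

section Weights

variable (ρ : G →* End K W) (S : Set (End K W))

/-- The common eigenspace of the operators in `S` with eigenvalues given by `χ`. -/
def weightSubmodule (χ : End K W → K) : Submodule K W := ⨅ s : S, (s : End K W).eigenspace (χ s)

variable {S}

theorem mem_weightSubmodule {χ : End K W → K} {w : W} :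
    w ∈ weightSubmodule S χ ↔ ∀ s ∈ S, s w = χ s • w := by
  simp [weightSubmodule, Submodule.mem_iInf]

theorem sSupIndep_weightSubmodule (hS : ∀ s ∈ S, ∀ t ∈ S, s * t = t * s) :
    sSupIndep {U : Submodule K W | U ≠ ⊥ ∧ ∃ χ, U = weightSubmodule S χ} := by
  have hind := Module.End.independent_iInf_maxGenEigenspace_of_forall_mapsTo
    (fun s : S => (s : End K W))
    fun i j φ => Module.End.mapsTo_maxGenEigenspace_of_comm (hS j j.2 i i.2) φ
  have hind' : iSupIndep fun χ : S → K => ⨅ s : S, (s : End K W).eigenspace (χ s) :=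
    hind.mono fun χ => iInf_mono fun s => Module.End.genEigenspace_le_maximal _ _ _
  refine hind'.sSupIndep_range.mono ?_
  rintro U ⟨-, χ, rfl⟩
  exact ⟨fun s => χ s, rfl⟩

theorem map_weightSubmodule (hS : ∀ g, ∀ s ∈ S, ρ g * s * ρ g⁻¹ ∈ S) (g : G) (χ : End K W → K) :
    (weightSubmodule S χ).map (ρ g) = weightSubmodule S fun s => χ (ρ g⁻¹ * s * ρ g) := by
  have hS' : ∀ s ∈ S, ρ g⁻¹ * s * ρ g ∈ S := fun s hs => by simpa using hS g⁻¹ s hs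
  have h1 := ρ.apply_inv_mul_cancel g
  have h2 := ρ.apply_mul_inv_cancel g
  apply le_antisymm
  · rintro _ ⟨v, hv, rfl⟩
    rw [mem_weightSubmodule]
    intro s hs
    have hsv := mem_weightSubmodule.1 hv _ (hS' s hs)
    rw [← map_smul, ← hsv, ← Module.End.mul_apply, ← Module.End.mul_apply, ← mul_assoc, ← mul_assoc,
      h2, one_mul]
  · intro w hw
    refine ⟨ρ g⁻¹ w, mem_weightSubmodule.2 fun s hs => ?_, ?_⟩
    · have hsw := mem_weightSubmodule.1 hw _ (hS g s hs)
      have hs' : ρ g⁻¹ * (ρ g * s * ρ g⁻¹) * ρ g = s := by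
        rw [← mul_assoc, ← mul_assoc, h1, one_mul, mul_assoc, h1, mul_one]
      rw [hs'] at hsw
      rw [← map_smul, ← hsw, ← Module.End.mul_apply, ← Module.End.mul_apply, ← mul_assoc,
        ← mul_assoc, h1, one_mul]
    · rw [← Module.End.mul_apply, h2, Module.End.one_apply]

end Weights

/-- A commuting set of operators normalized by an irreducible representation of small dimension,
and centralized by `Z`, consists of scalars. -/
theorem ProjectiveBound.exists_eq_algebraMap [IsAlgClosed K] [FiniteDimensional K W]
    (hG : ProjectiveBound Z K d) (hperf : commutator G = ⊤) (ρ : G →* End K W)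
    (hW : finrank K W ≤ d) (hρ : NoProperInvariant ρ) (S : Set (End K W))
    (hcomm : ∀ s ∈ S, ∀ t ∈ S, s * t = t * s) (hS : ∀ g, ∀ s ∈ S, ρ g * s * ρ g⁻¹ ∈ S)
    (hZ : ∀ z ∈ Z, ∀ s ∈ S, ρ z * s = s * ρ z) {s : End K W} (hs : s ∈ S) :
    ∃ c : K, s = algebraMap K (End K W) c := by
  classical
  rcases subsingleton_or_nontrivial W with hW0 | hW0
  · exact ⟨0, Subsingleton.elim _ _⟩
  obtain ⟨v, hv0, hv⟩ := Module.End.exists_common_eigenvector S hcomm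
  let χ : End K W → K := fun t => if h : t ∈ S then (hv t h).choose else 0
  have hvχ : v ∈ weightSubmodule S χ := mem_weightSubmodule.2 fun t ht => by
    simpa only [χ, dif_pos ht] using (hv t ht).choose_spec
  have hne : weightSubmodule S χ ≠ ⊥ := (Submodule.ne_bot_iff _).2 ⟨v, hvχ, hv0⟩
  have hinv : ∀ g, (weightSubmodule S χ).map (ρ g) = weightSubmodule S χ := by
    intro g
    refine hG.map_eq_of_sSupIndep hperf ρ hW (sSupIndep_weightSubmodule hcomm)
      (fun h => h.1 rfl) ?_ ?_ g ⟨hne, χ, rfl⟩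
    · rintro g _ ⟨hU, ψ, rfl⟩
      refine ⟨?_, _, map_weightSubmodule ρ hS g ψ⟩
      intro hmap
      refine hU (eq_bot_iff.2 fun u hu => ?_)
      have h0 : ρ g u ∈ (⊥ : Submodule K W) := hmap ▸ Submodule.mem_map_of_mem hu
      have := congrArg (ρ g⁻¹) ((Submodule.mem_bot K).1 h0)
      rwa [← Module.End.mul_apply, ρ.apply_inv_mul_cancel, map_zero] at this
    · rintro z hz _ ⟨-, ψ, rfl⟩
      rw [map_weightSubmodule ρ hS]
      ext w
      simp only [mem_weightSubmodule]
      refine forall₂_congr fun t ht => ?_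
      rw [mul_assoc, ← hZ z hz t ht, ← mul_assoc, ρ.apply_inv_mul_cancel, one_mul]
  have htop := (hρ _ fun g => Submodule.map_le_iff_le_comap.1 (hinv g).le).resolve_left hne
  refine ⟨χ s, LinearMap.ext fun w => ?_⟩
  rw [Module.algebraMap_end_apply]
  exact mem_weightSubmodule.1 (htop ▸ Submodule.mem_top : w ∈ weightSubmodule S χ) s hs

theorem ProjectiveBound.normal_abelian_scalar [IsAlgClosed K] [FiniteDimensional K W] [Z.Normal]
    (hG : ProjectiveBound Z K d) (hperf : commutator G = ⊤)
    (hZab : ∀ x ∈ Z, ∀ y ∈ Z, x * y = y * x) (ρ : G →* End K W) (hW : finrank K W ≤ d)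
    (hρ : NoProperInvariant ρ) (z : G) (hz : z ∈ Z) (f : End K W) : ρ z * f = f * ρ z := by
  have hab : ∀ x ∈ Z, ∀ t ∈ ρ '' Z, ρ x * t = t * ρ x := by
    rintro x hx _ ⟨y, hy, rfl⟩
    rw [← map_mul, hZab x hx y hy, map_mul]
  obtain ⟨c, hc⟩ := hG.exists_eq_algebraMap hperf ρ hW hρ (ρ '' Z)
    (by rintro _ ⟨x, hx, rfl⟩ t ht; exact hab x hx t ht)
    (by
      rintro g _ ⟨x, hx, rfl⟩
      exact ⟨g * x * g⁻¹, ‹Z.Normal›.conj_mem x hx g, by simp⟩)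
    hab ⟨z, hz, rfl⟩
  rw [hc]
  exact Algebra.commutes c f

/-- A representation of dimension at most `d` is either trivial or irreducible of dimension
exactly `d`. -/
theorem ProjectiveBound.eq_one_or_noProperInvariant [IsAlgClosed K] [Z.Normal]
    (hG : ProjectiveBound Z K d) (hperf : commutator G = ⊤)
    (hZab : ∀ x ∈ Z, ∀ y ∈ Z, x * y = y * x) :
    ∀ (n : ℕ) {W : Type*} [AddCommGroup W] [Module K W] [FiniteDimensional K W]
      (ρ : G →* End K W), finrank K W = n → n ≤ d → ρ = 1 ∨ NoProperInvariant ρ ∧ n = d := by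
  intro n
  induction n using Nat.strong_induction_on with
  | _ n ih =>
  intro W _ _ _ ρ hn hnd
  by_cases hρ : NoProperInvariant ρ
  · rcases hnd.eq_or_lt with h | h
    · exact Or.inr ⟨hρ, h⟩
    · exact Or.inl (hG.rep_eq_one_of_scalar hperf ρ (hn ▸ h)
        (hG.normal_abelian_scalar hperf hZab ρ (hn ▸ hnd) hρ))
  left
  simp only [NoProperInvariant, not_forall, not_or] at hρ
  obtain ⟨U, hU, hbot, htop⟩ := hρ
  have hadd := U.finrank_quotient_add_finrank
  have hUlt : finrank K U < n := hn ▸ Submodule.finrank_lt htop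
  have hUpos : 0 < finrank K U := Submodule.one_le_finrank_iff.2 hbot
  have hsub := (ih _ hUlt (Representation.subrepresentation ρ U hU) rfl (by lia)).resolve_right
    fun h => by lia
  have hquot := (ih _ (by lia) (Representation.quotient ρ U hU) rfl (by lia)).resolve_right
    fun h => by lia
  refine ρ.eq_one_of_unipotent_of_perfect hperf U (fun g u hu => ?_) fun g w => ?_
  · exact congrArg Subtype.val (LinearMap.congr_fun (DFunLike.congr_fun hsub g) ⟨u, hu⟩)
  · rw [← Submodule.Quotient.eq]
    exact LinearMap.congr_fun (DFunLike.congr_fun hquot g) (U.mkQ w)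

section Conjugation

variable (ρ : G →* End K W) (R : Subalgebra K (End K W))

/-- The action by conjugation on a subalgebra normalized by a representation. -/
def conjAut (hR : ∀ g, ∀ r ∈ R, ρ g * r * ρ g⁻¹ ∈ R) : G →* (R ≃ₐ[K] R) :=
  let c : G →* (End K W ≃ₐ[K] End K W) := (unitConj K (End K W)).comp ρ.toHomUnits
  let β : G → (R →ₐ[K] R) := fun g =>
    ((c g : End K W →ₐ[K] End K W).comp R.val).codRestrict R fun r => hR g r r.2
  have hβ : ∀ g h, (β g).comp (β h) = β (g * h) := fun g h =>
    AlgHom.ext fun r => Subtype.ext (DFunLike.congr_fun (map_mul c g h) (r : End K W)).symm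
  have hβ1 : β 1 = AlgHom.id K R :=
    AlgHom.ext fun r => Subtype.ext (DFunLike.congr_fun (map_one c) (r : End K W))
  { toFun := fun g => AlgEquiv.ofAlgHom (β g) (β g⁻¹)
      (by rw [hβ, mul_inv_cancel, hβ1]) (by rw [hβ, inv_mul_cancel, hβ1])
    map_one' := AlgEquiv.ext fun r => DFunLike.congr_fun hβ1 r
    map_mul' := fun g h => AlgEquiv.ext fun r => (DFunLike.congr_fun (hβ g h) r).symm }

variable {ρ R}

theorem coe_conjAut_apply (hR : ∀ g, ∀ r ∈ R, ρ g * r * ρ g⁻¹ ∈ R) (g : G) (r : R) :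
    (conjAut ρ R hR g r : End K W) = ρ g * r * ρ g⁻¹ := rfl

/-- A subalgebra normalized by an irreducible representation is semisimple. -/
theorem NoProperInvariant.isSemisimpleRing [FiniteDimensional K W] [Nontrivial W]
    (hρ : NoProperInvariant ρ) (hR : ∀ g, ∀ r ∈ R, ρ g * r * ρ g⁻¹ ∈ R) : IsSemisimpleRing R := by
  have : IsArtinianRing R := IsArtinianRing.of_finite K R
  have : Module.Finite R W := Module.Finite.of_restrictScalars_finite K R W
  rw [IsArtinianRing.isSemisimpleRing_iff_jacobson]
  let N : Submodule R W := Ring.jacobson R • (⊤ : Submodule R W)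
  have hinv : ∀ g, N.restrictScalars K ≤ (N.restrictScalars K).comap (ρ g) := by
    intro g w hw
    rw [Submodule.restrictScalars_mem] at hw
    rw [Submodule.mem_comap, Submodule.restrictScalars_mem]
    induction hw using Submodule.smul_induction_on' with
    | smul j hj w _ =>
      have hj' : conjAut ρ R hR g j ∈ Ring.jacobson R := by
        have : RingHomSurjective (conjAut ρ R hR g : R →+* R) := ⟨(conjAut ρ R hR g).surjective⟩
        exact Ring.le_comap_jacobson (conjAut ρ R hR g : R →+* R) hj
      have heq : ρ g (j • w) = conjAut ρ R hR g j • ρ g w := by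
        change (ρ g * (j : End K W)) w = ((conjAut ρ R hR g j : End K W) * ρ g) w
        rw [coe_conjAut_apply, mul_assoc _ (ρ g⁻¹), ρ.apply_inv_mul_cancel, mul_one]
      rw [heq]
      exact Submodule.smul_mem_smul hj' trivial
    | add x _ y _ hx hy =>
      rw [map_add]
      exact N.add_mem hx hy
  have hlt : N < ⊤ := Submodule.jacobson_smul_lt_top _
  have hN : N.restrictScalars K = ⊥ := (hρ _ hinv).resolve_right fun h =>
    hlt.ne ((Submodule.restrictScalars_eq_top_iff K R W).1 h)
  refine eq_bot_iff.2 fun j hj => ?_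
  rw [Ideal.mem_bot]
  refine Subtype.ext (LinearMap.ext fun w => ?_)
  have hjw : j • w ∈ N := Submodule.smul_mem_smul hj trivial
  rw [← Submodule.restrictScalars_mem K, hN, Submodule.mem_bot] at hjw
  exact hjw

end Conjugation

/-- A semisimple algebra over an algebraically closed field whose center consists of scalars is
a matrix algebra. -/
theorem IsSemisimpleRing.exists_algEquiv_matrix_of_center [IsAlgClosed K] {A : Type*} [Ring A]
    [Nontrivial A] [Algebra K A] [FiniteDimensional K A] [IsSemisimpleRing A]
    (hA : ∀ a : A, (∀ b, a * b = b * a) → ∃ c : K, a = algebraMap K A c) :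
    ∃ n : ℕ, Nonempty (A ≃ₐ[K] Matrix (Fin n) (Fin n) K) := by
  obtain ⟨s, m, hm, ⟨e⟩⟩ := IsSemisimpleRing.exists_algEquiv_pi_matrix_of_isAlgClosed K A
  have hsub : ∀ i j : Fin s, i = j := by
    intro i j
    by_contra hij
    obtain ⟨c, hc⟩ := hA (e.symm (Pi.single i 1)) fun b => e.injective <| by
      rw [map_mul, map_mul, e.apply_symm_apply]
      ext1 l
      rcases eq_or_ne l i with rfl | hl
      · simp
      · simp [Pi.single_eq_of_ne hl]
    rw [e.symm_apply_eq, e.commutes] at hc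
    have hi := congrFun hc i
    have hj := congrFun hc j
    rw [Pi.single_eq_same, Pi.algebraMap_apply] at hi
    rw [Pi.single_eq_of_ne (Ne.symm hij), Pi.algebraMap_apply, eq_comm,
      map_eq_zero_iff _ (algebraMap K _).injective] at hj
    rw [hj, map_zero] at hi
    exact one_ne_zero hi
  have hne : Nonempty (Fin s) := by
    by_contra h
    rw [not_nonempty_iff] at h
    exact not_subsingleton A e.toEquiv.subsingleton
  obtain ⟨i⟩ := hne
  refine ⟨m i, ⟨e.trans (AlgEquiv.ofBijective (Pi.evalAlgHom K _ i) ⟨fun x y h => ?_,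
    Function.surjective_eval i⟩)⟩⟩
  ext1 j
  obtain rfl := hsub i j
  exact h

/-- Subalgebras normalized by a nontrivial representation of dimension at most `d` over an
algebraically closed field are trivial. -/
theorem ProjectiveBound.subalgebra_eq_bot_or_eq_top [IsAlgClosed K] [FiniteDimensional K W]
    [Z.Normal] (hG : ProjectiveBound Z K d) (hperf : commutator G = ⊤)
    (hZab : ∀ x ∈ Z, ∀ y ∈ Z, x * y = y * x) (ρ : G →* End K W) (hρ1 : ρ ≠ 1)
    (hW : finrank K W ≤ d) (R : Subalgebra K (End K W))
    (hR : ∀ g, ∀ r ∈ R, ρ g * r * ρ g⁻¹ ∈ R) : R = ⊥ ∨ R = ⊤ := by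
  have hW0 : Nontrivial W := by
    by_contra h
    rw [not_nontrivial_iff_subsingleton] at h
    exact hρ1 (MonoidHom.ext fun g => Subsingleton.elim _ _)
  have hρ : NoProperInvariant ρ :=
    ((hG.eq_one_or_noProperInvariant hperf hZab _ ρ rfl hW).resolve_left hρ1).1
  have hZ := hG.normal_abelian_scalar hperf hZab ρ hW hρ
  have := hρ.isSemisimpleRing hR
  obtain ⟨n, ⟨e⟩⟩ := IsSemisimpleRing.exists_algEquiv_matrix_of_center (K := K) (A := R)
    fun a ha => by
      obtain ⟨c, hc⟩ := hG.exists_eq_algebraMap hperf ρ hW hρ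
        {s | ∃ a : R, (∀ b, a * b = b * a) ∧ s = a}
        (by
          rintro _ ⟨a, ha, rfl⟩ _ ⟨b, -, rfl⟩
          exact congrArg Subtype.val (ha b))
        (by
          rintro g _ ⟨a, ha, rfl⟩
          refine ⟨conjAut ρ R hR g a, fun b => ?_, rfl⟩
          obtain ⟨b, rfl⟩ := (conjAut ρ R hR g).surjective b
          rw [← map_mul, ha, map_mul])
        (fun z hz s _ => hZ z hz s) ⟨a, ha, rfl⟩
      exact ⟨c, Subtype.ext hc⟩
  rcases lt_or_ge n (finrank K W) with hn | hn
  · left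
    have hα := hG.algAut_eq_one (hn.trans_le hW) e (conjAut ρ R hR) fun z hz => by
      ext1 r
      refine Subtype.ext ?_
      rw [coe_conjAut_apply, hZ z hz, mul_assoc, ρ.apply_mul_inv_cancel, mul_one]
      rfl
    refine eq_bot_iff.2 fun r hr => ?_
    have hfix : ∀ g, ρ g * r * ρ g⁻¹ = r := fun g =>
      congrArg Subtype.val (DFunLike.congr_fun (DFunLike.congr_fun hα g) (⟨r, hr⟩ : R))
    obtain ⟨c, hc⟩ := hG.exists_eq_algebraMap hperf ρ hW hρ {r}
      (by rintro _ rfl _ rfl; rfl) (by rintro g _ rfl; exact hfix g)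
      (fun z hz s _ => hZ z hz s) rfl
    exact Algebra.mem_bot.2 ⟨c, hc.symm⟩
  · right
    have hdim : finrank K R = n * n := by
      rw [e.toLinearEquiv.finrank_eq, Module.finrank_matrix]
      simp
    rw [← Algebra.toSubmodule_eq_top]
    refine Submodule.eq_top_of_finrank_eq (le_antisymm (Submodule.finrank_le _) ?_)
    rw [Module.finrank_linearMap]
    exact (Nat.mul_le_mul hn hn).trans hdim.ge

end ProjectiveBound

section ScalarExtension

variable {k K : Type*} [Field k] [Field K] {V : Type*} [AddCommGroup V] [Module k V]
  [FiniteDimensional k V]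

/-- Extension of scalars on endomorphisms along `i : k →+* K`, in coordinates. -/
noncomputable def endScalarExtension (i : k →+* K) :
    End k V →+* End K (Fin (finrank k V) → K) :=
  ((Matrix.toLinAlgEquiv' : Matrix _ _ K ≃ₐ[K] End K (Fin (finrank k V) → K)) :
      Matrix _ _ K →+* End K (Fin (finrank k V) → K)).comp
    (i.mapMatrix.comp (algEquivMatrix (finBasis k V) :
      End k V →+* Matrix (Fin (finrank k V)) (Fin (finrank k V)) k))

theorem endScalarExtension_apply (i : k →+* K) (f : End k V) :
    endScalarExtension i f = Matrix.toLinAlgEquiv' ((algEquivMatrix (finBasis k V) f).map i) := rfl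

theorem endScalarExtension_injective (i : k →+* K) :
    Function.Injective (endScalarExtension (V := V) i) := by
  intro f g h
  simp only [endScalarExtension_apply] at h
  exact (algEquivMatrix (finBasis k V)).injective
    (Matrix.map_injective i.injective (Matrix.toLinAlgEquiv'.injective h))

theorem endScalarExtension_smul (i : k →+* K) (c : k) (f : End k V) :
    endScalarExtension i (c • f) = i c • endScalarExtension i f := by
  simp only [endScalarExtension_apply]
  rw [← map_smul, map_smul]
  congr 1
  ext a b
  simp

theorem exists_eq_algebraMap_of_endScalarExtension (i : k →+* K) {f : End k V} {c : K}
    (hf : endScalarExtension i f = algebraMap K _ c) : ∃ c' : k, f = algebraMap k (End k V) c' := by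
  rcases isEmpty_or_nonempty (Fin (finrank k V)) with h0 | ⟨⟨a⟩⟩
  · exact ⟨0, endScalarExtension_injective i (Subsingleton.elim _ _)⟩
  set M := algEquivMatrix (finBasis k V) f with hM
  have hMc : M.map i = algebraMap K (Matrix _ _ K) c := by
    apply Matrix.toLinAlgEquiv'.injective
    rw [← endScalarExtension_apply, hf, AlgEquiv.commutes]
  refine ⟨M a a, (algEquivMatrix (finBasis k V)).injective ?_⟩
  rw [AlgEquiv.commutes, ← hM]
  apply Matrix.map_injective i.injective
  have ha : i (M a a) = c := by
    simpa [Matrix.algebraMap_matrix_apply] using congrFun (congrFun hMc a) a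
  simp only [hMc]
  ext b b'
  simp only [Matrix.map_apply, Matrix.algebraMap_matrix_apply, Algebra.algebraMap_self,
    RingHom.id_apply]
  split_ifs <;> simp [ha]

/-- Subalgebra version of extension of scalars. -/
noncomputable def Subalgebra.extendEndScalars (i : k →+* K) (R : Subalgebra k (End k V)) :
    Subalgebra K (End K (Fin (finrank k V) → K)) :=
  Algebra.adjoin K (R.toSubring.map (endScalarExtension i) : Set _)

theorem Subalgebra.toSubmodule_extendEndScalars (i : k →+* K) (R : Subalgebra k (End k V)) :
    Subalgebra.toSubmodule (R.extendEndScalars i) =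
      Submodule.span K (endScalarExtension i '' R) := by
  have h := Algebra.adjoin_eq_span (R := K)
    (R.toSubring.map (endScalarExtension i) : Set (End K (Fin (finrank k V) → K)))
  rwa [← Subring.coe_toSubmonoid, Submonoid.closure_eq] at h

theorem Subalgebra.eq_bot_of_extendEndScalars (i : k →+* K) {R : Subalgebra k (End k V)}
    (hR : R.extendEndScalars i = ⊥) : R = ⊥ := by
  refine eq_bot_iff.2 fun r hr => ?_
  have h : endScalarExtension i r ∈ R.extendEndScalars i :=
    Algebra.subset_adjoin ⟨r, hr, rfl⟩
  rw [hR] at h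
  obtain ⟨c, hc⟩ := Algebra.mem_bot.1 h
  obtain ⟨c', hc'⟩ := exists_eq_algebraMap_of_endScalarExtension i hc.symm
  exact Algebra.mem_bot.2 ⟨c', hc'.symm⟩

theorem Subalgebra.eq_top_of_extendEndScalars (i : k →+* K) {R : Subalgebra k (End k V)}
    (hR : R.extendEndScalars i = ⊤) : R = ⊤ := by
  let b := finBasis k R
  let v : Fin (finrank k R) → End K (Fin (finrank k V) → K) :=
    fun j => endScalarExtension i (b j)
  have hspan : Submodule.span K (Set.range v) = ⊤ := by
    rw [eq_top_iff, ← Algebra.top_toSubmodule, ← hR, R.toSubmodule_extendEndScalars,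
      Submodule.span_le]
    rintro _ ⟨r, hr, rfl⟩
    have hrep : r = ∑ j, b.repr ⟨r, hr⟩ j • (b j : End k V) := by
      have := congrArg R.val (b.sum_repr ⟨r, hr⟩)
      rw [map_sum] at this
      exact this.symm
    rw [SetLike.mem_coe, hrep, map_sum]
    refine Submodule.sum_mem _ fun j _ => ?_
    rw [endScalarExtension_smul]
    exact Submodule.smul_mem _ _ (Submodule.subset_span ⟨j, rfl⟩)
  have hle := finrank_range_le_card (R := K) v
  rw [Set.finrank, hspan, finrank_top, finrank_linearMap, finrank_fin_fun, Fintype.card_fin] at hle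
  rw [← Algebra.toSubmodule_eq_top]
  refine Submodule.eq_top_of_finrank_eq (le_antisymm (Submodule.finrank_le _) ?_)
  rw [finrank_linearMap]
  exact hle

end ScalarExtension

/-- A non-commutative very simple linear group has only scalar normal abelian subgroups. -/
theorem IsVerySimple.exists_eq_algebraMap {k V : Type*} [Field k] [AddCommGroup V] [Module k V]
    {G : Subgroup (End k V)ˣ} (hV : IsVerySimple k V G.subtype)
    (hnc : ∃ a b : G, a * b ≠ b * a) (Z : Subgroup G) [Z.Normal]
    (hZab : ∀ x ∈ Z, ∀ y ∈ Z, x * y = y * x) (z : G) (hz : z ∈ Z) :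
    ∃ c : k, ((z : (End k V)ˣ) : End k V) = algebraMap k (End k V) c := by
  let S : Set (End k V) := (fun z : G => ((z : (End k V)ˣ) : End k V)) '' Z
  have hS : ∀ s ∈ S, ∀ t ∈ S, s * t = t * s := by
    rintro _ ⟨x, hx, rfl⟩ _ ⟨y, hy, rfl⟩
    exact congrArg (fun g : G => ((g : (End k V)ˣ) : End k V)) (hZab x hx y hy)
  have hconj : ∀ g : G, ∀ r ∈ Algebra.adjoin k S,
      unitConj k (End k V) (g : (End k V)ˣ) r ∈ Algebra.adjoin k S := by
    intro g r hr
    induction hr using Algebra.adjoin_induction with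
    | mem s hs =>
      obtain ⟨x, hx, rfl⟩ := hs
      exact Algebra.subset_adjoin ⟨g * x * g⁻¹, ‹Z.Normal›.conj_mem x hx g, rfl⟩
    | algebraMap c =>
      rw [AlgEquiv.commutes]
      exact Subalgebra.algebraMap_mem _ c
    | add x y _ _ hx hy => rw [map_add]; exact add_mem hx hy
    | mul x y _ _ hx hy => rw [map_mul]; exact mul_mem hx hy
  have hzS : ((z : (End k V)ˣ) : End k V) ∈ Algebra.adjoin k S :=
    Algebra.subset_adjoin ⟨z, hz, rfl⟩
  rcases hV (Algebra.adjoin k S) hconj with h | h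
  · rw [h] at hzS
    obtain ⟨c, hc⟩ := Algebra.mem_bot.1 hzS
    exact ⟨c, hc.symm⟩
  · obtain ⟨a, b, hab⟩ := hnc
    refine absurd (Subtype.ext (Units.ext ?_)) hab
    have hcomm := Algebra.adjoin_le_centralizer_centralizer k S
    have hS' : Algebra.adjoin k S ≤ Subalgebra.centralizer k S :=
      Algebra.adjoin_le fun s hs => (Subalgebra.mem_centralizer_iff k).2 fun t ht => hS t ht s hs
    have hall : ∀ x y : End k V, x * y = y * x := by
      intro x y
      have hx : x ∈ Subalgebra.centralizer k (Subalgebra.centralizer k S : Set (End k V)) :=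
        hcomm (h ▸ Algebra.mem_top)
      have hy : y ∈ Subalgebra.centralizer k S := hS' (h ▸ Algebra.mem_top)
      exact ((Subalgebra.mem_centralizer_iff k).1 hx y hy).symm
    exact hall _ _

/-- Let `ℓ` be a prime, `k` a finite field of characteristic `ℓ`, `V` a
finite-dimensional `k`-vector space, and `G` a subgroup of `Aut_k(V)`.  Assume: (i) `G` is
perfect; (ii) `G` contains a normal abelian subgroup `Z` such that `Γ := G/Z` is a simple
non-abelian group; (iii) there is `d ≥ dim_k V`, `d ≥ 1`, such that for every field `F` of
characteristic `ℓ` and every positive integer `a < d` every homomorphism `Γ → PGL_a(F)` is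
trivial.  Then `Z` is a cyclic central subgroup of `G` and the `G`-module `V` is very
simple. -/
theorem very_simple_of_projective_bound
    (ℓ : ℕ) [Fact ℓ.Prime] (k : Type*) [Field k] [Finite k] [CharP k ℓ]
    (V : Type*) [AddCommGroup V] [Module k V] [FiniteDimensional k V]
    (G : Subgroup (Module.End k V)ˣ)
    (hperf : commutator G = ⊤)
    (Z : Subgroup G) [Z.Normal] (hZab : ∀ x ∈ Z, ∀ y ∈ Z, x * y = y * x)
    [IsSimpleGroup (G ⧸ Z)] (hnab : ∃ a b : G ⧸ Z, a * b ≠ b * a)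
    (d : ℕ) (hd0 : 0 < d) (hdim : Module.finrank k V ≤ d)
    (hproj : ∀ (F : Type) [Field F] [CharP F ℓ] (a : ℕ), 0 < a → a < d →
      ∀ φ : G ⧸ Z →* ProjGL a F, φ = 1) :
    IsCyclic Z ∧ Z ≤ Subgroup.center G ∧ IsVerySimple k V G.subtype := by
  obtain ⟨a, b, hab⟩ := hnab
  induction a using QuotientGroup.induction_on with | _ a =>
  induction b using QuotientGroup.induction_on with | _ b =>
  have hab' : a * b ≠ b * a := fun h => hab <| by
    rw [← QuotientGroup.mk_mul, h, QuotientGroup.mk_mul]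
  let K := AlgebraicClosure (ZMod ℓ)
  let _ : Algebra (ZMod ℓ) k := ZMod.algebra k ℓ
  have : CharP K ℓ := charP_of_injective_algebraMap (algebraMap (ZMod ℓ) K).injective ℓ
  let i : k →+* K := (IsAlgClosed.lift : k →ₐ[ZMod ℓ] K)
  have hG : ProjectiveBound Z K d := fun n hn hnd φ hφ => by
    have h := hproj K n hn hnd (QuotientGroup.lift Z φ hφ)
    ext1 g
    exact DFunLike.congr_fun h (g : G ⧸ Z)
  let ρ : G →* End K (Fin (finrank k V) → K) :=
    (endScalarExtension (V := V) i).toMonoidHom.comp ((Units.coeHom _).comp G.subtype)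
  have hρ1 : ρ ≠ 1 := by
    intro h
    have hinj : ∀ g : G, g = 1 := fun g => Subtype.ext <| Units.ext <|
      endScalarExtension_injective i <| by
        rw [OneMemClass.coe_one, Units.val_one, map_one]
        exact DFunLike.congr_fun h g
    exact hab' (by rw [hinj a, hinj b])
  have hV : IsVerySimple k V G.subtype := by
    intro R hR
    have hconj : ∀ g, ∀ r ∈ R.extendEndScalars i, ρ g * r * ρ g⁻¹ ∈ R.extendEndScalars i := by
      intro g r hr
      change unitConj K _ (ρ.toHomUnits g) r ∈ _
      induction hr using Algebra.adjoin_induction with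
      | mem s hs =>
        obtain ⟨x, hx, rfl⟩ := hs
        refine Algebra.subset_adjoin ⟨_, hR g x hx, ?_⟩
        rw [map_mul, map_mul]
        rfl
      | algebraMap c =>
        rw [AlgEquiv.commutes]
        exact Subalgebra.algebraMap_mem _ c
      | add x y _ _ hx hy => rw [map_add]; exact add_mem hx hy
      | mul x y _ _ hx hy => rw [map_mul]; exact mul_mem hx hy
    exact (hG.subalgebra_eq_bot_or_eq_top hperf hZab ρ hρ1 (by simpa using hdim) _ hconj).imp
      (Subalgebra.eq_bot_of_extendEndScalars i) (Subalgebra.eq_top_of_extendEndScalars i)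
  have hscalar := hV.exists_eq_algebraMap ⟨a, b, hab'⟩ Z hZab
  have : Nontrivial (End k V) := by
    by_contra h
    rw [not_nontrivial_iff_subsingleton] at h
    exact hab' (Subtype.ext (Units.ext (Subsingleton.elim _ _)))
  refine ⟨?_, fun z hz => ?_, hV⟩
  · choose c hc using fun z : Z => hscalar z z.2
    have hinj : Function.Injective (algebraMap k (End k V)) := (algebraMap k (End k V)).injective
    let f : Z →* k :=
      { toFun := c
        map_one' := hinj (by rw [← hc, map_one]; rfl)
        map_mul' := fun x y => hinj (by rw [← hc, map_mul, ← hc, ← hc]; rfl) }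
    have hf : Function.Injective f := fun x y h =>
      Subtype.ext <| Subtype.ext <| Units.ext <| by
        rw [hc x, hc y]
        exact congrArg _ h
    have : Finite Z := Finite.of_injective f hf
    exact isCyclic_of_injective_ringHom f hf
  · obtain ⟨c, hc⟩ := hscalar z hz
    refine Subgroup.mem_center_iff.2 fun g => Subtype.ext (Units.ext ?_)
    change ((g : (End k V)ˣ) : End k V) * ((z : (End k V)ˣ) : End k V) =
      ((z : (End k V)ˣ) : End k V) * ((g : (End k V)ˣ) : End k V)
    rw [hc]
    exact (Algebra.commutes c _).symm
end

section
/- Let F be a field, V a finite-dimensional F-vector space, G a subgroup of Aut_F(V) such that the G-module V is very simple, and assume dim_F(V) ≥ 2. Let u be a nonzero element of End_F(V) such that the line F·u is stable under conjugation by G (for every g ∈ G, g u g⁻¹ ∈ F·u). Then u is a scalar operator, i.e., u ∈ F·Id. -/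
/-- If the line spanned by `u` is stable under conjugation by a unit `g`, then so is the
subalgebra generated by `u`. -/
theorem conj_mem_adjoin_singleton {k A : Type*} [CommSemiring k] [Semiring A] [Algebra k A]
    {u : A} (g : Aˣ) (hg : ∃ c : k, (g : A) * u * ((g⁻¹ : Aˣ) : A) = c • u)
    {r : A} (hr : r ∈ Algebra.adjoin k {u}) :
    (g : A) * r * ((g⁻¹ : Aˣ) : A) ∈ Algebra.adjoin k {u} := by
  induction hr using Algebra.adjoin_induction with
  | mem x hx =>
    obtain rfl := Set.mem_singleton_iff.mp hx
    obtain ⟨c, hc⟩ := hg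
    rw [hc]
    exact Subalgebra.smul_mem _ (Algebra.self_mem_adjoin_singleton k x) c
  | algebraMap c =>
    rw [← Algebra.commutes, mul_assoc, Units.mul_inv, mul_one]
    exact Subalgebra.algebraMap_mem _ c
  | add x y _ _ hx hy =>
    rw [mul_add, add_mul]
    exact add_mem hx hy
  | mul x y _ _ hx hy =>
    have hxy : (g : A) * (x * y) * ((g⁻¹ : Aˣ) : A) =
        (g * x * ((g⁻¹ : Aˣ) : A)) * (g * y * ((g⁻¹ : Aˣ) : A)) := by
      simp only [mul_assoc, Units.inv_mul_cancel_left]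
    rw [hxy]
    exact mul_mem hx hy

/-- Let `F` be a field, `V` a finite-dimensional `F`-vector space with
`dim_F V ≥ 2`, and `G` a subgroup of `Aut_F(V)` such that the `G`-module `V` is very
simple.  Let `u` be a nonzero element of `End_F(V)` such that the line `F·u` is stable
under conjugation by `G`.  Then `u` is a scalar operator, i.e. `u ∈ F·Id`. -/
theorem scalar_of_stable_line
    (F V : Type*) [Field F] [AddCommGroup V] [Module F V] [FiniteDimensional F V]
    (hdim : 2 ≤ Module.finrank F V)
    (G : Subgroup (Module.End F V)ˣ)
    (h : IsVerySimple F V G.subtype)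
    (u : Module.End F V) (hu : u ≠ 0)
    (hstab : ∀ g : G, ∃ c : F,
      ((g : (Module.End F V)ˣ) : Module.End F V) * u *
        (((g : (Module.End F V)ˣ)⁻¹ : (Module.End F V)ˣ) : Module.End F V) = c • u) :
    ∃ c : F, u = algebraMap F (Module.End F V) c := by
  have hmem : u ∈ Algebra.adjoin F {u} := Algebra.self_mem_adjoin_singleton F u
  suffices hcenter : u ∈ (⊥ : Subalgebra F (Module.End F V)) by
    obtain ⟨c, hc⟩ := Algebra.mem_bot.mp hcenter
    exact ⟨c, hc.symm⟩
  rcases h (Algebra.adjoin F {u}) fun g r hr => conj_mem_adjoin_singleton _ (hstab g) hr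
    with hbot | htop
  · exact hbot ▸ hmem
  · rw [← Algebra.IsCentral.center_eq_bot F (Module.End F V), Subalgebra.mem_center_iff]
    intro b
    have hb : b ∈ Algebra.adjoin F {u} := htop ▸ Algebra.mem_top
    exact (Algebra.commute_of_mem_adjoin_self hb).symm
end
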